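/- For every positive integer N and every smooth function w : X → ℝ on the two-sphere X, the spherical ensemble with N particles satisfies 𝔼_N[ exp( Σ_{i=1}^N w(x_i) − N ∫_X w dσ ) ] ≤ exp( (1/(8π)) ∫_X |∇_g w|² dV_g ), where ∇_g w is the Riemannian gradient of w. Equivalently, the H₀^{−s}(X)-valued random variable Y_N := Σ_{i=1}^N δ_{x_i} − N σ is sub-Gaussian: its moment generating function at every test function w is bounded by exp( ‖w‖²_{H¹(X)} / (8π) ) with ‖w‖²_{H¹(X)} = ∫_X |∇_g w|² dV_g. -/

import Mathlib

open MeasureTheory Real Metric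
open scoped ENNReal RealInnerProductSpace Manifold

noncomputable section

/-- Euclidean 3-space. -/
abbrev E3 : Type := EuclideanSpace ℝ (Fin 3)

/-- The unit two-sphere in `ℝ³`. -/
abbrev S2 : Type := Metric.sphere (0 : E3) 1

instance : Fact (Module.finrank ℝ E3 = 2 + 1) := ⟨finrank_euclideanSpace_fin⟩

/-- The Riemannian area measure `dV_g` on the unit two-sphere (total mass `4π`). -/
abbrev sphereArea : Measure S2 := (volume : Measure E3).toSphere

/-- The uniform probability measure `σ = dV_g / (4π)` on the unit two-sphere. -/
def sphereUniform : Measure S2 := (ENNReal.ofReal (4 * π))⁻¹ • sphereArea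

instance : IsFiniteMeasure sphereUniform := by
  constructor
  rw [sphereUniform, Measure.smul_apply, smul_eq_mul]
  exact ENNReal.mul_lt_top (by simp [Real.pi_pos]) (measure_lt_top _ _)

/-- The density (up to normalization) of the spherical ensemble:
`∏_{i ≠ j} |x_i − x_j| = ∏_{i < j} |x_i − x_j|²`. -/
def ensembleDensity (N : ℕ) (x : Fin N → S2) : ℝ≥0∞ :=
  ENNReal.ofReal (∏ p ∈ Finset.univ.offDiag, dist (x p.1) (x p.2))

/-- The spherical ensemble with `N` particles: the probability measure on `(S²)^N`
with density proportional to `∏_{i<j} |x_i − x_j|²` with respect to `σ^{⊗N}`. -/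
def sphericalEnsemble (N : ℕ) : Measure (Fin N → S2) :=
  (∫⁻ x, ensembleDensity N x ∂(Measure.pi fun _ : Fin N => sphereUniform))⁻¹ •
    (Measure.pi fun _ : Fin N => sphereUniform).withDensity (ensembleDensity N)

/-- The Legendre polynomial of degree `l` (Rodrigues' formula). -/
def legendreP (l : ℕ) : Polynomial ℝ :=
  Polynomial.C ((2 ^ l * l.factorial : ℝ)⁻¹) *
    (Polynomial.derivative^[l] ((Polynomial.X ^ 2 - 1) ^ l))

/-- The degree-`l` zonal harmonic kernel `Z_l(x,y) = ((2l+1)/(4π)) P_l(⟨x,y⟩)`, which is the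
reproducing kernel of the eigenspace of the Laplace–Beltrami operator with eigenvalue `l(l+1)`,
inside `L²(X, dV_g)`. -/
def zonal (l : ℕ) (x y : S2) : ℝ :=
  ((2 * l + 1 : ℝ) / (4 * π)) * (legendreP l).eval ⟪(x : E3), (y : E3)⟫

/-- `∫∫ f(x) Z_l(x,y) f(y) dV_g(x) dV_g(y)`, the squared `L²(dV_g)`-norm of the projection
of `f` onto the degree-`l` eigenspace of the Laplace–Beltrami operator. -/
def levelSq (l : ℕ) (f : S2 → ℝ) : ℝ :=
  ∫ x, ∫ y, f x * zonal l x y * f y ∂sphereArea ∂sphereArea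

/-- The squared Sobolev norm `‖f‖²_{H^s(X)} = ∫_X f (Δ_g)^s f dV_g`, expressed spectrally:
`Σ_{l≥1} (l(l+1))^s ‖proj_l f‖²_{L²(dV_g)}`, where `l(l+1)` are the positive eigenvalues of the
(positive) Laplace–Beltrami operator `Δ_g` on the unit two-sphere. -/
def sobNormSq (s : ℝ) (f : S2 → ℝ) : ℝ :=
  ∑' l : ℕ, (((l + 1) * (l + 2) : ℕ) : ℝ) ^ s * levelSq (l + 1) f

/-- Smooth real-valued functions on the two-sphere. -/
def SmoothOnSphere (f : S2 → ℝ) : Prop :=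
  ContMDiff (𝓡 2) 𝓘(ℝ, ℝ) (⊤ : ℕ∞) f

/-- The worst-case error `wce(x_N; s)` of the numerical integration rule with node set
`x_N = (x_1, …, x_N)` and smoothness parameter `s`. -/
def wce (N : ℕ) (s : ℝ) (x : Fin N → S2) : ℝ :=
  sSup { r | ∃ f : S2 → ℝ, SmoothOnSphere f ∧ sobNormSq s f ≤ 1 ∧
    r = |(∫ y, f y ∂sphereUniform) - (1 / N : ℝ) * ∑ i, f (x i)| }

end

noncomputable section
open MeasureTheory Real Metric
open scoped ENNReal RealInnerProductSpace Manifold Pointwise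

/-- Action of a linear isometry on the unit sphere. -/
def sphMap {V : Type*} [NormedAddCommGroup V] [InnerProductSpace ℝ V]
    (T : V ≃ₗᵢ[ℝ] V) (x : sphere (0 : V) 1) : sphere (0 : V) 1 :=
  ⟨T x, by simp⟩

lemma sphMap_coe {V : Type*} [NormedAddCommGroup V] [InnerProductSpace ℝ V]
    (T : V ≃ₗᵢ[ℝ] V) (x : sphere (0 : V) 1) : (sphMap T x : V) = T x := rfl

lemma sphMap_continuous {V : Type*} [NormedAddCommGroup V] [InnerProductSpace ℝ V]
    (T : V ≃ₗᵢ[ℝ] V) : Continuous (sphMap T) :=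
  Continuous.subtype_mk (T.continuous.comp continuous_subtype_val) _

lemma sphMap_mp {V : Type*} [NormedAddCommGroup V] [InnerProductSpace ℝ V]
    [FiniteDimensional ℝ V] [MeasurableSpace V] [BorelSpace V] (T : V ≃ₗᵢ[ℝ] V) :
    MeasurePreserving (sphMap T) (volume : Measure V).toSphere (volume : Measure V).toSphere := by
  refine ⟨(sphMap_continuous T).measurable, ?_⟩
  ext s hs
  have hs' : MeasurableSet (sphMap T ⁻¹' s) := (sphMap_continuous T).measurable hs
  rw [Measure.map_apply (sphMap_continuous T).measurable hs, Measure.toSphere_apply' _ hs,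
    Measure.toSphere_apply' _ hs']
  congr 1
  rw [← T.measurePreserving.measure_preimage_equiv (f := T.toMeasurableEquiv)
    (Set.Ioo (0 : ℝ) 1 • ((↑) '' s : Set V) : Set V)]
  congr 1
  ext x
  simp only [Set.mem_smul, Set.mem_image, Set.mem_preimage]
  constructor
  · rintro ⟨r, hr, y, ⟨z, hz, rfl⟩, rfl⟩
    exact ⟨r, hr, _, ⟨_, hz, rfl⟩, by simp [sphMap]⟩
  · rintro ⟨r, hr, y, ⟨z, hz, rfl⟩, h⟩
    refine ⟨r, hr, T.symm z, ⟨sphMap T.symm z, ?_, rfl⟩, ?_⟩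
    · convert hz; ext1; simp [sphMap]
    · apply T.injective
      simpa using h

instance : IsProbabilityMeasure sphereUniform := by
  constructor
  rw [sphereUniform, Measure.smul_apply, smul_eq_mul, Measure.toSphere_apply_univ,
    EuclideanSpace.volume_ball_fin_three]
  simp only [finrank_euclideanSpace, Fintype.card_fin]
  rw [show ((3 : ℕ) : ℝ≥0∞) = ENNReal.ofReal 3 by simp]
  rw [ENNReal.ofReal_one, one_pow, one_mul,
    ← ENNReal.ofReal_mul (by norm_num), show (3 : ℝ) * (π * 4 / 3) = 4 * π by ring]
  exact ENNReal.inv_mul_cancel (by simp [Real.pi_pos]) ENNReal.ofReal_ne_top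

lemma sphereUniform_mp (T : E3 ≃ₗᵢ[ℝ] E3) :
    MeasurePreserving (sphMap T) sphereUniform sphereUniform := by
  refine ⟨(sphMap_continuous T).measurable, ?_⟩
  rw [sphereUniform, Measure.map_smul, (sphMap_mp T).map_eq]

/-- Real 4-space, thought of as `ℂ²`. -/
abbrev E4 : Type := EuclideanSpace ℝ (Fin 4)
/-- The unit three-sphere. -/
abbrev S3 : Type := Metric.sphere (0 : E4) 1

/-- The uniform probability measure on `S³`. -/
def mu3 : Measure S3 :=
  ((volume : Measure E4).toSphere Set.univ)⁻¹ • (volume : Measure E4).toSphere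

instance : IsProbabilityMeasure mu3 := by
  constructor
  rw [mu3, Measure.smul_apply, smul_eq_mul]
  apply ENNReal.inv_mul_cancel
  · rw [Ne, Measure.measure_univ_eq_zero]
    exact Measure.toSphere_ne_zero _
  · exact measure_ne_top _ _

lemma mu3_mp (T : E4 ≃ₗᵢ[ℝ] E4) : MeasurePreserving (sphMap T) mu3 mu3 := by
  refine ⟨(sphMap_continuous T).measurable, ?_⟩
  rw [mu3, Measure.map_smul, (sphMap_mp T).map_eq]

/-- The homeomorphism of the sphere. -/
lemma mu3_integral (T : E4 ≃ₗᵢ[ℝ] E4) {G : Type*} [NormedAddCommGroup G] [NormedSpace ℝ G]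
    (F : S3 → G) (hF : Continuous F) :
    ∫ z, F (sphMap T z) ∂mu3 = ∫ z, F z ∂mu3 := by
  conv_rhs => rw [← (mu3_mp T).map_eq]
  rw [integral_map (sphMap_continuous T).aemeasurable hF.aestronglyMeasurable]

lemma S3.integrable {G : Type*} [NormedAddCommGroup G]
    [SecondCountableTopologyEither S3 G] {F : S3 → G} (hF : Continuous F) :
    Integrable F mu3 := by
  obtain ⟨C, hC⟩ := isCompact_univ.exists_bound_of_continuousOn hF.continuousOn
  exact Integrable.of_bound hF.aestronglyMeasurable C (by simpa using Filter.Eventually.of_forall hC)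

lemma S2.integrable {G : Type*} [NormedAddCommGroup G]
    [SecondCountableTopologyEither S2 G] {F : S2 → G} (hF : Continuous F) :
    Integrable F sphereUniform := by
  obtain ⟨C, hC⟩ := isCompact_univ.exists_bound_of_continuousOn hF.continuousOn
  exact Integrable.of_bound hF.aestronglyMeasurable C (by simpa using Filter.Eventually.of_forall hC)

/-- first complex coordinate -/
def za (x : E4) : ℂ := ⟨x 0, x 1⟩
/-- second complex coordinate -/
def zb (x : E4) : ℂ := ⟨x 2, x 3⟩

lemma za_eq (x : E4) : za x = (x 0 : ℂ) + (x 1 : ℂ) * Complex.I := by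
  apply Complex.ext <;> simp [za]
lemma zb_eq (x : E4) : zb x = (x 2 : ℂ) + (x 3 : ℂ) * Complex.I := by
  apply Complex.ext <;> simp [zb]

@[fun_prop] lemma za_cont : Continuous za := by
  rw [show za = _ from funext za_eq]; fun_prop
@[fun_prop] lemma zb_cont : Continuous zb := by
  rw [show zb = _ from funext zb_eq]; fun_prop

lemma norm_sq_E4 (x : E4) : ‖x‖ ^ 2 = Complex.normSq (za x) + Complex.normSq (zb x) := by
  rw [EuclideanSpace.norm_sq_eq, Fin.sum_univ_four]
  simp [za, zb, Complex.normSq_apply]; ring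

lemma S3_normSq (z : S3) : Complex.normSq (za z) + Complex.normSq (zb z) = 1 := by
  rw [← norm_sq_E4]; simp

lemma S3_eq (z : S3) : za z * (starRingEnd ℂ) (za z) + zb z * (starRingEnd ℂ) (zb z) = 1 := by
  rw [Complex.mul_conj, Complex.mul_conj]; exact_mod_cast S3_normSq z

/-- build a point of `E4` -/
def mkE4 (a b : ℂ) : E4 := !₂[a.re, a.im, b.re, b.im]
@[simp] lemma za_mk (a b : ℂ) : za (mkE4 a b) = a := by apply Complex.ext <;> simp [za, mkE4]
@[simp] lemma zb_mk (a b : ℂ) : zb (mkE4 a b) = b := by apply Complex.ext <;> simp [zb, mkE4]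

lemma E4_ext {x y : E4} (h1 : za x = za y) (h2 : zb x = zb y) : x = y := by
  rw [Complex.ext_iff] at h1 h2
  simp only [za, zb] at h1 h2
  ext i; fin_cases i
  · exact h1.1
  · exact h1.2
  · exact h2.1
  · exact h2.2

/-- A linear isometry given by a norm-preserving additive map. -/
def mkIso (f : E4 →ₗ[ℝ] E4) (h : ∀ x, ‖f x‖ = ‖x‖) : E4 ≃ₗᵢ[ℝ] E4 :=
  LinearIsometry.toLinearIsometryEquiv ⟨f, h⟩ rfl

@[simp] lemma mkIso_apply (f : E4 →ₗ[ℝ] E4) (h : ∀ x, ‖f x‖ = ‖x‖) (x : E4) :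
    mkIso f h x = f x := rfl

lemma za_add (x y : E4) : za (x + y) = za x + za y := by apply Complex.ext <;> simp [za]
lemma zb_add (x y : E4) : zb (x + y) = zb x + zb y := by apply Complex.ext <;> simp [zb]
lemma za_smul (r : ℝ) (y : E4) : za (r • y) = r * za y := by apply Complex.ext <;> simp [za]
lemma zb_smul (r : ℝ) (y : E4) : zb (r • y) = r * zb y := by apply Complex.ext <;> simp [zb]

/-- General real-linear map of `ℂ²` from a real-linear formula. -/
def mkLin (f g : ℂ → ℂ → ℂ)
    (hf : ∀ a b c d, f (a + c) (b + d) = f a b + f c d)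
    (hg : ∀ a b c d, g (a + c) (b + d) = g a b + g c d)
    (hf' : ∀ (r : ℝ) a b, f (r * a) (r * b) = r * f a b)
    (hg' : ∀ (r : ℝ) a b, g (r * a) (r * b) = r * g a b) : E4 →ₗ[ℝ] E4 where
  toFun x := mkE4 (f (za x) (zb x)) (g (za x) (zb x))
  map_add' x y := by
    apply E4_ext <;> simp [za_add, zb_add, hf, hg]
  map_smul' x y := by
    apply E4_ext <;> simp [za_smul, zb_smul, hf', hg']

/-- The unitary with rows determined by a unit vector `(a, b)`:
`z ↦ (z₁ ā + z₂ b̄, a z₂ − b z₁)`. -/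
def uni (a b : ℂ) (h : Complex.normSq a + Complex.normSq b = 1) : E4 ≃ₗᵢ[ℝ] E4 :=
  mkIso (mkLin (fun z w => z * (starRingEnd ℂ) a + w * (starRingEnd ℂ) b)
    (fun z w => a * w - b * z) (by intros; ring) (by intros; ring) (by intros; ring)
    (by intros; ring)) (by
      intro x
      rw [← sq_eq_sq₀ (norm_nonneg _) (norm_nonneg _), norm_sq_E4, norm_sq_E4]
      simp only [mkLin, LinearMap.coe_mk, AddHom.coe_mk, za_mk, zb_mk]
      have : Complex.normSq (za x) + Complex.normSq (zb x) =
        (Complex.normSq (za x) + Complex.normSq (zb x)) * (Complex.normSq a + Complex.normSq b) := by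
        rw [h, mul_one]
      rw [this]
      simp [Complex.normSq_apply]; ring)

lemma za_uni (a b : ℂ) (h) (x : E4) :
    za (uni a b h x) = za x * (starRingEnd ℂ) a + zb x * (starRingEnd ℂ) b := by
  simp [uni, mkLin]
lemma zb_uni (a b : ℂ) (h) (x : E4) :
    zb (uni a b h x) = a * zb x - b * za x := by
  simp [uni, mkLin]

/-- diagonal unitary -/
def dia (a b : ℂ) (ha : Complex.normSq a = 1) (hb : Complex.normSq b = 1) : E4 ≃ₗᵢ[ℝ] E4 :=
  mkIso (mkLin (fun z _ => a * z) (fun _ w => b * w) (by intros; ring) (by intros; ring)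
    (by intros; ring) (by intros; ring)) (by
      intro x
      rw [← sq_eq_sq₀ (norm_nonneg _) (norm_nonneg _), norm_sq_E4, norm_sq_E4]
      simp [mkLin, ha, hb])
lemma za_dia (a b : ℂ) (ha hb) (x : E4) : za (dia a b ha hb x) = a * za x := by simp [dia, mkLin]
lemma zb_dia (a b : ℂ) (ha hb) (x : E4) : zb (dia a b ha hb x) = b * zb x := by simp [dia, mkLin]

/-- Hopf map into `E3`. -/
def hopf (x : E4) : E3 :=
  !₂[2 * (za x * (starRingEnd ℂ) (zb x)).re, 2 * (za x * (starRingEnd ℂ) (zb x)).im,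
    Complex.normSq (za x) - Complex.normSq (zb x)]

lemma hopf_norm (x : E4) : ‖hopf x‖ = ‖x‖ ^ 2 := by
  rw [← sq_eq_sq₀ (norm_nonneg _) (by positivity), norm_sq_E4, EuclideanSpace.norm_sq_eq,
    Fin.sum_univ_three]
  simp [hopf, Complex.normSq_apply, sq_abs, mul_pow]; ring

/-- Hopf map -/
def hopfS (z : S3) : S2 := ⟨hopf z, by simp [hopf_norm]⟩

@[fun_prop] lemma hopf_cont : Continuous hopf := by
  unfold hopf
  apply (PiLp.continuous_toLp 2 _).comp
  apply continuous_pi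
  intro i
  fin_cases i
  · exact continuous_const.mul (Complex.continuous_re.comp (by fun_prop))
  · exact continuous_const.mul (Complex.continuous_im.comp (by fun_prop))
  · exact (Complex.continuous_normSq.comp (by fun_prop)).sub
      (Complex.continuous_normSq.comp (by fun_prop))

@[fun_prop] lemma hopfS_cont : Continuous hopfS :=
  Continuous.subtype_mk (hopf_cont.comp continuous_subtype_val) _

/-- hermitian product -/
def hp (z w : E4) : ℂ := za z * (starRingEnd ℂ) (za w) + zb z * (starRingEnd ℂ) (zb w)

lemma inner_hopf (z w : E4) : ⟪hopf z, hopf w⟫ = 2 * Complex.normSq (hp z w) -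
    (Complex.normSq (za z) + Complex.normSq (zb z)) *
    (Complex.normSq (za w) + Complex.normSq (zb w)) := by
  simp [hopf, hp, PiLp.inner_apply, Fin.sum_univ_three, Complex.normSq_apply]; ring

lemma inner_hopfS (z w : S3) :
    ⟪(hopfS z : E3), (hopfS w : E3)⟫ = 2 * Complex.normSq (hp z w) - 1 := by
  simp only [hopfS]
  rw [inner_hopf, S3_normSq, S3_normSq]; ring

lemma normSq_hp_add (z w : S3) : Complex.normSq (hp z w) +
    Complex.normSq (za z * zb w - zb z * za w) = 1 := by
  have : Complex.normSq (hp z w) +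
    Complex.normSq (za z * zb w - zb z * za w) =
    (Complex.normSq (za z) + Complex.normSq (zb z)) *
    (Complex.normSq (za w) + Complex.normSq (zb w)) := by
    simp [hp, Complex.normSq_apply]; ring
  rw [this, S3_normSq, S3_normSq]; ring

lemma dist_hopfS (z w : S3) :
    dist (hopfS z) (hopfS w) = 2 * ‖za z * zb w - zb z * za w‖ := by
  rw [← sq_eq_sq₀ dist_nonneg (by positivity), Subtype.dist_eq, dist_eq_norm,
    norm_sub_sq_real, inner_hopfS, mul_pow, ← Complex.normSq_eq_norm_sq]
  have := normSq_hp_add z w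
  simp; linarith

lemma hopf_surj (y : S2) : ∃ z : S3, hopfS z = y := by
  have hy : (y : E3) 0 ^ 2 + (y : E3) 1 ^ 2 + (y : E3) 2 ^ 2 = 1 := by
    have : ‖(y : E3)‖ ^ 2 = 1 := by simp
    rw [EuclideanSpace.norm_sq_eq, Fin.sum_univ_three] at this
    simpa using this
  set a := (y : E3) 0
  set b := (y : E3) 1
  set c := (y : E3) 2
  by_cases hc : c = -1
  · have ha : a = 0 := by nlinarith
    have hb : b = 0 := by nlinarith
    refine ⟨⟨mkE4 0 1, ?_⟩, ?_⟩
    · rw [mem_sphere_zero_iff_norm, ← sq_eq_sq₀ (norm_nonneg _) (by positivity), norm_sq_E4]; simp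
    · ext i
      fin_cases i
      · simpa [hopfS, hopf] using ha.symm
      · simpa [hopfS, hopf] using hb.symm
      · simpa [hopfS, hopf] using hc.symm
  · have hc1 : 0 < 1 + c := by
      rcases lt_or_gt_of_ne hc with h | h
      · nlinarith
      · linarith
    set r := Real.sqrt ((1 + c) / 2)
    have hr : r * r = (1 + c) / 2 := Real.mul_self_sqrt (by positivity)
    have hr0 : 0 < r := Real.sqrt_pos.2 (by positivity)
    have h1 : Complex.normSq (mkE4 r ⟨a / (2 * r), - b / (2 * r)⟩ |> za) = (1 + c) / 2 := by
      simp [Complex.normSq_apply, hr]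
    have h2 : Complex.normSq (mkE4 r ⟨a / (2 * r), - b / (2 * r)⟩ |> zb) = (1 - c) / 2 := by
      simp only [zb_mk, Complex.normSq_apply]
      have : a / (2 * r) * (a / (2 * r)) + -b / (2 * r) * (-b / (2 * r)) =
        (a ^ 2 + b ^ 2) / (4 * (r * r)) := by field_simp; ring
      rw [this, hr]
      field_simp
      nlinarith
    refine ⟨⟨mkE4 r ⟨a / (2 * r), - b / (2 * r)⟩, ?_⟩, ?_⟩
    · rw [mem_sphere_zero_iff_norm, ← sq_eq_sq₀ (norm_nonneg _) (by positivity), norm_sq_E4]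
      rw [h1, h2]; ring
    · ext i
      fin_cases i
      · show 2 * _ = a
        simp
        field_simp
      · show 2 * _ = b
        simp
        field_simp
      · show Complex.normSq _ - Complex.normSq _ = c
        exact (congrArg₂ (· - ·) h1 h2).trans (by ring)


lemma exists_iso (x y : S2) : ∃ T : E3 ≃ₗᵢ[ℝ] E3, T x = y := by
  refine ⟨(ℝ ∙ ((x : E3) - y))ᗮ.reflection, ?_⟩
  exact Submodule.reflection_sub (by simp)

/-- zonal integrals on `S2` -/
lemma zonal_S2 (φ : ℝ → ℂ) (hφ : Continuous φ) (x y : S2) :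
    ∫ u : S2, φ ⟪(u : E3), (x : E3)⟫ ∂sphereUniform =
      ∫ u : S2, φ ⟪(u : E3), (y : E3)⟫ ∂sphereUniform := by
  obtain ⟨T, hT⟩ := exists_iso x y
  conv_rhs => rw [← (sphereUniform_mp T).map_eq]
  rw [integral_map (sphMap_continuous T).aemeasurable
    (Continuous.aestronglyMeasurable (by fun_prop))]
  simp only [sphMap_coe, ← hT, LinearIsometryEquiv.inner_map_map]

lemma zonal_S3 (φ : ℝ → ℂ) (hφ : Continuous φ) (w : S3) :
    ∫ z : S3, φ (Complex.normSq (hp z w)) ∂mu3 =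
      ∫ z : S3, φ (Complex.normSq (za z)) ∂mu3 := by
  have hc : Continuous fun z : S3 => φ (Complex.normSq (za z)) :=
    hφ.comp (Complex.continuous_normSq.comp (za_cont.comp continuous_subtype_val))
  rw [← mu3_integral (uni _ _ (S3_normSq w)) _ hc]
  simp only [sphMap_coe, za_uni, hp]

lemma zonal_hopf (φ : ℝ → ℂ) (hφ : Continuous φ) (x y : S2) :
    ∫ u : S3, φ ⟪(hopfS u : E3), (x : E3)⟫ ∂mu3 =
      ∫ u : S3, φ ⟪(hopfS u : E3), (y : E3)⟫ ∂mu3 := by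
  obtain ⟨z, rfl⟩ := hopf_surj x
  obtain ⟨w, rfl⟩ := hopf_surj y
  simp only [inner_hopfS]
  have h2 : Continuous fun t : ℝ => φ (2 * t - 1) := by fun_prop
  rw [zonal_S3 (fun t => φ (2 * t - 1)) h2 z, zonal_S3 (fun t => φ (2 * t - 1)) h2 w]

lemma zonal_eq (φ : ℝ → ℂ) (hφ : Continuous φ) (x : S2) :
    ∫ u : S3, φ ⟪(hopfS u : E3), (x : E3)⟫ ∂mu3 =
      ∫ u : S2, φ ⟪(u : E3), (x : E3)⟫ ∂sphereUniform := by
  have h1 : ∫ v : S2, ∫ u : S3, φ ⟪(hopfS u : E3), (v : E3)⟫ ∂mu3 ∂sphereUniform =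
      ∫ u : S3, φ ⟪(hopfS u : E3), (x : E3)⟫ ∂mu3 := by
    rw [integral_congr_ae (Filter.Eventually.of_forall fun v => zonal_hopf φ hφ v x)]
    simp
  rw [← h1, integral_integral_swap]
  · have : ∀ u : S3, ∫ v : S2, φ ⟪(hopfS u : E3), (v : E3)⟫ ∂sphereUniform =
      ∫ u : S2, φ ⟪(u : E3), (x : E3)⟫ ∂sphereUniform := by
      intro u
      rw [← zonal_S2 φ hφ (hopfS u) x]
      simp only [real_inner_comm]
    simp only [this]; simp
  · have hc : Continuous (Function.uncurry fun (v : S2) (u : S3) =>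
        φ ⟪(hopfS u : E3), (v : E3)⟫) := by
      unfold Function.uncurry; fun_prop
    obtain ⟨C, hC⟩ := isCompact_univ.exists_bound_of_continuousOn hc.continuousOn
    exact Integrable.of_bound hc.aestronglyMeasurable C
      (by simpa using Filter.Eventually.of_forall hC)

lemma hopf_map : mu3.map (fun z => (hopfS z : E3)) = sphereUniform.map (fun x : S2 => (x : E3)) := by
  have m1 : Measurable (fun z : S3 => (hopfS z : E3)) :=
    (continuous_subtype_val.comp hopfS_cont).measurable
  have m2 : Measurable (fun x : S2 => (x : E3)) := continuous_subtype_val.measurable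
  apply Measure.ext_of_charFun
  ext t
  rw [charFun_apply, charFun_apply, integral_map m1.aemeasurable
    (Continuous.aestronglyMeasurable (by fun_prop)), integral_map m2.aemeasurable
    (Continuous.aestronglyMeasurable (by fun_prop))]
  by_cases ht : t = 0
  · subst ht; simp
  · have hn : ‖t‖ ≠ 0 := norm_ne_zero_iff.2 ht
    have h := zonal_eq (fun s => Complex.exp ((‖t‖ * s : ℝ) * Complex.I)) (by fun_prop)
      ⟨(‖t‖⁻¹ • t), by simp [norm_smul, hn]⟩
    simp only [inner_smul_right, mul_inv_cancel_left₀ hn] at h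
    exact h

lemma hopf_mp : MeasurePreserving hopfS mu3 sphereUniform := by
  refine ⟨hopfS_cont.measurable, ?_⟩
  have he : MeasurableEmbedding (fun x : S2 => (x : E3)) :=
    MeasurableEmbedding.subtype_coe isClosed_sphere.measurableSet
  have h := hopf_map
  rw [← Function.comp_def (fun x : S2 => (x : E3)) hopfS,
    ← Measure.map_map he.measurable hopfS_cont.measurable] at h
  rw [← he.comap_map (mu3.map hopfS), h, he.comap_map]

lemma hopf_integral {G : Type*} [NormedAddCommGroup G] [NormedSpace ℝ G]
    (F : S2 → G) (hF : Continuous F) :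
    ∫ z, F (hopfS z) ∂mu3 = ∫ x, F x ∂sphereUniform := by
  rw [← hopf_mp.map_eq, integral_map hopfS_cont.aemeasurable]
  rw [hopf_mp.map_eq]
  exact hF.aestronglyMeasurable

end

noncomputable section
open MeasureTheory Real Metric
open scoped ENNReal RealInnerProductSpace Manifold Pointwise

local notation "conj" => starRingEnd ℂ

/-- The two rotation flows: `cos s + sin s · τ J`, with `J z = (-z̄₂, z̄₁)`, `|τ| = 1`. -/
def rot (τ : ℂ) (hτ : Complex.normSq τ = 1) (s : ℝ) : E4 ≃ₗᵢ[ℝ] E4 :=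
  mkIso (mkLin (fun z w => Real.cos s * z - Real.sin s * τ * conj w)
    (fun z w => Real.cos s * w + Real.sin s * τ * conj z)
    (by intros; simp only [map_add]; ring) (by intros; simp only [map_add]; ring)
    (by intros; simp only [map_mul, Complex.conj_ofReal]; ring)
    (by intros; simp only [map_mul, Complex.conj_ofReal]; ring)) (by
      intro x
      rw [← sq_eq_sq₀ (norm_nonneg _) (norm_nonneg _), norm_sq_E4, norm_sq_E4]
      simp only [mkLin, LinearMap.coe_mk, AddHom.coe_mk, za_mk, zb_mk]
      have h1 := Real.sin_sq_add_cos_sq s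
      rw [Complex.normSq_apply] at hτ
      simp only [Complex.normSq_apply, Complex.sub_re, Complex.mul_re, Complex.ofReal_re,
        Complex.ofReal_im, Complex.conj_re, Complex.conj_im, Complex.sub_im, Complex.mul_im,
        Complex.add_re, Complex.add_im]
      linear_combination (((za x).re ^ 2 + (za x).im ^ 2 + (zb x).re ^ 2 + (zb x).im ^ 2)) * h1
        + Real.sin s ^ 2 * (((za x).re ^ 2 + (za x).im ^ 2 + (zb x).re ^ 2 + (zb x).im ^ 2)) * hτ)

lemma za_rot (τ : ℂ) (hτ) (s : ℝ) (x : E4) :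
    za (rot τ hτ s x) = Real.cos s * za x - Real.sin s * τ * conj (zb x) := by
  simp [rot, mkLin]
lemma zb_rot (τ : ℂ) (hτ) (s : ℝ) (x : E4) :
    zb (rot τ hτ s x) = Real.cos s * zb x + Real.sin s * τ * conj (za x) := by
  simp [rot, mkLin]

lemma rot_add (τ : ℂ) (hτ) (s t : ℝ) (x : E4) :
    rot τ hτ (s + t) x = rot τ hτ s (rot τ hτ t x) := by
  have h : τ * conj τ = 1 := by rw [Complex.mul_conj, hτ]; simp
  apply E4_ext
  · simp only [za_rot, zb_rot, Real.cos_add, Real.sin_add, map_add, map_mul, Complex.conj_ofReal,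
      Complex.conj_conj, Complex.ofReal_add, Complex.ofReal_sub, Complex.ofReal_mul]
    linear_combination (Real.sin s * Real.sin t * za x : ℂ) * h
  · simp only [za_rot, zb_rot, Real.cos_add, Real.sin_add, map_add, map_sub, map_mul,
      Complex.conj_ofReal,
      Complex.conj_conj, Complex.ofReal_add, Complex.ofReal_sub, Complex.ofReal_mul]
    linear_combination (Real.sin s * Real.sin t * zb x : ℂ) * h

lemma rot_zero (τ : ℂ) (hτ) (x : E4) : rot τ hτ 0 x = x := by
  apply E4_ext <;> simp [za_rot, zb_rot]

/-- Flow on `S3`. -/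
def flow (τ : ℂ) (hτ : Complex.normSq τ = 1) (s : ℝ) (z : S3) : S3 := sphMap (rot τ hτ s) z

lemma flow_add (τ : ℂ) (hτ) (s t : ℝ) (x : S3) :
    flow τ hτ (s + t) x = flow τ hτ s (flow τ hτ t x) :=
  Subtype.ext (rot_add τ hτ s t x)
lemma flow_zero (τ : ℂ) (hτ) (x : S3) : flow τ hτ 0 x = x := Subtype.ext (rot_zero τ hτ x)
lemma flow_cont (τ : ℂ) (hτ) (s : ℝ) : Continuous (flow τ hτ s) := sphMap_continuous _

lemma hone : Complex.normSq 1 = 1 := by simp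
lemma hI : Complex.normSq Complex.I = 1 := by simp

/-- `Dd F A B`: `F` has continuous derivatives `D F = A`, `D̄ F = B` on `S³`. -/
structure Dd (F A B : S3 → ℂ) : Prop where
  c : Continuous F
  cA : Continuous A
  cB : Continuous B
  d1 : ∀ z, HasDerivAt (fun s => F (flow 1 hone s z)) (A z + B z) 0
  d2 : ∀ z, HasDerivAt (fun s => F (flow Complex.I hI s z)) (Complex.I * (A z - B z)) 0

lemma flow_ibp (τ : ℂ) (hτ : Complex.normSq τ = 1) (F G : S3 → ℂ) (cF : Continuous F)
    (cG : Continuous G)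
    (d : ∀ z, HasDerivAt (fun s => F (flow τ hτ s z)) (G z) 0) : ∫ z, G z ∂mu3 = 0 := by
  have d' : ∀ z s, HasDerivAt (fun s => F (flow τ hτ s z)) (G (flow τ hτ s z)) s := by
    intro z s
    have h := d (flow τ hτ s z)
    simp only [← flow_add] at h
    have h2 : HasDerivAt (fun x : ℝ => x - s) 1 s := (hasDerivAt_id s).sub_const s
    have h3 := HasDerivAt.scomp_of_eq (g₁ := fun x => F (flow τ hτ (x + s) z)) s h h2 (by simp)
    simpa [Function.comp_def] using h3
  obtain ⟨C, hC⟩ := isCompact_univ.exists_bound_of_continuousOn cG.continuousOn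
  have := (hasDerivAt_integral_of_dominated_loc_of_deriv_le (μ := mu3) (x₀ := (0 : ℝ))
    (s := Set.univ) (F := fun s z => F (flow τ hτ s z)) (F' := fun s z => G (flow τ hτ s z))
    (bound := fun _ => C) Filter.univ_mem
    (Filter.Eventually.of_forall fun s => (cF.comp (flow_cont τ hτ s)).aestronglyMeasurable)
    (S3.integrable (cF.comp (flow_cont τ hτ 0)))
    ((cG.comp (flow_cont τ hτ 0)).aestronglyMeasurable)
    (Filter.Eventually.of_forall fun z s _ => hC _ trivial) (integrable_const C)
    (Filter.Eventually.of_forall fun z s _ => d' z s)).2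
  have hc : ∀ s, ∫ z, F (flow τ hτ s z) ∂mu3 = ∫ z, F z ∂mu3 := fun s =>
    mu3_integral (rot τ hτ s) F cF
  simp only [hc, flow_zero] at this
  exact this.unique (hasDerivAt_const _ _)

namespace Dd
variable {F A B F' A' B' : S3 → ℂ}

lemma ibp (h : Dd F A B) : ∫ z, A z ∂mu3 = 0 ∧ ∫ z, B z ∂mu3 = 0 := by
  have h1 := flow_ibp _ _ F _ h.c (h.cA.add h.cB) h.d1
  have h2 := flow_ibp _ _ F _ h.c (continuous_const.mul (h.cA.sub h.cB)) h.d2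
  have iA := S3.integrable h.cA
  have iB := S3.integrable h.cB
  simp only [Pi.mul_apply, Pi.sub_apply, Pi.add_apply] at h1 h2
  rw [integral_const_mul, integral_sub iA iB] at h2
  rw [integral_add iA iB] at h1
  have h3 := (mul_eq_zero.1 h2).resolve_left Complex.I_ne_zero
  constructor
  · linear_combination (h1 + h3) / 2
  · linear_combination (h1 - h3) / 2

lemma congr (h : Dd F A B) (hF : ∀ z, F' z = F z) (hA : ∀ z, A' z = A z) (hB : ∀ z, B' z = B z) :
    Dd F' A' B' := by
  rw [funext hF, funext hA, funext hB]; exact h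

lemma add (h : Dd F A B) (h' : Dd F' A' B') :
    Dd (fun z => F z + F' z) (fun z => A z + A' z) (fun z => B z + B' z) where
  c := h.c.add h'.c
  cA := h.cA.add h'.cA
  cB := h.cB.add h'.cB
  d1 z := ((h.d1 z).add (h'.d1 z)).congr_deriv (by ring)
  d2 z := ((h.d2 z).add (h'.d2 z)).congr_deriv (by ring)

lemma mul (h : Dd F A B) (h' : Dd F' A' B') :
    Dd (fun z => F z * F' z) (fun z => A z * F' z + F z * A' z)
      (fun z => B z * F' z + F z * B' z) where
  c := h.c.mul h'.c
  cA := (h.cA.mul h'.c).add (h.c.mul h'.cA)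
  cB := (h.cB.mul h'.c).add (h.c.mul h'.cB)
  d1 z := ((h.d1 z).mul (h'.d1 z)).congr_deriv (by simp only [flow_zero]; ring)
  d2 z := ((h.d2 z).mul (h'.d2 z)).congr_deriv (by simp only [flow_zero]; ring)

lemma const (a : ℂ) : Dd (fun _ => a) (fun _ => 0) (fun _ => 0) where
  c := continuous_const
  cA := continuous_const
  cB := continuous_const
  d1 z := (hasDerivAt_const _ _).congr_deriv (by ring)
  d2 z := (hasDerivAt_const _ _).congr_deriv (by ring)

lemma smul (a : ℂ) (h : Dd F A B) :
    Dd (fun z => a * F z) (fun z => a * A z) (fun z => a * B z) :=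
  ((const a).mul h).congr (fun _ => rfl) (fun z => by ring) (fun z => by ring)

lemma sum {ι : Type*} (s : Finset ι) {F A B : ι → S3 → ℂ} (h : ∀ i ∈ s, Dd (F i) (A i) (B i)) :
    Dd (fun z => ∑ i ∈ s, F i z) (fun z => ∑ i ∈ s, A i z) (fun z => ∑ i ∈ s, B i z) := by
  classical
  induction s using Finset.induction_on with
  | empty => simpa using const 0
  | insert i s hi ih =>
    simp only [Finset.sum_insert hi]
    exact (h i (Finset.mem_insert_self i s)).add
      (ih fun j hj => h j (Finset.mem_insert_of_mem hj))

lemma conj' (h : Dd F A B) :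
    Dd (fun z => conj (F z)) (fun z => conj (B z)) (fun z => conj (A z)) where
  c := Complex.continuous_conj.comp h.c
  cA := Complex.continuous_conj.comp h.cB
  cB := Complex.continuous_conj.comp h.cA
  d1 z := by
    have := (Complex.conjCLE : ℂ →L[ℝ] ℂ).hasFDerivAt.comp_hasDerivAt (0 : ℝ) (h.d1 z)
    exact this.congr_deriv (by simp; ring)
  d2 z := by
    have := (Complex.conjCLE : ℂ →L[ℝ] ℂ).hasFDerivAt.comp_hasDerivAt (0 : ℝ) (h.d2 z)
    exact this.congr_deriv (by simp; ring)

lemma pow (h : Dd F A B) (n : ℕ) :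
    Dd (fun z => F z ^ n) (fun z => n * F z ^ (n - 1) * A z) (fun z => n * F z ^ (n - 1) * B z) where
  c := h.c.pow n
  cA := (continuous_const.mul (h.c.pow _)).mul h.cA
  cB := (continuous_const.mul (h.c.pow _)).mul h.cB
  d1 z := ((h.d1 z).pow n).congr_deriv (by simp only [flow_zero]; ring)
  d2 z := ((h.d2 z).pow n).congr_deriv (by simp only [flow_zero]; ring)

/-- composition with a real function of a real-valued function -/
lemma comp_real {f : S3 → ℝ} {φ φ' : ℝ → ℝ} (h : Dd (fun z => (f z : ℂ)) A B)
    (hφ : ∀ z, HasDerivAt φ (φ' (f z)) (f z)) (hc : Continuous fun z => φ' (f z))  :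
    Dd (fun z => (φ (f z) : ℂ)) (fun z => φ' (f z) * A z) (fun z => φ' (f z) * B z) := by
  have cf : Continuous f := by
    have := Complex.continuous_re.comp h.c
    simpa [Function.comp_def] using this
  have key : ∀ (g : ℝ → ℝ) (d : ℂ) (z : S3), g 0 = f z →
      HasDerivAt (fun s => (g s : ℂ)) d 0 →
      HasDerivAt (fun s => (φ (g s) : ℂ)) (φ' (f z) * d) 0 := by
    intro g d z hg hd
    have h1 : HasDerivAt g d.re 0 := by
      have := Complex.reCLM.hasFDerivAt.comp_hasDerivAt (0 : ℝ) hd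
      simpa [Function.comp_def] using this
    have h2 : d = d.re := (hd.unique h1.ofReal_comp)
    have h3 := (HasDerivAt.comp_of_eq (0 : ℝ) (hφ z) h1 hg.symm).ofReal_comp
    rw [h2]
    exact h3.congr_deriv (by push_cast; rfl)
  refine ⟨?_, ?_, ?_, ?_, ?_⟩
  · apply Complex.continuous_ofReal.comp
    rw [continuous_iff_continuousAt]
    intro z
    exact (hφ z).continuousAt.comp cf.continuousAt
  · exact (Complex.continuous_ofReal.comp hc).mul h.cA
  · exact (Complex.continuous_ofReal.comp hc).mul h.cB
  · intro z
    exact (key _ _ z (by simp [flow_zero]) (h.d1 z)).congr_deriv (by ring)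
  · intro z
    exact (key _ _ z (by simp [flow_zero]) (h.d2 z)).congr_deriv (by ring)

lemma coa : Dd (fun z => za z) (fun z => - conj (zb z)) (fun _ => 0) where
  c := by fun_prop
  cA := (Complex.continuous_conj.comp (by fun_prop)).neg
  cB := continuous_const
  d1 z := by
    have h1 := (Real.hasDerivAt_cos 0).ofReal_comp
    have h2 := (Real.hasDerivAt_sin 0).ofReal_comp
    simp only [flow, sphMap_coe, za_rot]
    exact ((h1.mul_const (za z)).sub ((h2.mul_const 1).mul_const (conj (zb z)))).congr_deriv
      (by simp)
  d2 z := by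
    have h1 := (Real.hasDerivAt_cos 0).ofReal_comp
    have h2 := (Real.hasDerivAt_sin 0).ofReal_comp
    simp only [flow, sphMap_coe, za_rot]
    exact ((h1.mul_const (za z)).sub ((h2.mul_const Complex.I).mul_const (conj (zb z)))).congr_deriv
      (by simp)

lemma cob : Dd (fun z => zb z) (fun z => conj (za z)) (fun _ => 0) where
  c := by fun_prop
  cA := (Complex.continuous_conj.comp (by fun_prop))
  cB := continuous_const
  d1 z := by
    have h1 := (Real.hasDerivAt_cos 0).ofReal_comp
    have h2 := (Real.hasDerivAt_sin 0).ofReal_comp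
    simp only [flow, sphMap_coe, zb_rot]
    exact ((h1.mul_const (zb z)).add ((h2.mul_const 1).mul_const (conj (za z)))).congr_deriv
      (by simp)
  d2 z := by
    have h1 := (Real.hasDerivAt_cos 0).ofReal_comp
    have h2 := (Real.hasDerivAt_sin 0).ofReal_comp
    simp only [flow, sphMap_coe, zb_rot]
    exact ((h1.mul_const (zb z)).add ((h2.mul_const Complex.I).mul_const (conj (za z)))).congr_deriv
      (by simp)

end Dd

/-- moments -/
def mom (a b : ℕ) : ℝ := ∫ z : S3, Complex.normSq (za z) ^ a * Complex.normSq (zb z) ^ b ∂mu3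

lemma mom_cont (a b : ℕ) :
    Continuous fun z : S3 => Complex.normSq (za z) ^ a * Complex.normSq (zb z) ^ b := by
  have := Complex.continuous_normSq
  fun_prop

lemma mom_zero : mom 0 0 = 1 := by simp [mom]

lemma mom_add (a b : ℕ) : mom a b = mom (a + 1) b + mom a (b + 1) := by
  unfold mom
  rw [← integral_add (S3.integrable (mom_cont _ _)) (S3.integrable (mom_cont _ _))]
  congr 1; ext z
  have := S3_normSq z
  linear_combination (- Complex.normSq (za z) ^ a * Complex.normSq (zb z) ^ b) * this

lemma mom_rel (a b : ℕ) : (a + 1) * mom a (b + 1) = (b + 1) * mom (a + 1) b := by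
  have h := (((Dd.coa.pow (a + 1)).mul (Dd.coa.conj'.pow a)).mul
    ((Dd.cob.pow (b + 1)).mul (Dd.cob.conj'.pow b))).ibp.1
  have h2 : ∫ z : S3, (((b + 1 : ℝ) * (Complex.normSq (za z) ^ (a + 1) * Complex.normSq (zb z) ^ b)
    - (a + 1 : ℝ) * (Complex.normSq (za z) ^ a * Complex.normSq (zb z) ^ (b + 1)) : ℝ) : ℂ) ∂mu3 = 0 := by
    rw [← h]
    congr 1; ext z
    push_cast
    simp only [← Complex.mul_conj, map_zero]
    push_cast
    rcases a with _ | a <;> rcases b with _ | b <;>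
      simp only [Nat.add_sub_cancel, Nat.zero_add, Nat.sub_self] <;> push_cast <;> ring
  rw [integral_complex_ofReal] at h2
  have h3 : ∫ z : S3, ((b + 1 : ℝ) * (Complex.normSq (za z) ^ (a + 1) * Complex.normSq (zb z) ^ b)
    - (a + 1 : ℝ) * (Complex.normSq (za z) ^ a * Complex.normSq (zb z) ^ (b + 1)) : ℝ) ∂mu3 = 0 := by
    exact_mod_cast h2
  rw [integral_sub ((S3.integrable (mom_cont _ _)).const_mul _)
    ((S3.integrable (mom_cont _ _)).const_mul _), integral_const_mul, integral_const_mul] at h3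
  unfold mom; linarith

lemma mom_eq (a b : ℕ) : mom a b * (a + b + 1).factorial = a.factorial * b.factorial := by
  have key : ∀ n a b : ℕ, a + b = n →
      mom a b * (a + b + 1).factorial = a.factorial * b.factorial := by
    intro n
    induction n with
    | zero =>
      intro a b h
      obtain ⟨rfl, rfl⟩ : a = 0 ∧ b = 0 := by omega
      simp [mom_zero]
    | succ n ih =>
      have h1 : ∀ a b, a + b = n → mom (a + 1) b * (n + 2).factorial =
          (a + 1).factorial * b.factorial ∧ mom a (b + 1) * (n + 2).factorial =
          a.factorial * (b + 1).factorial := by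
        intro a b h
        have e := ih a b h
        rw [mom_add, h] at e
        have r := mom_rel a b
        have hn : ((n : ℝ)) = a + b := by exact_mod_cast h.symm
        rw [Nat.factorial_succ (n + 1), Nat.factorial_succ a, Nat.factorial_succ b]
        push_cast
        rw [hn]
        constructor
        · linear_combination (a + 1) * e - ((n + 1).factorial : ℝ) * r
        · linear_combination (b + 1) * e + ((n + 1).factorial : ℝ) * r
      intro a b h
      rcases a with _ | a
      · obtain ⟨b, rfl⟩ : ∃ c, b = c + 1 := ⟨n, by omega⟩
        have := (h1 0 b (by omega)).2
        rw [h]; exact this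
      · have := (h1 a b (by omega)).1
        rw [h]; exact this
  exact key _ a b rfl

lemma mom_val (a b : ℕ) : mom a b = a.factorial * b.factorial / (a + b + 1).factorial := by
  rw [← mom_eq]; field_simp

lemma mom_pos (a b : ℕ) : 0 < mom a b := by rw [mom_val]; positivity

/-- off-diagonal moments -/
lemma charge_zero (F : S3 → ℂ) (hF : Continuous F) (m : ℤ) (l : ℤ)
    (h : ∀ (a b : ℂ) (ha hb) (z : S3), F (sphMap (dia a b ha hb) z) = a ^ m * b ^ l * F z)
    (hm : m ≠ 0 ∨ l ≠ 0) : ∫ z, F z ∂mu3 = 0 := by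
  have key : ∃ a b : ℂ, ∃ (_ : Complex.normSq a = 1) (_ : Complex.normSq b = 1), a ^ m * b ^ l ≠ 1 := by
    have hn : ∀ m : ℤ, m ≠ 0 → ∃ a : ℂ, ∃ (_ : Complex.normSq a = 1), a ^ m ≠ 1 := by
      intro m hm
      refine ⟨Complex.exp ((π / m : ℝ) * Complex.I), ?_, ?_⟩
      · rw [Complex.normSq_eq_norm_sq, Complex.norm_exp_ofReal_mul_I]; simp
      · rw [← Complex.exp_int_mul]
        have : (m : ℂ) * (((π / m : ℝ) : ℂ) * Complex.I) = π * Complex.I := by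
          have : (m : ℂ) ≠ 0 := by exact_mod_cast hm
          push_cast; field_simp
        rw [this, Complex.exp_pi_mul_I]; norm_num
    rcases hm with hm | hm
    · obtain ⟨a, ha, h⟩ := hn m hm
      exact ⟨a, 1, ha, by simp, by simpa using h⟩
    · obtain ⟨a, ha, h⟩ := hn l hm
      exact ⟨1, a, by simp, ha, by simpa using h⟩
  obtain ⟨a, b, ha, hb, hab⟩ := key
  have h1 := mu3_integral (dia a b ha hb) F hF
  simp only [h] at h1
  rw [integral_const_mul] at h1
  have : (a ^ m * b ^ l - 1) * ∫ z, F z ∂mu3 = 0 := by rw [sub_mul, h1]; ring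
  exact (mul_eq_zero.1 this).resolve_left (sub_ne_zero.2 hab)

end

noncomputable section
open MeasureTheory Real Metric
open scoped ENNReal RealInnerProductSpace Manifold Pointwise
local notation "conj" => starRingEnd ℂ

/-- monomials of degree `n` -/
def mon (n : ℕ) (a : Fin (n + 1)) (z : S3) : ℂ := za z ^ (a : ℕ) * zb z ^ (n - a)

/-- normalized monomials of degree `n` -/
def onb (n : ℕ) (a : Fin (n + 1)) (z : S3) : ℂ := (Real.sqrt (mom a (n - a)) : ℂ)⁻¹ * mon n a z

@[fun_prop] lemma mon_cont (n : ℕ) (a : Fin (n + 1)) : Continuous (mon n a) := by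
  unfold mon; fun_prop
@[fun_prop] lemma onb_cont (n : ℕ) (a : Fin (n + 1)) : Continuous (onb n a) := by
  unfold onb; fun_prop
@[fun_prop] lemma conj_cont : Continuous (starRingEnd ℂ) := Complex.continuous_conj

lemma unit_conj {a : ℂ} (ha : Complex.normSq a = 1) : conj a = a⁻¹ := by
  rw [Complex.inv_def, ha]; simp

lemma unit_ne {a : ℂ} (ha : Complex.normSq a = 1) : a ≠ 0 := by
  rintro rfl; simp at ha

lemma mon_ortho (n : ℕ) (a b : Fin (n + 1)) (h : a ≠ b) :
    ∫ z, mon n a z * conj (mon n b z) ∂mu3 = 0 := by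
  apply charge_zero _ (by fun_prop) ((a : ℤ) - b) ((n - a : ℕ) - (n - b : ℕ))
  · intro α β hα hβ z
    have h1 := unit_ne hα
    have h2 := unit_ne hβ
    simp only [mon, sphMap_coe, za_dia, zb_dia, map_mul, map_pow, unit_conj hα, unit_conj hβ]
    rw [zpow_sub₀ h1, zpow_sub₀ h2]
    simp only [zpow_natCast, mul_pow, inv_pow]
    field_simp
  · left
    intro h'
    exact h (Fin.ext (by omega))

lemma mon_norm (n : ℕ) (a : Fin (n + 1)) :
    ∫ z, mon n a z * conj (mon n a z) ∂mu3 = mom a (n - a) := by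
  unfold mom
  rw [← integral_complex_ofReal]
  congr 1; ext z
  rw [Complex.mul_conj]
  simp [mon]

lemma onb_ortho (n : ℕ) (a b : Fin (n + 1)) :
    ∫ z, onb n a z * conj (onb n b z) ∂mu3 = if a = b then 1 else 0 := by
  have : ∀ z, onb n a z * conj (onb n b z) = ((Real.sqrt (mom a (n - a)) : ℂ)⁻¹ *
      (Real.sqrt (mom b (n - b)) : ℂ)⁻¹) * (mon n a z * conj (mon n b z)) := by
    intro z; simp [onb]; ring
  simp only [this]
  rw [integral_const_mul]
  split_ifs with h
  · subst h
    rw [mon_norm, ← mul_inv, ← Complex.ofReal_mul, Real.mul_self_sqrt (mom_pos _ _).le]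
    exact inv_mul_cancel₀ (by exact_mod_cast (mom_pos _ _).ne')
  · rw [mon_ortho n a b h, mul_zero]

lemma onb_kernel (n : ℕ) (z w : S3) :
    ∑ a, onb n a z * conj (onb n a w) = (n + 1) * hp z w ^ n := by
  unfold hp
  rw [add_pow, Finset.sum_range, Finset.mul_sum]
  apply Finset.sum_congr rfl
  intro a _
  have ha : (a : ℕ) ≤ n := Nat.lt_succ_iff.1 a.2
  have h1 : onb n a z * conj (onb n a w) = ((mom a (n - a) : ℝ) : ℂ)⁻¹ *
      (mon n a z * conj (mon n a w)) := by
    conv_rhs => rw [← Real.mul_self_sqrt (mom_pos a (n - a)).le]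
    push_cast
    simp [onb]; ring
  have h2 : ((mom a (n - a) : ℝ) : ℂ)⁻¹ = (n + 1) * (n.choose a : ℂ) := by
    have : (mom a (n - a))⁻¹ = (n + 1) * (n.choose a : ℝ) := by
      rw [mom_val, Nat.add_sub_cancel' ha, Nat.cast_choose ℝ ha, Nat.factorial_succ]
      push_cast; field_simp
    exact_mod_cast congrArg ((↑) : ℝ → ℂ) this
  rw [h1, h2]
  simp [mon]; ring

lemma hp_self (z : S3) : hp z z = 1 := S3_eq z

lemma hp_conj (z w : E4) : conj (hp z w) = hp w z := by simp [hp]; ring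

lemma onb_sum (n : ℕ) (z : S3) : ∑ a, Complex.normSq (onb n a z) = n + 1 := by
  have := onb_kernel n z z
  rw [hp_self, one_pow, mul_one] at this
  simp only [Complex.mul_conj] at this
  exact_mod_cast this

/-- Homogeneous holomorphic polynomials of degree `n` on `S³`. -/
def Vn (n : ℕ) : Submodule ℂ (S3 → ℂ) := Submodule.span ℂ (Set.range (onb n))

lemma Vn_iff {n : ℕ} {P : S3 → ℂ} :
    P ∈ Vn n ↔ ∃ u : Fin (n + 1) → ℂ, ∀ z, P z = ∑ a, u a * onb n a z := by
  rw [Vn, Submodule.mem_span_range_iff_exists_fun]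
  constructor
  · rintro ⟨u, rfl⟩
    exact ⟨u, fun z => by simp⟩
  · rintro ⟨u, h⟩
    exact ⟨u, by ext z; simp [h]⟩

lemma mon_mem (a b : ℕ) : (fun z : S3 => za z ^ a * zb z ^ b) ∈ Vn (a + b) := by
  have h : (fun z : S3 => za z ^ a * zb z ^ b) =
    (Real.sqrt (mom a b) : ℂ) • onb (a + b) ⟨a, by omega⟩ := by
    ext z
    have : (Real.sqrt (mom a b) : ℂ) ≠ 0 := by
      exact_mod_cast (Real.sqrt_pos.2 (mom_pos a b)).ne'
    simp only [onb, mon, Pi.smul_apply, smul_eq_mul, Nat.add_sub_cancel_left]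
    field_simp
  rw [h]
  exact Submodule.smul_mem _ _ (Submodule.subset_span ⟨_, rfl⟩)

lemma Vn_mul {m n : ℕ} {P Q : S3 → ℂ} (hP : P ∈ Vn m) (hQ : Q ∈ Vn n) :
    (fun z => P z * Q z) ∈ Vn (m + n) := by
  obtain ⟨u, hu⟩ := Vn_iff.1 hP
  obtain ⟨v, hv⟩ := Vn_iff.1 hQ
  have : (fun z => P z * Q z) = ∑ a, ∑ b, (u a * v b * (Real.sqrt (mom a (m - a)) : ℂ)⁻¹ *
      (Real.sqrt (mom b (n - b)) : ℂ)⁻¹) •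
      (fun z : S3 => za z ^ (a + b : ℕ) * zb z ^ (m - a + (n - b))) := by
    ext z
    simp only [Finset.sum_apply, Pi.smul_apply, smul_eq_mul, hu, hv, Finset.sum_mul_sum]
    refine Finset.sum_congr rfl fun a _ => Finset.sum_congr rfl fun b _ => ?_
    simp only [onb, mon]; ring
  rw [this]
  refine Submodule.sum_mem _ fun a _ => Submodule.sum_mem _ fun b _ => Submodule.smul_mem _ _ ?_
  have := mon_mem (a + b : ℕ) (m - a + (n - b))
  rwa [show (a + b : ℕ) + (m - a + (n - b)) = m + n by have := a.2; have := b.2; omega] at this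

lemma one_mem : (fun _ : S3 => (1 : ℂ)) ∈ Vn 0 := by simpa using mon_mem 0 0

lemma hp_mem (w : S3) (n : ℕ) : (fun z : S3 => hp z w ^ n) ∈ Vn n := by
  have h1 : (fun z : S3 => hp z w) ∈ Vn 1 := by
    have h := Submodule.add_mem _ (Submodule.smul_mem _ (conj (za w)) (mon_mem 1 0))
      (Submodule.smul_mem _ (conj (zb w)) (mon_mem 0 1))
    convert h using 1
    ext z; simp [hp]; ring
  induction n with
  | zero => simpa using one_mem
  | succ n ih => simpa [pow_succ] using Vn_mul ih h1

lemma Vn_cont {n : ℕ} {P : S3 → ℂ} (hP : P ∈ Vn n) : Continuous P := by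
  obtain ⟨u, hu⟩ := Vn_iff.1 hP
  rw [funext hu]; fun_prop

lemma hp_cont (x : E4) : Continuous fun y : S3 => hp x y := by
  unfold hp; fun_prop
lemma hp_cont' (x : E4) : Continuous fun y : S3 => hp y x := by
  unfold hp; fun_prop

lemma reproducing {n : ℕ} {P : S3 → ℂ} (hP : P ∈ Vn n) (x : S3) :
    P x = (n + 1) * ∫ y, hp x y ^ n * P y ∂mu3 := by
  obtain ⟨u, hu⟩ := Vn_iff.1 hP
  rw [← integral_const_mul]
  have : ∀ y : S3, (n + 1) * (hp x y ^ n * P y) =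
      ∑ a, ∑ b, (onb n a x * u b) * (onb n b y * conj (onb n a y)) := by
    intro y
    rw [← mul_assoc, ← onb_kernel, hu, Finset.sum_mul_sum]
    refine Finset.sum_congr rfl fun a _ => Finset.sum_congr rfl fun b _ => by ring
  simp only [this]
  rw [integral_finsetSum _ fun a _ => S3.integrable (by fun_prop)]
  rw [hu]
  apply Finset.sum_congr rfl
  intro a _
  rw [integral_finsetSum _ fun b _ => S3.integrable (by fun_prop)]
  simp only [integral_const_mul, onb_ortho]
  simp [mul_comm]

lemma hp_moment (n : ℕ) (w : S3) :
    ∫ z : S3, Complex.normSq (hp z w) ^ n ∂mu3 = 1 / (n + 1) := by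
  have := zonal_S3 (fun t => ((t ^ n : ℝ) : ℂ)) (by fun_prop) w
  rw [integral_complex_ofReal, integral_complex_ofReal] at this
  have h2 : ∫ z : S3, Complex.normSq (hp z w) ^ n ∂mu3 = ∫ z : S3, Complex.normSq (za z) ^ n ∂mu3 := by
    exact_mod_cast this
  have h3 := mom_val n 0
  simp only [mom, pow_zero, mul_one] at h3
  rw [h2, h3, add_zero, Nat.factorial_succ]
  simp
  field_simp

/-- derivative of a holomorphic polynomial -/
lemma Vn_Dd {n : ℕ} {P : S3 → ℂ} (hP : P ∈ Vn n) : ∃ P', Dd P P' (fun _ => 0) := by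
  obtain ⟨u, hu⟩ := Vn_iff.1 hP
  have h : ∀ a, ∃ A, Dd (fun z => u a * onb n a z) A (fun _ => 0) := by
    intro a
    refine ⟨_, ((((Dd.coa.pow a).mul (Dd.cob.pow (n - a))).smul
      (u a * (Real.sqrt (mom a (n - a)) : ℂ)⁻¹)).congr (fun z => ?_) (fun z => rfl) fun z => ?_)⟩
    · simp [onb, mon]; ring
    · simp
  choose A hA using h
  exact ⟨_, (Dd.sum Finset.univ fun a _ => hA a).congr hu (fun _ => rfl) (by simp)⟩

end

noncomputable section
open MeasureTheory Real Metric
open scoped ENNReal RealInnerProductSpace Manifold Pointwise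
local notation "conj" => starRingEnd ℂ

lemma re_int {F : S3 → ℂ} (hF : Continuous F) : (∫ z, F z ∂mu3).re = ∫ z, (F z).re ∂mu3 :=
  (Complex.reCLM.integral_comp_comm (S3.integrable hF)).symm

@[fun_prop] lemma re_cont : Continuous Complex.re := Complex.continuous_re
@[fun_prop] lemma im_cont : Continuous Complex.im := Complex.continuous_im
@[fun_prop] lemma ofReal_cont : Continuous ((↑) : ℝ → ℂ) := Complex.continuous_ofReal
@[fun_prop] lemma normSq_cont : Continuous Complex.normSq := Complex.continuous_normSq

lemma re_mul_conj (a b : ℂ) : (a * conj b).re = (conj a * b).re := by simp [Complex.mul_re]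

lemma pyth {f g : S3 → ℂ} (hf : Continuous f) (hg : Continuous g)
    (h : ∫ z, f z * conj (g z) ∂mu3 = 0) :
    ∫ z, Complex.normSq (f z) ∂mu3 ≤ ∫ z, Complex.normSq (f z - g z) ∂mu3 := by
  have h1 : ∫ z, (f z * conj (g z)).re ∂mu3 = 0 := by
    rw [← re_int (by fun_prop), h]; simp
  have h2 : ∀ z, Complex.normSq (f z - g z) = Complex.normSq (f z) + Complex.normSq (g z)
      - 2 * (f z * conj (g z)).re := fun z => Complex.normSq_sub _ _
  simp only [h2]
  rw [integral_sub (S3.integrable (by fun_prop)) (S3.integrable (by fun_prop)),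
    integral_add (S3.integrable (by fun_prop)) (S3.integrable (by fun_prop)), integral_const_mul, h1]
  have : 0 ≤ ∫ z, Complex.normSq (g z) ∂mu3 := integral_nonneg fun z => Complex.normSq_nonneg _
  linarith

lemma Dd.unique {F A B A' B' : S3 → ℂ} (h : Dd F A B) (h' : Dd F A' B') : A = A' ∧ B = B' := by
  have h1 : ∀ z, A z + B z = A' z + B' z := fun z => (h.d1 z).unique (h'.d1 z)
  have h2 : ∀ z, A z - B z = A' z - B' z := fun z =>
    mul_left_cancel₀ Complex.I_ne_zero ((h.d2 z).unique (h'.d2 z))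
  constructor <;> ext z
  · linear_combination (h1 z + h2 z) / 2
  · linear_combination (h1 z - h2 z) / 2

lemma Dd.real_conj {f : S3 → ℝ} {A B : S3 → ℂ} (h : Dd (fun z => (f z : ℂ)) A B) :
    ∀ z, A z = conj (B z) := by
  have h2 : Dd (fun z => (f z : ℂ)) _ _ := h.conj'.congr (fun z => (Complex.conj_ofReal _).symm)
    (fun _ => rfl) (fun _ => rfl)
  exact fun z => congrFun (h.unique h2).1 z

/-- functions of charge `m` with `D β = b1` -/
def Gd (m : ℤ) (β b1 : S3 → ℂ) : Prop := ∃ b2 b11 b12 b21 b22 : S3 → ℂ,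
  Dd β b1 b2 ∧ Dd b1 b11 b12 ∧ Dd b2 b21 b22 ∧ ∀ z, b21 z - b12 z = m * β z

lemma Gd.congr {m l : ℤ} {β b β' b' : S3 → ℂ} (h : Gd m β b) (hm : l = m) (h1 : ∀ z, β' z = β z)
    (h2 : ∀ z, b' z = b z) : Gd l β' b' := by
  rw [funext h1, funext h2, hm]; exact h

lemma Gd.mul {m l : ℤ} {β b γ c : S3 → ℂ} (h : Gd m β b) (h' : Gd l γ c) :
    Gd (m + l) (fun z => β z * γ z) (fun z => b z * γ z + β z * c z) := by
  obtain ⟨b2, b11, b12, b21, b22, h1, h2, h3, h4⟩ := h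
  obtain ⟨c2, c11, c12, c21, c22, k1, k2, k3, k4⟩ := h'
  refine ⟨_, _, _, _, _, h1.mul k1, (h2.mul k1).add (h1.mul k2), (h3.mul k1).add (h1.mul k3), ?_⟩
  intro z
  push_cast
  linear_combination γ z * h4 z + β z * k4 z

lemma Gd.add {m : ℤ} {β b γ c : S3 → ℂ} (h : Gd m β b) (h' : Gd m γ c) :
    Gd m (fun z => β z + γ z) (fun z => b z + c z) := by
  obtain ⟨b2, b11, b12, b21, b22, h1, h2, h3, h4⟩ := h
  obtain ⟨c2, c11, c12, c21, c22, k1, k2, k3, k4⟩ := h'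
  refine ⟨_, _, _, _, _, h1.add k1, h2.add k2, h3.add k3, ?_⟩
  intro z
  linear_combination h4 z + k4 z

lemma Gd.const (a : ℂ) : Gd 0 (fun _ => a) (fun _ => 0) :=
  ⟨_, _, _, _, _, Dd.const a, Dd.const 0, Dd.const 0, fun z => by simp⟩

lemma Gd.smul {m : ℤ} {β b : S3 → ℂ} (a : ℂ) (h : Gd m β b) :
    Gd m (fun z => a * β z) (fun z => a * b z) := by
  have := (Gd.const a).mul h
  simpa using this

lemma Gd.coa : Gd 1 (fun z => za z) (fun z => - conj (zb z)) :=
  ⟨_, _, _, _, _, Dd.coa, (Dd.cob.conj'.smul (-1)).congr (fun z => by ring) (fun _ => rfl)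
    (fun _ => rfl), Dd.const 0, fun z => by simp⟩

lemma Gd.cob : Gd 1 (fun z => zb z) (fun z => conj (za z)) :=
  ⟨_, _, _, _, _, Dd.cob, Dd.coa.conj', Dd.const 0, fun z => by simp⟩

lemma Gd.coa' : Gd (-1) (fun z => conj (za z)) (fun z => 0) :=
  ⟨_, _, _, _, _, Dd.coa.conj'.congr (fun _ => rfl) (fun z => by simp) (fun z => rfl), Dd.const 0,
    (Dd.cob.smul (-1)).congr (fun z => by simp) (fun z => rfl) (fun z => rfl), fun z => by simp⟩

lemma Gd.cob' : Gd (-1) (fun z => conj (zb z)) (fun z => 0) :=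
  ⟨_, _, _, _, _, Dd.cob.conj'.congr (fun _ => rfl) (fun z => by simp) (fun z => rfl), Dd.const 0,
    Dd.coa.congr (fun z => by simp) (fun z => rfl) (fun z => rfl), fun z => by simp⟩

lemma Gd.pow {m : ℤ} {β b : S3 → ℂ} (h : Gd m β b) (n : ℕ) :
    Gd (n * m) (fun z => β z ^ n) (fun z => n * β z ^ (n - 1) * b z) := by
  induction n with
  | zero => simpa using Gd.const 1
  | succ n ih =>
    refine (ih.mul h).congr (by push_cast; ring) (fun z => pow_succ _ _) (fun z => ?_)
    rcases n with _ | n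
    · simp
    · simp only [Nat.add_sub_cancel, pow_succ]; push_cast; ring

/-- monomial in `z, z̄` -/
def Mono (a b c d : ℕ) (z : S3) : ℂ := za z ^ a * zb z ^ b * (conj (za z) ^ c * conj (zb z) ^ d)

@[fun_prop] lemma Mono_cont (a b c d : ℕ) : Continuous (Mono a b c d) := by
  unfold Mono; fun_prop

lemma Mono_Gd (a b c d : ℕ) (m : ℤ) (hm : (a : ℤ) + b - c - d = m) :
    Gd m (Mono a b c d) (fun z => - a * (za z ^ (a - 1) * zb z ^ b * (conj (za z) ^ c * conj (zb z) ^ (d + 1)))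
      + b * (za z ^ a * zb z ^ (b - 1) * (conj (za z) ^ (c + 1) * conj (zb z) ^ d))) := by
  refine (((Gd.coa.pow a).mul (Gd.cob.pow b)).mul ((Gd.coa'.pow c).mul (Gd.cob'.pow d))).congr
    (by rw [← hm]; ring) (fun z => rfl) (fun z => by ring)

/-- Bochner-type inequality -/
lemma bochner {m : ℤ} {β b1 : S3 → ℂ} (hβ : Gd m β b1) {w : S3 → ℝ} {wA wB wBA wBB : S3 → ℂ}
    (hw : Dd (fun z => (w z : ℂ)) wA wB) (hw2 : Dd wB wBA wBB) :
    ∫ z, (m - (wBA z).re) * Complex.normSq (β z) * Real.exp (- w z) ∂mu3 ≤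
      ∫ z, Complex.normSq (b1 z) * Real.exp (- w z) ∂mu3 := by
  obtain ⟨b2, b11, b12, b21, b22, h1, h2, h3, h4⟩ := hβ
  have hc := hw.real_conj
  have cw : Continuous w := by
    have := Complex.continuous_re.comp hw.c
    simpa [Function.comp_def] using this
  have hE : Dd (fun z => (Real.exp (- w z) : ℂ)) (fun z => (-Real.exp (- w z) : ℝ) * wA z)
      (fun z => (-Real.exp (- w z) : ℝ) * wB z) :=
    hw.comp_real (φ := fun t => Real.exp (-t)) (φ' := fun t => -Real.exp (-t))
      (fun z => by simpa using (hasDerivAt_neg (w z)).exp) (by fun_prop)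
  have i1 := ((h2.mul h1.conj').mul hE).ibp.2
  have i2 := (((h3.add ((hw2.mul h1).smul (-1))).mul h1.conj').mul hE).ibp.1
  have c1 := ((h2.mul h1.conj').mul hE).cB
  have c2 := (((h3.add ((hw2.mul h1).smul (-1))).mul h1.conj').mul hE).cA
  have := h1.c; have := h1.cA; have := h1.cB; have := hw2.cA; have := hw.cB
  have key : ∫ z, Complex.normSq (b1 z) * Real.exp (- w z) ∂mu3 -
      ∫ z, (m - (wBA z).re) * Complex.normSq (β z) * Real.exp (- w z) ∂mu3 =
      ∫ z, Complex.normSq (b2 z - wB z * β z) * Real.exp (- w z) ∂mu3 := by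
    have i3 := congrArg₂ (· - ·) i1 i2
    simp only [sub_self] at i3
    rw [← integral_sub (S3.integrable c1) (S3.integrable c2)] at i3
    have i4 : ∫ z, (((Complex.normSq (b1 z) * Real.exp (- w z) -
        Complex.normSq (b2 z - wB z * β z) * Real.exp (- w z) : ℝ) : ℂ) -
        (m - wBA z) * ((Complex.normSq (β z) * Real.exp (- w z) : ℝ) : ℂ)) ∂mu3 = 0 := by
      rw [← i3]
      congr 1; ext z
      have e : b12 z = b21 z - m * β z := by rw [← h4]; ring
      rw [e, hc]
      simp only [Complex.ofReal_sub, Complex.ofReal_mul, Complex.ofReal_neg, ← Complex.mul_conj,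
        map_sub, map_mul]
      ring
    have i5 := congrArg Complex.re i4
    rw [re_int (by fun_prop)] at i5
    simp only [Complex.sub_re, Complex.ofReal_re, Complex.re_mul_ofReal, Complex.intCast_re,
      Complex.zero_re] at i5
    rw [← sub_eq_zero, ← integral_sub (S3.integrable (by fun_prop)) (S3.integrable (by fun_prop)),
      ← integral_sub (S3.integrable (by fun_prop)) (S3.integrable (by fun_prop)), ← i5]
    congr 1; ext z
    ring
  have : 0 ≤ ∫ z, Complex.normSq (b2 z - wB z * β z) * Real.exp (- w z) ∂mu3 :=
    integral_nonneg fun z => mul_nonneg (Complex.normSq_nonneg _) (Real.exp_pos _).le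
  linarith
end

noncomputable section
open MeasureTheory Real Metric
open scoped ENNReal RealInnerProductSpace Manifold Pointwise
local notation "conj" => starRingEnd ℂ

/-- functions of charge `n` under the circle action -/
def Chg (n : ℤ) (h : S3 → ℂ) : Prop :=
  ∀ (a : ℂ) (ha : Complex.normSq a = 1) (z : S3), h (sphMap (dia a a ha ha) z) = a ^ n * h z

lemma Mono_chg (a b c d : ℕ) : Chg ((a : ℤ) + b - c - d) (Mono a b c d) := by
  intro α hα z
  have h1 := unit_ne hα
  simp only [Mono, sphMap_coe, za_dia, zb_dia, map_mul, unit_conj hα, mul_pow, inv_pow]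
  rw [zpow_sub₀ h1, zpow_sub₀ h1, zpow_add₀ h1]
  simp only [zpow_natCast]
  field_simp

lemma chg_ortho {m n : ℤ} (hmn : m ≠ n) {f g : S3 → ℂ} (hf : Continuous f) (hg : Continuous g)
    (cf : Chg m f) (cg : Chg n g) : ∫ z, f z * conj (g z) ∂mu3 = 0 := by
  obtain ⟨a, ha, h⟩ : ∃ a : ℂ, ∃ (_ : Complex.normSq a = 1), a ^ (m - n) ≠ 1 := by
    have hm : ((m - n : ℤ) : ℂ) ≠ 0 := by exact_mod_cast sub_ne_zero.2 hmn
    refine ⟨Complex.exp ((π / (m - n : ℤ) : ℝ) * Complex.I), ?_, ?_⟩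
    · rw [Complex.normSq_eq_norm_sq, Complex.norm_exp_ofReal_mul_I]; simp
    · rw [← Complex.exp_int_mul]
      have : ((m - n : ℤ) : ℂ) * (((π / (m - n : ℤ) : ℝ) : ℂ) * Complex.I) = π * Complex.I := by
        rw [Complex.ofReal_div, Complex.ofReal_intCast]; field_simp
      rw [this, Complex.exp_pi_mul_I]; norm_num
  have h1 := mu3_integral (dia a a ha ha) (fun z => f z * conj (g z)) (by fun_prop)
  have h0 := unit_ne ha
  have h2 : ∀ z, f (sphMap (dia a a ha ha) z) * conj (g (sphMap (dia a a ha ha) z)) =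
      a ^ (m - n) * (f z * conj (g z)) := by
    intro z
    rw [cf a ha z, cg a ha z, map_mul, map_zpow₀, unit_conj ha, zpow_sub₀ h0, inv_zpow]
    field_simp
  simp only [h2] at h1
  rw [integral_const_mul] at h1
  have : (a ^ (m - n) - 1) * ∫ z, f z * conj (g z) ∂mu3 = 0 := by rw [sub_mul, h1]; ring
  exact (mul_eq_zero.1 this).resolve_left (sub_ne_zero.2 h)

/-- polynomials in `z`, `z̄` -/
def Pol : Submodule ℂ (S3 → ℂ) :=
  Submodule.span ℂ (Set.range fun q : ℕ × ℕ × ℕ × ℕ => Mono q.1 q.2.1 q.2.2.1 q.2.2.2)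

lemma Mono_mem (a b c d : ℕ) : Mono a b c d ∈ Pol := Submodule.subset_span ⟨(a, b, c, d), rfl⟩

lemma Pol_mul {f g : S3 → ℂ} (hf : f ∈ Pol) (hg : g ∈ Pol) : f * g ∈ Pol := by
  have h := Submodule.mul_mem_mul hf hg
  rw [Pol, Submodule.span_mul_span] at h
  refine Submodule.span_le.2 ?_ h
  rintro _ ⟨_, ⟨⟨a, b, c, d⟩, rfl⟩, _, ⟨⟨a', b', c', d'⟩, rfl⟩, rfl⟩
  have := Mono_mem (a + a') (b + b') (c + c') (d + d')
  have e : Mono a b c d * Mono a' b' c' d' = Mono (a + a') (b + b') (c + c') (d + d') := by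
    ext z
    simp only [Mono, Pi.mul_apply]; ring
  show Mono a b c d * Mono a' b' c' d' ∈ Pol
  rw [e]; exact this

lemma Pol_star {f : S3 → ℂ} (hf : f ∈ Pol) : (fun z => conj (f z)) ∈ Pol := by
  refine Submodule.span_induction (p := fun f _ => (fun z => conj (f z)) ∈ Pol) ?_ ?_ ?_ ?_ hf
  · rintro _ ⟨⟨a, b, c, d⟩, rfl⟩
    have := Mono_mem c d a b
    convert this using 1
    ext z; simp [Mono]; ring
  · simp only [Pi.zero_apply, map_zero]; exact Pol.zero_mem
  · intro x y _ _ hx hy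
    have := Pol.add_mem hx hy
    convert this using 1
    ext z; simp
  · intro a x _ hx
    have := Pol.smul_mem (conj a) hx
    convert this using 1
    ext z; simp

lemma adj_Pol (p : C(S3, ℂ)) (hp : p ∈ StarAlgebra.adjoin ℂ
      {(⟨fun z => za z, by fun_prop⟩ : C(S3, ℂ)), (⟨fun z => zb z, by fun_prop⟩ : C(S3, ℂ))}) :
    (p : S3 → ℂ) ∈ Pol := by
  induction hp using StarAlgebra.adjoin_induction with
  | mem x h =>
    rcases h with rfl | h
    · have := Mono_mem 1 0 0 0
      convert this using 1; ext z; simp [Mono]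
    · rw [Set.mem_singleton_iff] at h; subst h
      have := Mono_mem 0 1 0 0
      convert this using 1; ext z; simp [Mono]
  | algebraMap r =>
    have := Pol.smul_mem r (Mono_mem 0 0 0 0)
    convert this using 1
    ext z; simp [Mono]
  | add x y hx hy h1 h2 => exact Pol.add_mem h1 h2
  | mul x y hx hy h1 h2 => exact Pol_mul h1 h2
  | star x hx h => exact Pol_star h

lemma Pol_dense {f : S3 → ℂ} (hf : Continuous f) {ε : ℝ} (hε : 0 < ε) :
    ∃ p ∈ Pol, Continuous p ∧ ∀ z, ‖f z - p z‖ < ε := by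
  let A : StarSubalgebra ℂ C(S3, ℂ) := StarAlgebra.adjoin ℂ
    {(⟨fun z => za z, by fun_prop⟩ : C(S3, ℂ)), (⟨fun z => zb z, by fun_prop⟩ : C(S3, ℂ))}
  have hsep : A.SeparatesPoints := by
    intro x y hxy
    by_cases h : za x = za y
    · refine ⟨fun z => zb z, ⟨(⟨fun z => zb z, by fun_prop⟩ : C(S3, ℂ)), ?_, rfl⟩, ?_⟩
      · exact StarAlgebra.subset_adjoin _ _ (by simp)
      · intro h2
        exact hxy (Subtype.ext (E4_ext h h2))
    · refine ⟨fun z => za z, ⟨(⟨fun z => za z, by fun_prop⟩ : C(S3, ℂ)), ?_, rfl⟩, h⟩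
      exact StarAlgebra.subset_adjoin _ _ (by simp)
  have htop := ContinuousMap.starSubalgebra_topologicalClosure_eq_top_of_separatesPoints A hsep
  have hmem : (⟨f, hf⟩ : C(S3, ℂ)) ∈ A.topologicalClosure := by rw [htop]; trivial
  have hmem2 : (⟨f, hf⟩ : C(S3, ℂ)) ∈ closure (A : Set C(S3, ℂ)) := hmem
  obtain ⟨p, hp, hd⟩ := Metric.mem_closure_iff.1 hmem2 ε hε
  refine ⟨p, ?_, p.continuous, fun z => ?_⟩
  · exact adj_Pol p hp
  · rw [← dist_eq_norm]
    exact lt_of_le_of_lt (ContinuousMap.dist_apply_le_dist (f := ⟨f, hf⟩) (g := p) z) hd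

/-- `p = D β + e` with `e` holomorphic. -/
def Rng (n : ℕ) (p : S3 → ℂ) : Prop := ∃ β b1 e : S3 → ℂ, Gd (n + 2) β b1 ∧ e ∈ Vn n ∧
  ∀ z, p z = b1 z + e z

lemma Rng.zero (n : ℕ) : Rng n 0 := by
  refine ⟨fun _ => 0, fun _ => 0, 0, ?_, Submodule.zero_mem _, fun z => by simp⟩
  exact ⟨_, _, _, _, _, Dd.const 0, Dd.const 0, Dd.const 0, fun z => by simp⟩
lemma Rng.add {n : ℕ} {p q : S3 → ℂ} (hp : Rng n p) (hq : Rng n q) : Rng n (p + q) := by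
  obtain ⟨β, b, e, h1, h2, h3⟩ := hp
  obtain ⟨γ, c, f, k1, k2, k3⟩ := hq
  exact ⟨_, _, _, h1.add k1, Submodule.add_mem _ h2 k2, fun z => by simp [h3, k3]; ring⟩
lemma Rng.smul {n : ℕ} {p : S3 → ℂ} (a : ℂ) (hp : Rng n p) : Rng n (a • p) := by
  obtain ⟨β, b, e, h1, h2, h3⟩ := hp
  exact ⟨_, _, _, h1.smul a, Submodule.smul_mem _ a h2, fun z => by simp [h3]; ring⟩

lemma Rng_mono (n : ℕ) : ∀ N a b c d : ℕ, c + d = N → a + b = n + c + d → Rng n (Mono a b c d) := by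
  intro N
  induction N with
  | zero =>
    intro a b c d h h2
    obtain ⟨rfl, rfl⟩ : c = 0 ∧ d = 0 := by omega
    refine ⟨fun _ => 0, fun _ => 0, Mono a b 0 0,
      ⟨_, _, _, _, _, Dd.const 0, Dd.const 0, Dd.const 0, fun z => by simp⟩, ?_, fun z => by simp⟩
    have := mon_mem a b
    rw [show a + b = n by omega] at this
    convert this using 1
    ext z; simp [Mono]
  | succ N ih =>
    intro a b c d h h2
    have hab : ((a : ℂ) + b + 1) ≠ 0 := by exact_mod_cast Nat.succ_ne_zero (a + b)
    rcases d with _ | d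
    · obtain ⟨c, rfl⟩ : ∃ c', c = c' + 1 := ⟨N, by omega⟩
      have hβ := Mono_Gd a (b + 1) c 0 (n + 2) (by push_cast; omega)
      have key : ∃ Q, Rng n Q ∧ ∀ z, (a + b + 1) * Mono a b (c + 1) 0 z =
        (- a * (za z ^ (a - 1) * zb z ^ (b + 1) * (conj (za z) ^ c * conj (zb z) ^ (0 + 1)))
      + (b + 1 : ℕ) * (za z ^ a * zb z ^ (b + 1 - 1) * (conj (za z) ^ (c + 1) * conj (zb z) ^ 0)))
        + a * Q z := by
        rcases a with _ | a
        · exact ⟨0, Rng.zero n, fun z => by simp [Mono]⟩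
        · refine ⟨Mono a b c 0, ih a b c 0 (by omega) (by omega), fun z => ?_⟩
          have := S3_eq z
          simp only [Mono, Nat.add_sub_cancel, pow_succ, pow_zero]
          push_cast
          linear_combination ((a + 1) * (za z ^ a * zb z ^ b * (conj (za z) ^ c))) * this
      obtain ⟨Q, ⟨γ, c', f, k1, k2, k3⟩, hQ⟩ := key
      refine ⟨_, _, _, (hβ.add (k1.smul a)).smul (a + b + 1)⁻¹,
        Submodule.smul_mem _ ((a + b + 1 : ℂ)⁻¹ * a) k2, fun z => ?_⟩
      have := hQ z
      rw [k3] at this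
      rw [← mul_right_inj' hab, this]
      simp only [Pi.smul_apply, smul_eq_mul]
      field_simp
      ring
    · have hβ := Mono_Gd (a + 1) b c d (n + 2) (by push_cast; omega)
      have key : ∃ Q, Rng n Q ∧ ∀ z, (a + b + 1) * Mono a b c (d + 1) z = -
        (- (a + 1 : ℕ) * (za z ^ (a + 1 - 1) * zb z ^ b * (conj (za z) ^ c * conj (zb z) ^ (d + 1)))
      + b * (za z ^ (a + 1) * zb z ^ (b - 1) * (conj (za z) ^ (c + 1) * conj (zb z) ^ d)))
        + b * Q z := by
        rcases b with _ | b
        · exact ⟨0, Rng.zero n, fun z => by simp [Mono]; ring⟩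
        · refine ⟨Mono a b c d, ih a b c d (by omega) (by omega), fun z => ?_⟩
          have := S3_eq z
          simp only [Mono, Nat.add_sub_cancel, pow_succ]
          push_cast
          linear_combination ((b + 1) * (za z ^ a * zb z ^ b * (conj (za z) ^ c * conj (zb z) ^ d))) * this
      obtain ⟨Q, ⟨γ, c', f, k1, k2, k3⟩, hQ⟩ := key
      refine ⟨_, _, _, ((hβ.smul (-1)).add (k1.smul b)).smul (a + b + 1)⁻¹,
        Submodule.smul_mem _ ((a + b + 1 : ℂ)⁻¹ * b) k2, fun z => ?_⟩
      have := hQ z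
      rw [k3] at this
      rw [← mul_right_inj' hab, this]
      simp only [Pi.smul_apply, smul_eq_mul]
      field_simp
      ring

lemma Pol_split (n : ℕ) {p : S3 → ℂ} (hp : p ∈ Pol) : ∃ p0 r : S3 → ℂ, p = p0 + r ∧ Rng n p0 ∧
    Continuous p0 ∧ Chg n p0 ∧ Continuous r ∧
    ∀ g, Continuous g → Chg n g → ∫ z, g z * conj (r z) ∂mu3 = 0 := by
  have chg0 : Chg n 0 := fun a ha z => by simp
  refine Submodule.span_induction (p := fun p _ => ∃ p0 r : S3 → ℂ, p = p0 + r ∧ Rng n p0 ∧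
    Continuous p0 ∧ Chg n p0 ∧ Continuous r ∧
    ∀ g, Continuous g → Chg n g → ∫ z, g z * conj (r z) ∂mu3 = 0) ?_ ?_ ?_ ?_ hp
  · rintro _ ⟨⟨a, b, c, d⟩, rfl⟩
    by_cases h : ((a : ℤ) + b - c - d) = n
    · refine ⟨Mono a b c d, 0, by simp, Rng_mono n _ a b c d rfl (by omega), Mono_cont _ _ _ _, ?_,
        continuous_const, fun g _ _ => by simp⟩
      rw [← h]; exact Mono_chg a b c d
    · refine ⟨0, Mono a b c d, by simp, Rng.zero n, continuous_const, chg0, Mono_cont _ _ _ _, ?_⟩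
      intro g hg cg
      exact chg_ortho (Ne.symm h) hg (Mono_cont _ _ _ _) cg (Mono_chg a b c d)
  · exact ⟨0, 0, by simp, Rng.zero n, continuous_const, chg0, continuous_const, by simp⟩
  · rintro x y _ _ ⟨p0, r, h1, h2, h3, h4, h5, h6⟩ ⟨q0, s, k1, k2, k3, k4, k5, k6⟩
    refine ⟨p0 + q0, r + s, by rw [h1, k1]; ring, h2.add k2, h3.add k3, ?_, h5.add k5, ?_⟩
    · intro a ha z; simp [h4 a ha z, k4 a ha z]; ring
    · intro g hg cg
      simp only [Pi.add_apply, map_add, mul_add]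
      rw [integral_add (S3.integrable (by fun_prop)) (S3.integrable (by fun_prop)), h6 g hg cg,
        k6 g hg cg, add_zero]
  · rintro a x _ ⟨p0, r, h1, h2, h3, h4, h5, h6⟩
    refine ⟨a • p0, a • r, by rw [h1, smul_add], h2.smul a, h3.const_smul a, ?_, h5.const_smul a, ?_⟩
    · intro b hb z; simp [h4 b hb z]; ring
    · intro g hg cg
      have : ∀ z, g z * conj ((a • r) z) = conj a * (g z * conj (r z)) := by
        intro z; simp; ring
      simp only [this]
      rw [integral_const_mul, h6 g hg cg, mul_zero]

lemma D_ortho {m : ℤ} {n : ℕ} {β b1 e : S3 → ℂ} (hβ : Gd m β b1) (he : e ∈ Vn n) :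
    ∫ z, b1 z * conj (e z) ∂mu3 = 0 := by
  obtain ⟨b2, _, _, _, _, h1, _⟩ := hβ
  obtain ⟨e', h2⟩ := Vn_Dd he
  have := (h1.mul h2.conj').ibp.1
  simpa using this

lemma D_dense (n : ℕ) {h : S3 → ℂ} (hc : Continuous h) (hn : Chg n h)
    (ho : ∀ e ∈ Vn n, ∫ z, h z * conj (e z) ∂mu3 = 0) {ε : ℝ} (hε : 0 < ε) :
    ∃ β b1, Gd (n + 2) β b1 ∧ ∫ z, Complex.normSq (h z - b1 z) ∂mu3 ≤ ε := by
  obtain ⟨p, hp, cp, hd⟩ := Pol_dense hc (Real.sqrt_pos.2 hε)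
  obtain ⟨p0, r, h1, ⟨β, b1, e, hg, he, hR⟩, h3, h4, h5, h6⟩ := Pol_split n hp
  refine ⟨β, b1, hg, ?_⟩
  have cb : Continuous b1 := by obtain ⟨_, _, _, _, _, h1, _⟩ := hg; exact h1.cA
  have ce := Vn_cont he
  have a1 : ∫ z, Complex.normSq (h z - b1 z) ∂mu3 ≤ ∫ z, Complex.normSq (h z - b1 z - e z) ∂mu3 := by
    apply pyth (by fun_prop) ce
    simp only [sub_mul]
    rw [integral_sub (S3.integrable (by fun_prop)) (S3.integrable (by fun_prop)), ho e he,
      D_ortho hg he, sub_zero]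
  have a2 : ∫ z, Complex.normSq (h z - p0 z) ∂mu3 ≤ ∫ z, Complex.normSq (h z - p0 z - r z) ∂mu3 := by
    apply pyth (by fun_prop) h5
    apply h6 _ (by fun_prop)
    intro a ha z
    simp only [hn a ha z, h4 a ha z]; ring
  have a3 : ∫ z, Complex.normSq (h z - p0 z - r z) ∂mu3 ≤ ∫ z, ε ∂mu3 := by
    apply integral_mono (S3.integrable (by fun_prop)) (integrable_const _)
    intro z
    have h7 := hd z
    rw [h1] at h7
    simp only [Pi.add_apply] at h7
    show Complex.normSq (h z - p0 z - r z) ≤ ε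
    rw [sub_sub, Complex.normSq_eq_norm_sq]
    calc _ ≤ (Real.sqrt ε) ^ 2 := by gcongr
      _ = ε := Real.sq_sqrt hε.le
  simp only [integral_const, probReal_univ, one_smul] at a3
  have a4 : ∀ z, h z - b1 z - e z = h z - p0 z := fun z => by rw [hR]; ring
  simp only [a4] at a1
  linarith

end

noncomputable section
open MeasureTheory Real Metric
open scoped ENNReal RealInnerProductSpace Manifold Pointwise
local notation "conj" => starRingEnd ℂ

lemma Vn_chg {n : ℕ} {P : S3 → ℂ} (hP : P ∈ Vn n) : Chg n P := by
  refine Submodule.span_induction (p := fun P _ => Chg n P) ?_ ?_ ?_ ?_ hP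
  · rintro _ ⟨a, rfl⟩ α hα z
    simp only [onb, mon, sphMap_coe, za_dia, zb_dia, mul_pow, zpow_natCast]
    have : α ^ n = α ^ (a : ℕ) * α ^ (n - a) := by rw [← pow_add]; congr 1; omega
    rw [this]; ring
  · intro α hα z; simp
  · intro x y _ _ hx hy α hα z; simp [hx α hα z, hy α hα z]; ring
  · intro a x _ hx α hα z; simp [hx α hα z]; ring

lemma amgm_aux {x X Y : ℝ} (hX : 0 ≤ X) (hY : 0 ≤ Y) (h : x ^ 2 ≤ X * Y) : x ≤ (X + Y) / 2 := by
  by_contra hh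
  push Not at hh
  nlinarith [sq_nonneg (X - Y)]

lemma re_sq_le (a : ℂ) : a.re ^ 2 ≤ Complex.normSq a := by
  rw [Complex.normSq_apply]; nlinarith [mul_self_nonneg a.im]

lemma dist_bound (n : ℕ) {w : S3 → ℝ} {wA wB wBA wBB : S3 → ℂ}
    (hw : Dd (fun z => (w z : ℂ)) wA wB) (hw2 : Dd wB wBA wBB)
    (wchg : Chg 0 (fun z => (w z : ℂ)))
    {a : S3 → ℝ} {aA aB : S3 → ℂ} (ha : Dd (fun z => (a z : ℂ)) aA aB)
    (achg : Chg 0 (fun z => (a z : ℂ)))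
    {q : S3 → ℝ} (hq : Continuous q) (hq0 : ∀ z, 0 ≤ q z)
    (hc : ∀ z, 0 ≤ (n + 2) - (wBA z).re)
    (hb : ∀ z, Complex.normSq (aB z) ≤ ((n + 2) - (wBA z).re) * q z)
    {e e0 : S3 → ℂ} (he : e ∈ Vn n) (he0 : e0 ∈ Vn n)
    (ho : ∀ f ∈ Vn n, ∫ z, (a z * e z - e0 z) * conj (f z) * Real.exp (w z) ∂mu3 = 0) :
    ∫ z, Complex.normSq (a z * e z - e0 z) * Real.exp (w z) ∂mu3 ≤
      ∫ z, q z * Complex.normSq (e z) * Real.exp (w z) ∂mu3 := by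
  have cw : Continuous w := by
    have := Complex.continuous_re.comp hw.c
    simpa [Function.comp_def] using this
  have ca : Continuous a := by
    have := Complex.continuous_re.comp ha.c
    simpa [Function.comp_def] using this
  have caB := ha.cB
  have cwBA := hw2.cA
  have ce := Vn_cont he
  have ce0 := Vn_cont he0
  have w0 : ∀ (α : ℂ) (hα : Complex.normSq α = 1) (z : S3), w (sphMap (dia α α hα hα) z) = w z := by
    intro α hα z
    have := wchg α hα z
    simp only [zpow_zero, one_mul] at this
    exact_mod_cast this
  set y : S3 → ℂ := fun z => a z * e z - e0 z with hy
  have cy : Continuous y := by fun_prop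
  set h : S3 → ℂ := fun z => y z * Real.exp (w z) with hh
  have ch : Continuous h := by fun_prop
  have hchg : Chg n h := by
    intro α hα z
    have h1 := achg α hα z
    simp only [zpow_zero, one_mul] at h1
    simp only [hh, hy, w0, h1, Vn_chg he α hα z, Vn_chg he0 α hα z]
    ring
  obtain ⟨M, hM⟩ : ∃ M, ∀ z : S3, Real.exp (- w z) ≤ M := by
    obtain ⟨M, hM⟩ := (isCompact_range (f := fun z : S3 => Real.exp (- w z)) (by fun_prop)).bddAbove
    exact ⟨M, fun z => hM ⟨z, rfl⟩⟩
  have hM0 : 0 < M := by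
    obtain ⟨z, -⟩ := hopf_surj ⟨EuclideanSpace.single 0 1, by simp⟩
    exact (Real.exp_pos _).trans_le (hM z)
  set A := ∫ z, Complex.normSq (y z) * Real.exp (w z) ∂mu3 with hA
  set R := ∫ z, q z * Complex.normSq (e z) * Real.exp (w z) ∂mu3 with hR
  have hA0 : 0 ≤ A := integral_nonneg fun z => mul_nonneg (Complex.normSq_nonneg _) (Real.exp_pos _).le
  have main : ∀ δ : ℝ, 0 < δ → δ ≤ 1 → A ≤ R + δ * (2 * A + 3) := by
    intro δ hδ hδ1
    obtain ⟨β, b1, hβ, hd⟩ := D_dense n ch hchg (fun f hf => by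
      rw [← ho f hf]; congr 1; ext z; simp only [hh, hy]; ring) (ε := δ ^ 2 / M) (by positivity)
    have hbo := bochner hβ hw hw2
    obtain ⟨b2, _, _, _, _, hβd, hβd1, hβd2, _⟩ := id hβ
    have cb1 := hβd.cA
    have cβ := hβd.c
    have hd2 : ∫ z, Complex.normSq (h z - b1 z) * Real.exp (- w z) ∂mu3 ≤ δ ^ 2 := by
      calc _ ≤ ∫ z, Complex.normSq (h z - b1 z) * M ∂mu3 := by
            apply integral_mono (S3.integrable (by fun_prop)) (S3.integrable (by fun_prop))
            intro z
            exact mul_le_mul_of_nonneg_left (hM z) (Complex.normSq_nonneg _)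
        _ ≤ δ ^ 2 / M * M := by
            rw [integral_mul_const]
            exact mul_le_mul_of_nonneg_right hd hM0.le
        _ = δ ^ 2 := by field_simp
    set E := ∫ z, Complex.normSq (h z - b1 z) * Real.exp (- w z) ∂mu3 with hE
    -- first term
    have s1 : ∫ z, (y z * conj (h z - b1 z)).re ∂mu3 ≤ (δ * A + δ⁻¹ * E) / 2 := by
      rw [hA, hE, ← integral_const_mul, ← integral_const_mul, ← integral_add
        (S3.integrable (by fun_prop)) (S3.integrable (by fun_prop)), ← integral_div]
      apply integral_mono (S3.integrable (by fun_prop)) (S3.integrable (by fun_prop))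
      intro z
      apply amgm_aux
      · have := Complex.normSq_nonneg (y z); positivity
      · have := Complex.normSq_nonneg (h z - b1 z); positivity
      · refine (re_sq_le _).trans (le_of_eq ?_)
        rw [Complex.normSq_mul, Complex.normSq_conj, Real.exp_neg]
        have := (Real.exp_pos (w z)).ne'
        field_simp
    -- second term
    have s2 : ∫ z, y z * conj (b1 z) ∂mu3 = ∫ z, -(aB z * e z * conj (β z)) ∂mu3 := by
      obtain ⟨e', hed⟩ := Vn_Dd he
      have i1 := ((ha.mul hed).mul hβd.conj').ibp.2
      have i2 : ∫ z, e0 z * conj (b1 z) ∂mu3 = 0 := by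
        have i3 := congrArg conj (D_ortho hβ he0)
        rw [← integral_conj] at i3
        simpa [mul_comm] using i3
      have i4 : ∫ z, a z * e z * conj (b1 z) ∂mu3 = ∫ z, -(aB z * e z * conj (β z)) ∂mu3 := by
        rw [← sub_eq_zero, ← integral_sub (S3.integrable (by fun_prop)) (S3.integrable (by fun_prop)), ← i1]
        congr 1; ext z; ring
      rw [← i4]
      simp only [hy, sub_mul]
      rw [integral_sub (S3.integrable (by fun_prop)) (S3.integrable (by fun_prop)), i2, sub_zero]
    have s3 : ∫ z, (-(aB z * e z * conj (β z))).re ∂mu3 ≤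
        (R + ∫ z, (((n + 2 : ℤ) : ℝ) - (wBA z).re) * Complex.normSq (β z) * Real.exp (- w z) ∂mu3) / 2 := by
      rw [hR, ← integral_add
        (S3.integrable (by fun_prop)) (S3.integrable (by fun_prop)), ← integral_div]
      apply integral_mono (S3.integrable (by fun_prop)) (S3.integrable (by fun_prop))
      intro z
      have hcz := hc z
      apply amgm_aux
      · exact mul_nonneg (mul_nonneg (hq0 z) (Complex.normSq_nonneg _)) (Real.exp_pos _).le
      · refine mul_nonneg (mul_nonneg ?_ (Complex.normSq_nonneg _)) (Real.exp_pos _).le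
        push_cast; exact hcz
      · refine (re_sq_le _).trans ?_
        rw [Complex.normSq_neg, Complex.normSq_mul, Complex.normSq_mul, Complex.normSq_conj, Real.exp_neg]
        have := (Real.exp_pos (w z)).ne'
        calc _ ≤ ((n + 2) - (wBA z).re) * q z * Complex.normSq (e z) * Complex.normSq (β z) := by
              have := Complex.normSq_nonneg (e z)
              have := Complex.normSq_nonneg (β z)
              gcongr
              exact hb z
          _ = _ := by push_cast; field_simp
    have s4 : ∫ z, Complex.normSq (b1 z) * Real.exp (- w z) ∂mu3 ≤ (1 + δ) * A + (1 + δ⁻¹) * E := by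
      rw [hA, hE, ← integral_const_mul, ← integral_const_mul, ← integral_add
        (S3.integrable (by fun_prop)) (S3.integrable (by fun_prop))]
      apply integral_mono (S3.integrable (by fun_prop)) (S3.integrable (by fun_prop))
      intro z
      have e1 : Complex.normSq (y z) * Real.exp (w z) = Complex.normSq (h z) * Real.exp (-w z) := by
        rw [hh]; simp only [Complex.normSq_mul, Complex.normSq_ofReal, Real.exp_neg]
        have := (Real.exp_pos (w z)).ne'
        field_simp
      simp only [e1]
      rw [← mul_assoc, ← mul_assoc, ← add_mul]
      apply mul_le_mul_of_nonneg_right _ (Real.exp_pos _).le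
      simp only [Complex.normSq_apply, Complex.sub_re, Complex.sub_im]
      have k : ∀ u v : ℝ, v * v ≤ (1 + δ) * (u * u) + (1 + δ⁻¹) * ((u - v) * (u - v)) := by
        intro u v
        have : (1 + δ) * (u * u) + (1 + δ⁻¹) * ((u - v) * (u - v)) - v * v
          = (δ * u + (u - v)) ^ 2 / δ := by field_simp; ring
        have : 0 ≤ (δ * u + (u - v)) ^ 2 / δ := by positivity
        linarith
      have := k (h z).re (b1 z).re
      have := k (h z).im (b1 z).im
      linarith
    have s5 : A = ∫ z, (y z * conj (h z - b1 z)).re ∂mu3 + ∫ z, (y z * conj (b1 z)).re ∂mu3 := by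
      rw [← integral_add (S3.integrable (by fun_prop)) (S3.integrable (by fun_prop)), hA]
      congr 1; ext z
      rw [← Complex.add_re, ← mul_add, ← map_add, sub_add_cancel]
      simp only [hh, map_mul, Complex.conj_ofReal]
      rw [← mul_assoc, Complex.mul_conj, ← Complex.ofReal_mul, Complex.ofReal_re]
    rw [← re_int (F := fun z => y z * conj (b1 z)) (by fun_prop), s2, re_int (by fun_prop)] at s5
    have s6 : δ⁻¹ * E ≤ δ := by
      rw [inv_mul_le_iff₀ hδ]; nlinarith
    have s7 : δ ^ 2 ≤ δ := by nlinarith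
    nlinarith
  refine le_of_forall_pos_le_add fun ε hε => ?_
  have h3 : 0 < 2 * A + 3 := by positivity
  have := main (min 1 (ε / (2 * A + 3))) (lt_min one_pos (by positivity)) (min_le_left _ _)
  have h4 : min 1 (ε / (2 * A + 3)) * (2 * A + 3) ≤ ε := by
    calc _ ≤ ε / (2 * A + 3) * (2 * A + 3) := by gcongr; exact min_le_right _ _
      _ = ε := by field_simp
  linarith
end

noncomputable section
open MeasureTheory Real Metric
open scoped ENNReal RealInnerProductSpace Manifold Pointwise ComplexOrder MatrixOrder Matrix.Norms.L2Operator
local notation "conj" => starRingEnd ℂ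

lemma det_deriv {n : ℕ} {G : ℝ → Matrix (Fin n) (Fin n) ℂ} {G1 : Matrix (Fin n) (Fin n) ℂ} {t : ℝ}
    (hG : ∀ i j, HasDerivAt (fun s => G s i j) (G1 i j) t) :
    HasDerivAt (fun s => (G s).det) ((G t).adjugate * G1).trace t := by
  have h1 : HasDerivAt (fun s => ∑ σ : Equiv.Perm (Fin n), ((Equiv.Perm.sign σ : ℤ) : ℂ) * ∏ i, G s (σ i) i)
      (∑ σ : Equiv.Perm (Fin n), ((Equiv.Perm.sign σ : ℤ) : ℂ) *
        ∑ i, (∏ j ∈ Finset.univ.erase i, G t (σ j) j) • G1 (σ i) i) t := by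
    apply HasDerivAt.fun_sum
    intro σ _
    apply HasDerivAt.const_mul
    exact HasDerivAt.fun_finsetProd (fun i _ => hG (σ i) i)
  have h2 : (fun s => (G s).det) = fun s => ∑ σ : Equiv.Perm (Fin n), ((Equiv.Perm.sign σ : ℤ) : ℂ) * ∏ i, G s (σ i) i := by
    ext s; rw [Matrix.det_apply']
  rw [h2]
  refine h1.congr_deriv ?_
  have h3 : ((G t).adjugate * G1).trace = ∑ i, ((G t).updateCol i (fun k => G1 k i)).det := by
    rw [Matrix.trace]
    refine Finset.sum_congr rfl fun i _ => ?_
    rw [← Matrix.cramer_apply, Matrix.cramer_eq_adjugate_mulVec]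
    simp [Matrix.mul_apply, Matrix.mulVec, dotProduct]
  rw [h3]
  simp only [Matrix.det_apply', Finset.mul_sum]
  rw [Finset.sum_comm]
  refine Finset.sum_congr rfl fun i _ => Finset.sum_congr rfl fun σ _ => ?_
  rw [← Finset.mul_prod_erase Finset.univ _ (Finset.mem_univ i)]
  simp only [Matrix.updateCol_self, smul_eq_mul]
  rw [mul_comm (G1 (σ i) i)]
  congr 2
  refine Finset.prod_congr rfl fun j hj => ?_
  rw [Matrix.updateCol_ne (Finset.ne_of_mem_erase hj)]

lemma inv_deriv {n : ℕ} {G : ℝ → Matrix (Fin n) (Fin n) ℂ} {G1 : Matrix (Fin n) (Fin n) ℂ} {t : ℝ}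
    (hG : ∀ i j, HasDerivAt (fun s => G s i j) (G1 i j) t) (hpd : ∀ t, (G t).PosDef) (i j : Fin n) :
    HasDerivAt (fun s => (G s)⁻¹ i j) (- ((G t)⁻¹ * G1 * (G t)⁻¹) i j) t := by
  have hne : ∀ t, (G t).det ≠ 0 := fun t => (hpd t).det_pos.ne'
  have hex : ∀ i j, ∃ d, HasDerivAt (fun s => (G s)⁻¹ i j) d t := by
    intro i j
    have h1 : (fun s => (G s)⁻¹ i j) = fun s => ((G s).det)⁻¹ * ((G s).updateRow j (Pi.single i 1)).det := by
      ext s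
      rw [Matrix.inv_def, Ring.inverse_eq_inv', Matrix.smul_apply, Matrix.adjugate_apply, smul_eq_mul]
    rw [h1]
    have h2 := det_deriv (G := fun s => (G s).updateRow j (Pi.single i 1))
      (G1 := G1.updateRow j 0) (t := t) (by
      intro a b
      by_cases h : a = j
      · subst h; simpa using hasDerivAt_const t _
      · simpa [Matrix.updateRow_ne h] using hG a b)
    exact ⟨_, ((det_deriv hG).fun_inv (hne t)).mul h2⟩
  choose d hd using hex
  have key : ∀ i j, ∑ k, (d i k * G t k j + (G t)⁻¹ i k * G1 k j) = 0 := by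
    intro i j
    have h1 : HasDerivAt (fun s => ∑ k, (G s)⁻¹ i k * G s k j) _ t :=
      HasDerivAt.fun_sum (fun k _ => (hd i k).mul (hG k j))
    have h2 : (fun s => ∑ k, (G s)⁻¹ i k * G s k j) = fun s => (1 : Matrix (Fin n) (Fin n) ℂ) i j := by
      ext s
      rw [← Matrix.nonsing_inv_mul (G s) (isUnit_iff_ne_zero.2 (hne s)), Matrix.mul_apply]
    rw [h2] at h1
    exact h1.unique (hasDerivAt_const t _)
  have key2 : (Matrix.of d) * G t = - ((G t)⁻¹ * G1) := by
    ext a b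
    have := key a b
    rw [Finset.sum_add_distrib] at this
    simp only [Matrix.mul_apply, Matrix.neg_apply, Matrix.of_apply]
    linear_combination this
  have key3 : Matrix.of d = - ((G t)⁻¹ * G1 * (G t)⁻¹) := by
    rw [← Matrix.neg_mul, ← key2, Matrix.mul_nonsing_inv_cancel_right _ _ (isUnit_iff_ne_zero.2 (hne t))]
  have := hd i j
  rwa [show d i j = - ((G t)⁻¹ * G1 * (G t)⁻¹) i j from congrFun (congrFun key3 i) j] at this

lemma logdet_concave {n : ℕ} {G G1 G2 : ℝ → Matrix (Fin n) (Fin n) ℂ}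
    (hG : ∀ t i j, HasDerivAt (fun s => G s i j) (G1 t i j) t)
    (hG1 : ∀ t i j, HasDerivAt (fun s => G1 s i j) (G2 t i j) t)
    (hpd : ∀ t, (G t).PosDef)
    (hW : ∀ t (u : Fin n → ℂ), (u ⬝ᵥ (G2 t - G1 t * (G t)⁻¹ * G1 t).mulVec (star u)).re ≤ 0) :
    Real.log (G 1).det.re ≤ Real.log (G 0).det.re + ((G 0)⁻¹ * G1 0).trace.re := by
  have hdp : ∀ t, 0 < (G t).det.re ∧ (G t).det = ((G t).det.re : ℂ) := by
    intro t
    have := (hpd t).det_pos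
    rw [Complex.lt_def] at this
    refine ⟨by simpa using this.1, Complex.ext (by simp) (by simpa using this.2.symm)⟩
  have h1 : ∀ t, HasDerivAt (fun s => Real.log (G s).det.re) (((G t)⁻¹ * G1 t).trace.re) t := by
    intro t
    have h2 := det_deriv (hG t)
    have h3 : HasDerivAt (fun s => (G s).det.re) (((G t).adjugate * G1 t).trace).re t :=
      Complex.reCLM.hasFDerivAt.comp_hasDerivAt t h2
    refine (h3.log (hdp t).1.ne').congr_deriv ?_
    rw [Matrix.inv_def, Ring.inverse_eq_inv', Matrix.smul_mul, Matrix.trace_smul, smul_eq_mul]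
    rw [(hdp t).2, ← Complex.ofReal_inv, Complex.re_ofReal_mul, Complex.ofReal_re]
    field_simp
  have h2 : ∀ t, HasDerivAt (fun s => ((G s)⁻¹ * G1 s).trace.re)
      ((G t)⁻¹ * (G2 t - G1 t * (G t)⁻¹ * G1 t)).trace.re t := by
    intro t
    have h3 : HasDerivAt (fun s => ∑ i, ∑ j, (G s)⁻¹ i j * G1 s j i) _ t :=
      HasDerivAt.fun_sum fun i _ => HasDerivAt.fun_sum fun j _ =>
        (inv_deriv (hG t) hpd i j).mul (hG1 t j i)
    have h4 : HasDerivAt (fun s => (∑ i, ∑ j, (G s)⁻¹ i j * G1 s j i).re) _ t :=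
      Complex.reCLM.hasFDerivAt.comp_hasDerivAt t h3
    have h5 : (fun s => ((G s)⁻¹ * G1 s).trace.re) = fun s => (∑ i, ∑ j, (G s)⁻¹ i j * G1 s j i).re := by
      ext s; simp only [Matrix.trace, Matrix.mul_apply, Matrix.diag]
    rw [h5]
    refine h4.congr_deriv ?_
    rw [Complex.reCLM_apply]
    congr 1
    have : (G t)⁻¹ * (G2 t - G1 t * (G t)⁻¹ * G1 t) = (G t)⁻¹ * G2 t - (G t)⁻¹ * G1 t * (G t)⁻¹ * G1 t := by
      simp only [Matrix.mul_sub, Matrix.mul_assoc]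
    rw [this, Matrix.trace_sub, Matrix.trace, Matrix.trace, ← Finset.sum_sub_distrib]
    refine Finset.sum_congr rfl fun i _ => ?_
    simp only [Matrix.diag, Matrix.mul_apply (M := (G t)⁻¹) (N := G2 t),
      Matrix.mul_apply (M := (G t)⁻¹ * G1 t * (G t)⁻¹) (N := G1 t)]
    rw [← Finset.sum_sub_distrib]
    refine Finset.sum_congr rfl fun j _ => ?_
    ring
  have h3 : ∀ t, ((G t)⁻¹ * (G2 t - G1 t * (G t)⁻¹ * G1 t)).trace.re ≤ 0 := by
    intro t
    obtain ⟨B, hB⟩ := CStarAlgebra.nonneg_iff_eq_star_mul_self.mp (hpd t).inv.posSemidef.nonneg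
    set W := G2 t - G1 t * (G t)⁻¹ * G1 t with hWd
    rw [Matrix.star_eq_conjTranspose] at hB
    rw [hB, Matrix.mul_assoc, Matrix.trace_mul_comm, Matrix.trace, Complex.re_sum]
    refine Finset.sum_nonpos fun i _ => ?_
    refine le_of_eq_of_le ?_ (hW t (B i))
    congr 1
    rw [← hWd]
    simp only [Matrix.diag, Matrix.mul_apply, dotProduct, Matrix.mulVec, Finset.mul_sum, Finset.sum_mul,
      Matrix.conjTranspose_apply, Pi.star_apply]
    rw [Finset.sum_comm]
    refine Finset.sum_congr rfl fun j _ => Finset.sum_congr rfl fun k _ => by ring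
  have hanti : Antitone (fun s => ((G s)⁻¹ * G1 s).trace.re) :=
    antitone_of_hasDerivAt_nonpos h2 h3
  obtain ⟨c, hc, hc2⟩ := exists_hasDerivAt_eq_slope (fun s => Real.log (G s).det.re) _ (zero_lt_one)
    (fun s _ => (h1 s).continuousAt.continuousWithinAt) (fun s _ => h1 s)
  have := hanti hc.1.le
  simp only [sub_zero, div_one] at hc2 this
  linarith

lemma param_deriv {F F' : ℝ → S3 → ℂ} (hF : ∀ t, Continuous (F t))
    (hF' : Continuous fun q : ℝ × S3 => F' q.1 q.2)
    (hd : ∀ t z, HasDerivAt (fun s => F s z) (F' t z) t) (t : ℝ) :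
    HasDerivAt (fun s => ∫ z, F s z ∂mu3) (∫ z, F' t z ∂mu3) t := by
  obtain ⟨M, hM⟩ : ∃ M, ∀ s ∈ Set.Icc (t - 1) (t + 1), ∀ z : S3, ‖F' s z‖ ≤ M := by
    have hc : IsCompact (Set.Icc (t - 1) (t + 1) ×ˢ (Set.univ : Set S3)) := isCompact_Icc.prod isCompact_univ
    obtain ⟨M, hM⟩ := (hc.image hF'.norm).bddAbove
    exact ⟨M, fun s hs z => hM ⟨(s, z), ⟨hs, trivial⟩, rfl⟩⟩
  have hc' : ∀ t, Continuous (F' t) := fun t => hF'.comp (by fun_prop : Continuous fun z : S3 => (t, z))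
  exact (hasDerivAt_integral_of_dominated_loc_of_deriv_le (μ := mu3) (F := F) (F' := F') (x₀ := t)
    (s := Set.Icc (t - 1) (t + 1)) (bound := fun _ => M)
    (Icc_mem_nhds (by linarith) (by linarith))
    (Filter.Eventually.of_forall fun s => (S3.integrable (hF s)).aestronglyMeasurable)
    (S3.integrable (hF t)) (S3.integrable (hc' t)).aestronglyMeasurable
    (Filter.Eventually.of_forall fun z s hs => hM s hs z)
    (integrable_const _) (Filter.Eventually.of_forall fun z s _ => hd s z)).2
end

noncomputable section
open MeasureTheory Real Metric
open scoped ENNReal RealInnerProductSpace Manifold Pointwise ComplexOrder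
local notation "conj" => starRingEnd ℂ

lemma Vn_Dd2 {k : ℕ} {P : S3 → ℂ} (hP : P ∈ Vn k) : ∃ P' P'' : S3 → ℂ, Dd P P' (fun _ => 0) ∧
    Dd P' P'' (fun z => - k * P z) := by
  have h1 : ∃ b1, Gd k P b1 := by
    refine Submodule.span_induction (p := fun P _ => ∃ b1, Gd k P b1) ?_ ?_ ?_ ?_ hP
    · rintro _ ⟨a, rfl⟩
      refine ⟨_, ((Mono_Gd a (k - a) 0 0 k (by have := a.2; push_cast; omega)).smul
        ((Real.sqrt (mom a (k - a)) : ℂ)⁻¹)).congr rfl (fun z => ?_) (fun z => rfl)⟩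
      simp [onb, mon, Mono]
    · exact ⟨fun _ => 0, ⟨_, _, _, _, _, Dd.const 0, Dd.const 0, Dd.const 0, fun z => by simp⟩⟩
    · rintro x y _ _ ⟨b, hb⟩ ⟨c, hc⟩
      exact ⟨_, hb.add hc⟩
    · rintro a x _ ⟨b, hb⟩
      exact ⟨_, hb.smul a⟩
  obtain ⟨b1, b2, b11, b12, b21, b22, k1, k2, k3, k4⟩ := h1
  obtain ⟨P', h2⟩ := Vn_Dd hP
  obtain ⟨rfl, rfl⟩ := k1.unique h2
  obtain ⟨rfl, rfl⟩ := k3.unique (Dd.const 0)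
  refine ⟨b1, b11, k1, k2.congr (fun _ => rfl) (fun _ => rfl) (fun z => ?_)⟩
  have := k4 z
  push_cast at this
  linear_combination this

lemma cs_aux {ι : Type*} [Fintype ι] (μ : ι → ℝ) (hμ : ∀ i, 0 ≤ μ i) (x y : ι → ℂ) :
    Complex.normSq (∑ i, μ i * x i * conj (y i)) ≤
      (∑ i, μ i * Complex.normSq (x i)) * ∑ i, μ i * Complex.normSq (y i) := by
  have h1 : ‖∑ i, (μ i : ℂ) * x i * conj (y i)‖ ≤ ∑ i, (√(μ i) * ‖x i‖) * (√(μ i) * ‖y i‖) := by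
    refine (norm_sum_le _ _).trans (le_of_eq ?_)
    refine Finset.sum_congr rfl fun i _ => ?_
    rw [norm_mul, norm_mul, RCLike.norm_conj, Complex.norm_real, Real.norm_of_nonneg (hμ i)]
    nth_rw 1 [← Real.mul_self_sqrt (hμ i)]; ring
  rw [Complex.normSq_eq_norm_sq]
  calc _ ≤ (∑ i, (√(μ i) * ‖x i‖) * (√(μ i) * ‖y i‖)) ^ 2 := by gcongr
    _ ≤ _ := by
      refine (Finset.sum_mul_sq_le_sq_mul_sq _ _ _).trans (le_of_eq ?_)
      congr 1 <;>
      · refine Finset.sum_congr rfl fun i _ => ?_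
        rw [mul_pow, Real.sq_sqrt (hμ i), Complex.normSq_eq_norm_sq]

lemma sum_normSq_c {ι : Type*} [Fintype ι] (μ : ι → ℝ) (x : ι → ℂ) :
    ((∑ i, μ i * Complex.normSq (x i) : ℝ) : ℂ) = ∑ i, μ i * (x i * conj (x i)) := by
  push_cast
  refine Finset.sum_congr rfl fun i _ => ?_
  rw [Complex.mul_conj]

lemma cov_aux {ι : Type*} [Fintype ι] (μ : ι → ℝ) (hμ : ∀ i, 0 ≤ μ i) (lam : ι → ℝ) (P Q : ι → ℂ)
    (S S1 S2 T : ℝ) (B C : ℂ) (hS : S = ∑ i, μ i * Complex.normSq (P i))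
    (hS1 : S1 = ∑ i, lam i * μ i * Complex.normSq (P i))
    (hS2 : S2 = ∑ i, lam i ^ 2 * μ i * Complex.normSq (P i))
    (hT : T = ∑ i, μ i * Complex.normSq (Q i))
    (hB : B = ∑ i, μ i * (Q i * conj (P i))) (hC : C = ∑ i, lam i * μ i * (Q i * conj (P i)))
    (hpos : 0 < S) :
    Complex.normSq (S * C - S1 * B) ≤ (S * T - Complex.normSq B) * (S * S2 - S1 ^ 2) := by
  have hSc : (S : ℂ) = ∑ i, μ i * (P i * conj (P i)) := by rw [hS, sum_normSq_c]
  have hS1c : (S1 : ℂ) = ∑ i, lam i * μ i * (P i * conj (P i)) := by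
    rw [hS1, sum_normSq_c (fun i => lam i * μ i) P]; push_cast; rfl
  have hS2c : (S2 : ℂ) = ∑ i, lam i ^ 2 * μ i * (P i * conj (P i)) := by
    rw [hS2, sum_normSq_c (fun i => lam i ^ 2 * μ i) P]; push_cast; rfl
  have hTc : (T : ℂ) = ∑ i, μ i * (Q i * conj (Q i)) := by rw [hT, sum_normSq_c]
  have hBc : conj B = ∑ i, μ i * (P i * conj (Q i)) := by
    rw [hB, map_sum]; refine Finset.sum_congr rfl fun i _ => ?_
    simp only [map_mul, Complex.conj_ofReal, Complex.conj_conj]; ring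
  have h := cs_aux μ hμ (fun i => S * Q i - B * P i) (fun i => ((S * lam i - S1 : ℝ) : ℂ) * P i)
  have e1 : ∑ i, (μ i : ℂ) * (S * Q i - B * P i) * conj (((S * lam i - S1 : ℝ) : ℂ) * P i) =
      S * (S * C - S1 * B) := by
    have : ∀ i, (μ i : ℂ) * (S * Q i - B * P i) * conj (((S * lam i - S1 : ℝ) : ℂ) * P i) =
        (S * S) * (lam i * μ i * (Q i * conj (P i))) - (S * S1) * (μ i * (Q i * conj (P i)))
        - (B * S) * (lam i * μ i * (P i * conj (P i))) + (B * S1) * (μ i * (P i * conj (P i))) := by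
      intro i; rw [map_mul, Complex.conj_ofReal]; push_cast; ring
    simp only [this]
    rw [Finset.sum_add_distrib, Finset.sum_sub_distrib, Finset.sum_sub_distrib, ← Finset.mul_sum,
      ← Finset.mul_sum, ← Finset.mul_sum, ← Finset.mul_sum, ← hC, ← hB, ← hS1c, ← hSc]
    ring
  have e2 : ∑ i, μ i * Complex.normSq (S * Q i - B * P i) = S * (S * T - Complex.normSq B) := by
    have : ∀ i, (μ i : ℂ) * ((S * Q i - B * P i) * conj (S * Q i - B * P i)) =
        (S * S) * (μ i * (Q i * conj (Q i))) - (S * conj B) * (μ i * (Q i * conj (P i)))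
        - (S * B) * (μ i * (P i * conj (Q i))) + (B * conj B) * (μ i * (P i * conj (P i))) := by
      intro i; rw [map_sub, map_mul, map_mul, Complex.conj_ofReal]; ring
    have h3 := sum_normSq_c μ (fun i => S * Q i - B * P i)
    simp only [this] at h3
    rw [Finset.sum_add_distrib, Finset.sum_sub_distrib, Finset.sum_sub_distrib, ← Finset.mul_sum,
      ← Finset.mul_sum, ← Finset.mul_sum, ← Finset.mul_sum, ← hTc, ← hB, ← hBc, ← hSc] at h3
    have h4 : ((∑ i, μ i * Complex.normSq (S * Q i - B * P i) : ℝ) : ℂ) = ((S * (S * T - Complex.normSq B) : ℝ) : ℂ) := by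
      rw [h3]; push_cast; rw [← Complex.mul_conj]; ring
    exact_mod_cast h4
  have e3 : ∑ i, μ i * Complex.normSq (((S * lam i - S1 : ℝ) : ℂ) * P i) = S * (S * S2 - S1 ^ 2) := by
    have : ∀ i, μ i * Complex.normSq (((S * lam i - S1 : ℝ) : ℂ) * P i) =
        (S * S) * (lam i ^ 2 * μ i * Complex.normSq (P i)) - (2 * S * S1) * (lam i * μ i * Complex.normSq (P i))
        + (S1 ^ 2) * (μ i * Complex.normSq (P i)) := by
      intro i; rw [Complex.normSq_mul, Complex.normSq_ofReal]; ring
    simp only [this]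
    rw [Finset.sum_add_distrib, Finset.sum_sub_distrib, ← Finset.mul_sum, ← Finset.mul_sum, ← Finset.mul_sum,
      ← hS, ← hS1, ← hS2]
    ring
  rw [e1, e2, e3, Complex.normSq_mul, Complex.normSq_ofReal] at h
  have : 0 < S * S := by positivity
  nlinarith

/-- the matrix of multiplication by a function -/
def Mat (n : ℕ) (ψ : S3 → ℝ) : Matrix (Fin (n + 1)) (Fin (n + 1)) ℂ :=
  Matrix.of fun a b => ∫ z, onb n a z * conj (onb n b z) * ψ z ∂mu3

/-- the section with given coefficients -/
def sec (n : ℕ) (u : Fin (n + 1) → ℂ) (z : S3) : ℂ := ∑ a, u a * onb n a z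

@[fun_prop] lemma sec_cont (n : ℕ) (u : Fin (n + 1) → ℂ) : Continuous (sec n u) := by
  unfold sec; fun_prop

lemma sec_mem (n : ℕ) (u : Fin (n + 1) → ℂ) : sec n u ∈ Vn n := Vn_iff.2 ⟨u, fun _ => rfl⟩

lemma mat_form (n : ℕ) {ψ : S3 → ℝ} (hψ : Continuous ψ) (u v : Fin (n + 1) → ℂ) :
    u ⬝ᵥ (Mat n ψ).mulVec (star v) = ∫ z, sec n u z * conj (sec n v z) * ψ z ∂mu3 := by
  have h : ∀ z, sec n u z * conj (sec n v z) * ψ z =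
      ∑ a, ∑ b, (u a * conj (v b)) * (onb n a z * conj (onb n b z) * ψ z) := by
    intro z
    rw [sec, sec, map_sum, Finset.sum_mul_sum, Finset.sum_mul]
    refine Finset.sum_congr rfl fun a _ => ?_
    rw [Finset.sum_mul]
    refine Finset.sum_congr rfl fun b _ => ?_
    rw [map_mul]; ring
  simp only [h]
  rw [integral_finsetSum _ (fun a _ => S3.integrable (by fun_prop))]
  simp only [dotProduct, Matrix.mulVec, Finset.mul_sum]
  refine Finset.sum_congr rfl fun a _ => ?_
  rw [integral_finsetSum _ (fun a _ => S3.integrable (by fun_prop))]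
  refine Finset.sum_congr rfl fun b _ => ?_
  rw [integral_const_mul, Mat, Matrix.of_apply, Pi.star_apply]
  simp only [RCLike.star_def]; ring

lemma mat_one (n : ℕ) : Mat n (fun _ => 1) = 1 := by
  ext a b
  have := onb_ortho n a b
  simp only [Mat, Matrix.of_apply, Complex.ofReal_one, mul_one, this, Matrix.one_apply]

lemma sec_norm (n : ℕ) (u : Fin (n + 1) → ℂ) : ∫ z, Complex.normSq (sec n u z) ∂mu3 = ∑ a, Complex.normSq (u a) := by
  have h := mat_form n (ψ := fun _ => 1) continuous_const u u
  rw [mat_one, Matrix.one_mulVec] at h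
  have h2 : ∫ z, ((Complex.normSq (sec n u z) : ℝ) : ℂ) ∂mu3 = ∑ a, ((Complex.normSq (u a) : ℝ) : ℂ) := by
    simp only [← Complex.mul_conj]
    simpa [dotProduct] using h.symm
  rw [integral_complex_ofReal] at h2
  exact_mod_cast h2

lemma mat_posDef (n : ℕ) {ψ : S3 → ℝ} (hψ : Continuous ψ) (hp : ∀ z, 0 < ψ z) : (Mat n ψ).PosDef := by
  rw [Matrix.posDef_iff_dotProduct_mulVec]
  refine ⟨?_, ?_⟩
  · ext a b
    rw [Matrix.conjTranspose_apply, Mat, Matrix.of_apply, Matrix.of_apply]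
    simp only [RCLike.star_def]
    rw [← integral_conj]
    congr 1; ext z; simp only [map_mul, Complex.conj_ofReal, Complex.conj_conj]; ring
  · intro x hx
    have h := mat_form n hψ (star x) (star x)
    rw [star_star] at h
    rw [h]
    have h1 : ∀ z, sec n (star x) z * conj (sec n (star x) z) * ψ z =
        ((Complex.normSq (sec n (star x) z) * ψ z : ℝ) : ℂ) := by
      intro z; rw [Complex.mul_conj]; push_cast; ring
    simp only [h1]
    rw [integral_complex_ofReal]
    norm_cast
    obtain ⟨z0, hz0⟩ : ∃ z0, ∀ z, ψ z0 ≤ ψ z := by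
      obtain ⟨z, -⟩ := hopf_surj ⟨EuclideanSpace.single 0 1, by simp⟩
      have : Nonempty S3 := ⟨z⟩
      obtain ⟨z0, h0⟩ := hψ.exists_forall_le_of_isBounded (x₀ := z) (Metric.isBounded_of_compactSpace)
      exact ⟨z0, h0⟩
    have h2 : ∫ z, Complex.normSq (sec n (star x) z) * ψ z0 ∂mu3 ≤ ∫ z, Complex.normSq (sec n (star x) z) * ψ z ∂mu3 := by
      apply integral_mono (S3.integrable (by fun_prop)) (S3.integrable (by fun_prop))
      intro z
      exact mul_le_mul_of_nonneg_left (hz0 z) (Complex.normSq_nonneg _)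
    refine lt_of_lt_of_le ?_ h2
    rw [integral_mul_const, sec_norm]
    refine mul_pos ?_ (hp z0)
    obtain ⟨i, hi⟩ := Function.ne_iff.1 hx
    refine Finset.sum_pos' (fun i _ => Complex.normSq_nonneg _) ⟨i, Finset.mem_univ _, ?_⟩
    rw [Complex.normSq_pos]; simpa using hi
end

noncomputable section
open MeasureTheory Real Metric
open scoped ENNReal RealInnerProductSpace Manifold Pointwise ComplexOrder
local notation "conj" => starRingEnd ℂ

/-- `Σ λ^m e^{tλ} |P|²` -/
def Sm {k : ℕ} (P : Fin (k + 1) → S3 → ℂ) (lam : Fin (k + 1) → ℝ) (m : ℕ) (t : ℝ) (z : S3) : ℝ :=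
  ∑ j, lam j ^ m * Real.exp (t * lam j) * Complex.normSq (P j z)

section
variable {k : ℕ} {P : Fin (k + 1) → S3 → ℂ} {lam : Fin (k + 1) → ℝ}

lemma Sm_cont2 (hP : ∀ j, Continuous (P j)) (m : ℕ) : Continuous fun q : ℝ × S3 => Sm P lam m q.1 q.2 := by
  unfold Sm
  refine continuous_finset_sum _ fun j _ => ?_
  have := hP j
  fun_prop

lemma Sm_cont (hP : ∀ j, Continuous (P j)) (m : ℕ) (t : ℝ) : Continuous (Sm P lam m t) :=
  (Sm_cont2 hP m).comp (by fun_prop : Continuous fun z : S3 => (t, z))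

lemma Sm_deriv (m : ℕ) (t : ℝ) (z : S3) : HasDerivAt (fun s => Sm P lam m s z) (Sm P lam (m + 1) t z) t := by
  unfold Sm
  refine HasDerivAt.fun_sum fun j _ => ?_
  have := (((hasDerivAt_id t).mul_const (lam j)).exp.const_mul (lam j ^ m)).mul_const (Complex.normSq (P j z))
  refine this.congr_deriv ?_
  simp only [id]; ring

lemma S_pos (hsum : ∀ z, ∑ j, Complex.normSq (P j z) = k + 1) (t : ℝ) (z : S3) : 0 < Sm P lam 0 t z := by
  unfold Sm
  obtain ⟨j, -, hj⟩ : ∃ j ∈ Finset.univ, 0 < Complex.normSq (P j z) := by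
    apply Finset.exists_lt_of_sum_lt (f := fun _ => (0 : ℝ))
    rw [hsum]; simp; positivity
  refine Finset.sum_pos' (fun i _ => ?_) ⟨j, Finset.mem_univ _, by positivity⟩
  have := Complex.normSq_nonneg (P i z)
  positivity

lemma Sm_Dd (hP : ∀ j, P j ∈ Vn k) (m : ℕ) (t : ℝ) {P' : Fin (k + 1) → S3 → ℂ}
    (h : ∀ j, Dd (P j) (P' j) (fun _ => 0)) :
    Dd (fun z => (Sm P lam m t z : ℂ))
      (fun z => ∑ j, ((lam j ^ m * Real.exp (t * lam j) : ℝ) : ℂ) * (P' j z * conj (P j z)))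
      (fun z => ∑ j, ((lam j ^ m * Real.exp (t * lam j) : ℝ) : ℂ) * (P j z * conj (P' j z))) := by
  have h1 := Dd.sum Finset.univ (fun j _ => ((h j).mul (h j).conj').smul ((lam j ^ m * Real.exp (t * lam j) : ℝ) : ℂ))
  refine h1.congr (fun z => ?_) (fun z => ?_) (fun z => ?_)
  · rw [Sm, Complex.ofReal_sum]
    refine Finset.sum_congr rfl fun j _ => ?_
    rw [Complex.mul_conj]; push_cast; ring
  · refine Finset.sum_congr rfl fun j _ => ?_
    simp
  · refine Finset.sum_congr rfl fun j _ => ?_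
    simp

lemma Sm_chg (hP : ∀ j, P j ∈ Vn k) (m : ℕ) (t : ℝ) (α : ℂ) (hα : Complex.normSq α = 1) (z : S3) :
    Sm P lam m t (sphMap (dia α α hα hα) z) = Sm P lam m t z := by
  unfold Sm
  refine Finset.sum_congr rfl fun j _ => ?_
  rw [Vn_chg (hP j) α hα z, Complex.normSq_mul, map_zpow₀, hα, one_zpow, one_mul]

end

lemma concave_path (n k : ℕ) (hk : 0 < k) (P : Fin (k + 1) → S3 → ℂ) (lam : Fin (k + 1) → ℝ)
    (hP : ∀ j, P j ∈ Vn k) (hsum : ∀ z, ∑ j, Complex.normSq (P j z) = k + 1)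
    (hn : ∀ j, ∫ z, Complex.normSq (P j z) ∂mu3 = 1) :
    Real.log (Mat n (fun z => Real.exp (-((n + 2 : ℝ) / k) * Real.log (Sm P lam 0 1 z / (k + 1))))).det.re ≤
      - ((n + 1) * (n + 2) / (k * (k + 1))) * ∑ j, lam j := by
  set p : ℝ := (n + 2 : ℝ) / k with hp
  have hk' : (0 : ℝ) < k := by exact_mod_cast hk
  have hp0 : 0 < p := by positivity
  have hpk : p * k = n + 2 := by rw [hp]; field_simp
  have hPc : ∀ j, Continuous (P j) := fun j => Vn_cont (hP j)
  have hS := fun t z => S_pos (lam := lam) hsum t z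
  set S := Sm P lam 0 with hSd
  set S1 := Sm P lam 1 with hS1d
  set S2 := Sm P lam 2 with hS2d
  have c0 : Continuous fun q : ℝ × S3 => S q.1 q.2 := Sm_cont2 hPc 0
  have c1 : Continuous fun q : ℝ × S3 => S1 q.1 q.2 := Sm_cont2 hPc 1
  have c2 : Continuous fun q : ℝ × S3 => S2 q.1 q.2 := Sm_cont2 hPc 2
  have d0 : ∀ t z, HasDerivAt (fun s => S s z) (S1 t z) t := fun t z => Sm_deriv 0 t z
  have d1 : ∀ t z, HasDerivAt (fun s => S1 s z) (S2 t z) t := fun t z => Sm_deriv 1 t z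
  set w : ℝ → S3 → ℝ := fun t z => -p * Real.log (S t z / (k + 1)) with hwd
  set w1 : ℝ → S3 → ℝ := fun t z => -p * (S1 t z / S t z) with hw1d
  set w2 : ℝ → S3 → ℝ := fun t z => -p * ((S2 t z * S t z - S1 t z * S1 t z) / S t z ^ 2) with hw2d
  have hSne : ∀ q : ℝ × S3, S q.1 q.2 ≠ 0 := fun q => (hS _ _).ne'
  have hk1 : (k + 1 : ℝ) ≠ 0 := by positivity
  have cw : Continuous fun q : ℝ × S3 => w q.1 q.2 := by
    refine continuous_const.mul (Continuous.log (c0.div_const _) fun q => ?_)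
    exact div_ne_zero (hSne q) hk1
  have cw1 : Continuous fun q : ℝ × S3 => w1 q.1 q.2 := continuous_const.mul (c1.div c0 hSne)
  have cw2 : Continuous fun q : ℝ × S3 => w2 q.1 q.2 := by
    refine continuous_const.mul (Continuous.div (by fun_prop) (by fun_prop) fun q => ?_)
    exact pow_ne_zero 2 (hSne q)
  have dw : ∀ t z, HasDerivAt (fun s => w s z) (w1 t z) t := by
    intro t z
    have := (((d0 t z).div_const (k + 1 : ℝ)).log (div_ne_zero (hS t z).ne' hk1)).const_mul (-p)
    refine this.congr_deriv ?_
    have := (hS t z).ne'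
    simp only [hw1d]; field_simp
  have dw1 : ∀ t z, HasDerivAt (fun s => w1 s z) (w2 t z) t := by
    intro t z
    exact (((d1 t z).div (d0 t z) (hS t z).ne').const_mul (-p))
  have slice : ∀ (f : ℝ → S3 → ℝ), (Continuous fun q : ℝ × S3 => f q.1 q.2) → ∀ t, Continuous (f t) :=
    fun f hf t => hf.comp (by fun_prop : Continuous fun z : S3 => (t, z))
  have sw := slice w cw
  have sw1 := slice w1 cw1
  have sw2 := slice w2 cw2
  -- the matrices
  let G : ℝ → Matrix (Fin (n + 1)) (Fin (n + 1)) ℂ := fun t => Mat n (fun z => Real.exp (w t z))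
  let G1 : ℝ → Matrix (Fin (n + 1)) (Fin (n + 1)) ℂ := fun t => Mat n (fun z => w1 t z * Real.exp (w t z))
  let G2 : ℝ → Matrix (Fin (n + 1)) (Fin (n + 1)) ℂ := fun t =>
    Mat n (fun z => (w2 t z + w1 t z ^ 2) * Real.exp (w t z))
  have hG : ∀ t i j, HasDerivAt (fun s => G s i j) (G1 t i j) t := by
    intro t i j
    refine param_deriv (F := fun s z => onb n i z * conj (onb n j z) * ((Real.exp (w s z) : ℝ) : ℂ))
      (F' := fun s z => onb n i z * conj (onb n j z) * ((w1 s z * Real.exp (w s z) : ℝ) : ℂ))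
      (fun s => by have := sw s; fun_prop) (by fun_prop) (fun s z => ?_) t
    refine HasDerivAt.const_mul _ ?_
    have := (dw s z).exp.ofReal_comp
    refine this.congr_deriv ?_
    push_cast; ring
  have hG1 : ∀ t i j, HasDerivAt (fun s => G1 s i j) (G2 t i j) t := by
    intro t i j
    refine param_deriv (F := fun s z => onb n i z * conj (onb n j z) * ((w1 s z * Real.exp (w s z) : ℝ) : ℂ))
      (F' := fun s z => onb n i z * conj (onb n j z) * (((w2 s z + w1 s z ^ 2) * Real.exp (w s z) : ℝ) : ℂ))
      (fun s => by have := sw s; have := sw1 s; fun_prop) (by fun_prop) (fun s z => ?_) t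
    refine HasDerivAt.const_mul _ ?_
    have := ((dw1 s z).mul (dw s z).exp).ofReal_comp
    refine this.congr_deriv ?_
    push_cast; ring
  have hpd : ∀ t, (G t).PosDef := fun t => mat_posDef n (by have := sw t; fun_prop) (fun z => Real.exp_pos _)
  -- curvature estimates
  have hW : ∀ t (u : Fin (n + 1) → ℂ), (u ⬝ᵥ (G2 t - G1 t * (G t)⁻¹ * G1 t).mulVec (star u)).re ≤ 0 := by
    intro t u
    have swt := sw t
    have sw1t := sw1 t
    have sw2t := sw2 t
    choose P' P'' hP1 hP2 using fun j => Vn_Dd2 (hP j)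
    set μ : Fin (k + 1) → ℝ := fun j => Real.exp (t * lam j) with hμ
    have DS := Sm_Dd (lam := lam) hP 0 t hP1
    have DS1 := Sm_Dd (lam := lam) hP 1 t hP1
    simp only [pow_zero, one_mul, pow_one] at DS DS1
    set B : S3 → ℂ := fun z => ∑ j, (μ j : ℂ) * (P' j z * conj (P j z)) with hB
    set Bc : S3 → ℂ := fun z => ∑ j, (μ j : ℂ) * (P j z * conj (P' j z)) with hBc
    set C : S3 → ℂ := fun z => ∑ j, (lam j : ℂ) * (μ j : ℂ) * (P' j z * conj (P j z)) with hC
    set Cc : S3 → ℂ := fun z => ∑ j, (lam j : ℂ) * (μ j : ℂ) * (P j z * conj (P' j z)) with hCc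
    set T : S3 → ℝ := fun z => ∑ j, μ j * Complex.normSq (P' j z) with hT
    have DS' : Dd (fun z => (S t z : ℂ)) B Bc := DS
    have DS1' : Dd (fun z => (S1 t z : ℂ)) C Cc := DS1.congr (fun _ => rfl)
      (fun z => by simp [hC, hμ]) (fun z => by simp [hCc, hμ])
    have hBB : ∀ z, Bc z = conj (B z) := by
      intro z
      simp only [hB, hBc, map_sum, map_mul, Complex.conj_ofReal, Complex.conj_conj]
      refine Finset.sum_congr rfl fun j _ => by ring
    have hCC : ∀ z, Cc z = conj (C z) := by
      intro z
      simp only [hC, hCc, map_sum, map_mul, Complex.conj_ofReal, Complex.conj_conj]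
      refine Finset.sum_congr rfl fun j _ => by ring
    have cSt : Continuous (S t) := slice S c0 t
    have Dinv : Dd (fun z => ((S t z)⁻¹ : ℝ)) (fun z => (-((S t z) ^ 2)⁻¹ : ℝ) * B z)
        (fun z => (-((S t z) ^ 2)⁻¹ : ℝ) * Bc z) :=
      DS'.comp_real (φ := fun s => s⁻¹) (φ' := fun s => -(s ^ 2)⁻¹)
        (fun z => hasDerivAt_inv (hS t z).ne') (by
          refine Continuous.neg (Continuous.inv₀ (by fun_prop) fun z => pow_ne_zero 2 (hS t z).ne'))
    have Dlog : Dd (fun z => (w t z : ℂ)) _ (fun z => ((-p * (S t z)⁻¹ : ℝ) : ℂ) * Bc z) :=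
      DS'.comp_real (φ := fun s => -p * Real.log (s / (k + 1))) (φ' := fun s => -p * s⁻¹)
        (fun z => by
          have := (((hasDerivAt_id (S t z)).div_const (k + 1 : ℝ)).log
            (div_ne_zero (hS t z).ne' hk1)).const_mul (-p)
          refine this.congr_deriv ?_
          have := (hS t z).ne'
          simp only [id]; field_simp) (by
          refine continuous_const.mul (Continuous.inv₀ cSt fun z => (hS t z).ne'))
    have DBc : Dd Bc (fun z => (T z : ℂ) - k * S t z) (fun z => ∑ j, (μ j : ℂ) * (P j z * conj (P'' j z))) := by
      have h1 := Dd.sum Finset.univ (fun j _ => ((hP1 j).mul (hP2 j).conj').smul (μ j : ℂ))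
      refine h1.congr (fun z => rfl) (fun z => ?_) (fun z => ?_)
      · simp only [hT, hSd, Sm]
        push_cast
        rw [Finset.mul_sum, ← Finset.sum_sub_distrib]
        refine Finset.sum_congr rfl fun j _ => ?_
        rw [← Complex.mul_conj, ← Complex.mul_conj]
        simp only [map_mul, map_neg, Complex.conj_natCast, hμ, pow_zero]
        push_cast
        ring
      · refine Finset.sum_congr rfl fun j _ => ?_
        simp
    have Dlog2 := (Dinv.smul (-p)).mul DBc
    have Dw2 : Dd (fun z => ((-p * (S t z)⁻¹ : ℝ) : ℂ) * Bc z)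
      (fun z => ((-p * (-((S t z) ^ 2)⁻¹ * Complex.normSq (B z) + (S t z)⁻¹ * (T z - k * S t z)) : ℝ) : ℂ)) _ :=
      Dlog2.congr (fun z => by push_cast; ring) (fun z => by
        rw [hBB]; push_cast; rw [← Complex.mul_conj]; ring) (fun z => rfl)
    have Da : Dd (fun z => (w1 t z : ℂ)) _
        (fun z => ((-p * ((S t z) ^ 2)⁻¹ : ℝ) : ℂ) * (S t z * Cc z - S1 t z * Bc z)) :=
      ((DS1'.mul Dinv).smul (-p)).congr (fun z => by simp only [hw1d]; push_cast; rw [div_eq_mul_inv])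
        (fun z => rfl) (fun z => by
          have : (S t z : ℂ) ≠ 0 := by exact_mod_cast (hS t z).ne'
          push_cast; field_simp; ring)
    have cov : ∀ z, Complex.normSq (S t z * C z - S1 t z * B z) ≤
        (S t z * T z - Complex.normSq (B z)) * (S t z * S2 t z - S1 t z ^ 2) := fun z =>
      cov_aux μ (fun j => (Real.exp_pos _).le) lam (fun j => P j z) (fun j => P' j z) (S t z) (S1 t z) (S2 t z)
        (T z) (B z) (C z) (by simp [hSd, Sm, hμ]) (by simp [hS1d, Sm, hμ]) (by simp [hS2d, Sm, hμ]) rfl rfl rfl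
        (hS t z)
    have cs1 : ∀ z, 0 ≤ S t z * T z - Complex.normSq (B z) := by
      intro z
      have := cs_aux μ (fun j => (Real.exp_pos _).le) (fun j => P' j z) (fun j => P j z)
      have e1 : S t z = ∑ j, μ j * Complex.normSq (P j z) := by simp [hSd, Sm, hμ]
      have e2 : B z = ∑ j, (μ j : ℂ) * P' j z * conj (P j z) := by
        simp only [hB, mul_assoc]
      rw [← e1, ← e2] at this
      linarith [mul_comm (S t z) (T z)]
    have cs2 : ∀ z, 0 ≤ S t z * S2 t z - S1 t z ^ 2 := by
      intro z
      have := cs_aux μ (fun j => (Real.exp_pos _).le) (fun j => (lam j : ℂ) * P j z) (fun j => P j z)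
      have e1 : S t z = ∑ j, μ j * Complex.normSq (P j z) := by simp [hSd, Sm, hμ]
      have e3 : S2 t z = ∑ j, μ j * Complex.normSq ((lam j : ℂ) * P j z) := by
        simp only [hS2d, Sm, hμ, Complex.normSq_mul, Complex.normSq_ofReal]
        refine Finset.sum_congr rfl fun j _ => by ring
      have e2 : ∑ j, (μ j : ℂ) * ((lam j : ℂ) * P j z) * conj (P j z) = (S1 t z : ℂ) := by
        simp only [hS1d, Sm, hμ]
        push_cast
        refine Finset.sum_congr rfl fun j _ => ?_
        rw [← Complex.mul_conj]; ring
      rw [← e1, e2, ← e3, Complex.normSq_ofReal] at this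
      linarith [mul_comm (S t z) (S2 t z), sq (S1 t z)]
    have hcz : ∀ z, ((n : ℝ) + 2) - (((-p * (-((S t z) ^ 2)⁻¹ * Complex.normSq (B z) + (S t z)⁻¹ * (T z - k * S t z)) : ℝ) : ℂ)).re
        = p * (S t z * T z - Complex.normSq (B z)) / (S t z) ^ 2 := by
      intro z
      have := (hS t z).ne'
      rw [Complex.ofReal_re, ← hpk]; field_simp; ring
    have hq : ∀ z, - w2 t z = p * (S t z * S2 t z - S1 t z ^ 2) / (S t z) ^ 2 := by
      intro z
      simp only [hw2d]; ring
    -- the form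
    set u' : Fin (n + 1) → ℂ := Matrix.vecMul u (G1 t * (G t)⁻¹) with hu'
    have hGG : G1 t * (G t)⁻¹ * G t = G1 t :=
      Matrix.nonsing_inv_mul_cancel_right _ _ (isUnit_iff_ne_zero.2 (hpd t).det_pos.ne')
    have cE : Continuous fun z => Real.exp (w t z) := by fun_prop
    have ho : ∀ v, ∫ z, (w1 t z * sec n u z - sec n u' z) * conj (sec n v z) * Real.exp (w t z) ∂mu3 = 0 := by
      intro v
      have h1 := mat_form n (ψ := fun z => w1 t z * Real.exp (w t z)) (by fun_prop) u v
      have h2 := mat_form n cE u' v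
      have h3 : u' ⬝ᵥ (G t).mulVec (star v) = u ⬝ᵥ (G1 t).mulVec (star v) := by
        rw [hu', ← Matrix.dotProduct_mulVec, Matrix.mulVec_mulVec, hGG]
      have h4 : ∫ z, sec n u z * conj (sec n v z) * ((w1 t z * Real.exp (w t z) : ℝ) : ℂ) ∂mu3 =
          ∫ z, sec n u' z * conj (sec n v z) * ((Real.exp (w t z) : ℝ) : ℂ) ∂mu3 := by
        rw [← h1, ← h2]; exact h3.symm
      rw [← sub_eq_zero, ← integral_sub (S3.integrable (by fun_prop)) (S3.integrable (by fun_prop))] at h4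
      rw [← h4]
      congr 1; ext z; push_cast; ring
    have DB := dist_bound n Dlog Dw2
      (fun α hα z => by simp only [hwd, hSd, Sm_chg hP, zpow_zero, one_mul])
      Da (fun α hα z => by simp only [hw1d, hSd, hS1d, Sm_chg hP, zpow_zero, one_mul])
      (q := fun z => - w2 t z) (by fun_prop)
      (fun z => by rw [hq]; exact div_nonneg (mul_nonneg hp0.le (cs2 z)) (sq_nonneg _))
      (fun z => by rw [hcz]; exact div_nonneg (mul_nonneg hp0.le (cs1 z)) (sq_nonneg _))
      (fun z => by
        rw [hcz, hq, hBB, hCC]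
        have e : (S t z : ℂ) * conj (C z) - S1 t z * conj (B z) = conj (S t z * C z - S1 t z * B z) := by
          simp
        rw [e, Complex.normSq_mul, Complex.normSq_conj, Complex.normSq_ofReal]
        have hc := cov z
        have := hS t z
        calc _ = (p / S t z ^ 2) ^ 2 * Complex.normSq (S t z * C z - S1 t z * B z) := by field_simp
          _ ≤ (p / S t z ^ 2) ^ 2 * ((S t z * T z - Complex.normSq (B z)) * (S t z * S2 t z - S1 t z ^ 2)) := by gcongr
          _ = _ := by ring)
      (sec_mem n u) (sec_mem n u') (fun f hf => by
        obtain ⟨v, hv⟩ := Vn_iff.1 hf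
        have := ho v
        simpa only [sec, ← hv] using this)
    have F2 := mat_form n (ψ := fun z => (w2 t z + w1 t z ^ 2) * Real.exp (w t z)) (by fun_prop) u u
    have F1 := mat_form n (ψ := fun z => w1 t z * Real.exp (w t z)) (by fun_prop) u' u
    have h3 : u ⬝ᵥ (G1 t * (G t)⁻¹ * G1 t).mulVec (star u) = u' ⬝ᵥ (G1 t).mulVec (star u) := by
      rw [hu', ← Matrix.dotProduct_mulVec, Matrix.mulVec_mulVec]
    rw [Matrix.sub_mulVec, dotProduct_sub, h3]
    simp only [G2, G1]
    rw [F2, F1, Complex.sub_re, re_int (by fun_prop), re_int (by fun_prop)]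
    have ho' := congrArg Complex.re (ho u')
    rw [re_int (by fun_prop), Complex.zero_re] at ho'
    have e : ∀ z, Complex.normSq (w1 t z * sec n u z - sec n u' z) * Real.exp (w t z) =
        (sec n u z * conj (sec n u z) * (((w2 t z + w1 t z ^ 2) * Real.exp (w t z) : ℝ) : ℂ)).re
        + (- w2 t z * Complex.normSq (sec n u z) * Real.exp (w t z))
        - (sec n u' z * conj (sec n u z) * ((w1 t z * Real.exp (w t z) : ℝ) : ℂ)).re
        - ((w1 t z * sec n u z - sec n u' z) * conj (sec n u' z) * Real.exp (w t z)).re := by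
      intro z
      simp only [Complex.re_mul_ofReal]
      simp only [Complex.mul_re, Complex.sub_re, Complex.sub_im, Complex.conj_re, Complex.conj_im,
        Complex.ofReal_re, Complex.ofReal_im, Complex.mul_im, Complex.normSq_apply]
      ring
    simp only [e] at DB
    rw [integral_sub (S3.integrable (by fun_prop)) (S3.integrable (by fun_prop)), ho',
      integral_sub (S3.integrable (by fun_prop)) (S3.integrable (by fun_prop)),
      integral_add (S3.integrable (by fun_prop)) (S3.integrable (by fun_prop))] at DB
    linarith
  have main := logdet_concave hG hG1 hpd hW
  have S0 : ∀ z, S 0 z = k + 1 := by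
    intro z; simp only [hSd, Sm, ← hsum z]; simp
  have w0 : ∀ z, w 0 z = 0 := by
    intro z; simp only [hwd, S0, div_self hk1, Real.log_one, mul_zero]
  have G0 : G 0 = 1 := by
    simp only [G, w0, Real.exp_zero]; exact mat_one n
  rw [G0, Matrix.det_one, Complex.one_re, Real.log_one, zero_add, inv_one, Matrix.one_mul] at main
  refine main.trans (le_of_eq ?_)
  have t1 : (G1 0).trace = ((∫ z, (n + 1) * w1 0 z ∂mu3 : ℝ) : ℂ) := by
    rw [← integral_complex_ofReal]
    simp only [Matrix.trace, Matrix.diag, G1, Mat, Matrix.of_apply, w0, Real.exp_zero, mul_one]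
    have := sw1 0
    rw [← integral_finsetSum _ (fun a _ => S3.integrable (by fun_prop))]
    congr 1; ext z
    rw [← Finset.sum_mul]
    push_cast
    congr 1
    simp only [Complex.mul_conj]
    rw [← Complex.ofReal_sum, onb_sum]; push_cast; rfl
  rw [t1, Complex.ofReal_re, integral_const_mul]
  have t2 : ∫ z, w1 0 z ∂mu3 = - p / (k + 1) * ∑ j, lam j := by
    have : ∀ z, w1 0 z = ∑ j, (- p / (k + 1) * lam j) * Complex.normSq (P j z) := by
      intro z
      simp only [hw1d, S0, hS1d, Sm, zero_mul, Real.exp_zero, pow_one, mul_one]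
      rw [Finset.sum_div, Finset.mul_sum]
      refine Finset.sum_congr rfl fun j _ => by ring
    simp only [this]
    rw [integral_finsetSum _ (fun a _ => S3.integrable (by have := hPc a; fun_prop)), Finset.mul_sum]
    refine Finset.sum_congr rfl fun j _ => ?_
    rw [integral_const_mul, hn, mul_one]
  rw [t2, hp]
  field_simp
end

noncomputable section
open MeasureTheory Real Metric
open scoped ENNReal RealInnerProductSpace Manifold Pointwise ComplexOrder
local notation "conj" => starRingEnd ℂ

lemma cs_int {f g : S3 → ℝ} (hf : Continuous f) (hg : Continuous g) :
    (∫ z, f z * g z ∂mu3) ^ 2 ≤ (∫ z, f z ^ 2 ∂mu3) * ∫ z, g z ^ 2 ∂mu3 := by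
  have h : ∀ t : ℝ, 0 ≤ (∫ z, f z ^ 2 ∂mu3) * (t * t) + (2 * ∫ z, f z * g z ∂mu3) * t + ∫ z, g z ^ 2 ∂mu3 := by
    intro t
    have h1 : 0 ≤ ∫ z, (t * f z + g z) ^ 2 ∂mu3 := integral_nonneg fun z => sq_nonneg _
    have h2 : ∫ z, (t * f z + g z) ^ 2 ∂mu3 =
      ∫ z, ((t * t) * f z ^ 2 + (2 * t) * (f z * g z) + g z ^ 2) ∂mu3 := by
      congr 1; ext z; ring
    rw [integral_add (S3.integrable (by fun_prop)) (S3.integrable (by fun_prop)),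
      integral_add (S3.integrable (by fun_prop)) (S3.integrable (by fun_prop)), integral_const_mul,
      integral_const_mul] at h2
    rw [h2] at h1; linarith
  have := discrim_le_zero h
  rw [discrim] at this; nlinarith

lemma spectral (k : ℕ) {ψ : S3 → ℝ} (hψ : Continuous ψ) (hp : ∀ z, 0 < ψ z) :
    ∃ (P : Fin (k + 1) → S3 → ℂ) (lam : Fin (k + 1) → ℝ), (∀ j, P j ∈ Vn k) ∧
      (∀ z, ∑ j, Complex.normSq (P j z) = k + 1) ∧ (∀ j, ∫ z, Complex.normSq (P j z) ∂mu3 = 1) ∧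
      (∀ i j, ∫ z, P i z * conj (P j z) * ψ z ∂mu3 = if i = j then (exp (- lam j) : ℂ) else 0) ∧
      ∑ j, lam j = - log (Mat k ψ).det.re := by
  have hpd := mat_posDef k hψ hp
  have hH : (Mat k ψ).IsHermitian := hpd.1
  set V : Matrix (Fin (k + 1)) (Fin (k + 1)) ℂ := hH.eigenvectorUnitary.1 with hV
  have hV1 : star V * V = 1 := Unitary.coe_star_mul_self hH.eigenvectorUnitary
  have hV2 : V * star V = 1 := Unitary.coe_mul_star_self hH.eigenvectorUnitary
  have hev : ∀ j, (Mat k ψ).mulVec (fun a => V a j) = (hH.eigenvalues j : ℂ) • (fun a => V a j) := by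
    intro j
    have := hH.mulVec_eigenvectorBasis j
    have e : (fun a => V a j) = (hH.eigenvectorBasis j).ofLp := by
      ext a; rfl
    rw [e, this]; ext a; simp
  have epos : ∀ j, 0 < hH.eigenvalues j := fun j => hpd.eigenvalues_pos j
  have horth : ∀ i j, (fun a => conj (V a i)) ⬝ᵥ (fun a => V a j) = if i = j then 1 else 0 := by
    intro i j
    have := congrFun (congrFun hV1 i) j
    simpa [Matrix.mul_apply, dotProduct, Matrix.one_apply, Matrix.star_apply] using this
  refine ⟨fun j => sec k (fun a => conj (V a j)), fun j => - log (hH.eigenvalues j), fun j => sec_mem _ _, ?_, ?_, ?_, ?_⟩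
  · intro z
    have h1 : ((∑ j, Complex.normSq (sec k (fun a => conj (V a j)) z) : ℝ) : ℂ) = ((k + 1 : ℝ) : ℂ) := by
      rw [← onb_sum k z]
      push_cast
      simp only [← Complex.mul_conj, sec, map_sum, map_mul, Complex.conj_conj, Finset.sum_mul_sum]
      have : ∀ a b, ∑ j, V a j * conj (V b j) = if a = b then 1 else 0 := by
        intro a b
        have := congrFun (congrFun hV2 a) b
        simpa [Matrix.mul_apply, dotProduct, Matrix.one_apply, Matrix.star_apply] using this
      rw [Finset.sum_comm]
      refine Finset.sum_congr rfl fun a _ => ?_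
      rw [Finset.sum_comm]
      have h2 : ∀ b, ∑ j, conj (V a j) * onb k a z * (V b j * conj (onb k b z)) =
          (∑ j, V b j * conj (V a j)) * (onb k a z * conj (onb k b z)) := by
        intro b; rw [Finset.sum_mul]; refine Finset.sum_congr rfl fun j _ => ?_; ring
      simp only [h2, this]
      simp
    exact_mod_cast h1
  · intro j
    rw [sec_norm]
    have := horth j j
    simp only [dotProduct, if_true] at this
    have h2 : ((∑ a, Complex.normSq (conj (V a j)) : ℝ) : ℂ) = 1 := by
      rw [← this]; push_cast
      refine Finset.sum_congr rfl fun a _ => ?_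
      rw [← Complex.mul_conj, Complex.conj_conj]
    exact_mod_cast h2
  · intro i j
    rw [← mat_form k hψ]
    have : star (fun a => conj (V a j)) = fun a => V a j := by ext a; simp
    rw [this, hev, dotProduct_smul, horth]
    simp only [neg_neg]
    rw [Real.exp_log (epos j)]
    split_ifs <;> simp
  · rw [hH.det_eq_prod_eigenvalues]
    have : (∏ i, (hH.eigenvalues i : ℂ)) = ((∏ i, hH.eigenvalues i : ℝ) : ℂ) := by push_cast; rfl
    erw [this]
    rw [Complex.ofReal_re, Real.log_prod fun i _ => (epos i).ne', Finset.sum_neg_distrib]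

lemma bergman_aux (k : ℕ) (hk : 0 < k) {L r D : ℝ} (hr : r ^ 2 ≤ 4) (hD : D ≤ L * r) :
    (1 - r ^ 2 / 4) ^ (k + 2 * k ^ 2) * exp (k * D) ≤ exp (L ^ 2 / 2) := by
  have h1 : 1 - r ^ 2 / 4 ≤ exp (- (r ^ 2 / 4)) := by
    have := Real.add_one_le_exp (- (r ^ 2 / 4)); linarith
  have hk' : (1 : ℝ) ≤ k := by exact_mod_cast hk
  calc _ ≤ exp (- (r ^ 2 / 4)) ^ (k + 2 * k ^ 2) * exp (k * (L * r)) := by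
        gcongr; linarith
    _ = exp (((k + 2 * k ^ 2 : ℕ) : ℝ) * (- (r ^ 2 / 4)) + k * (L * r)) := by
        rw [← Real.exp_nat_mul, ← Real.exp_add]
    _ ≤ _ := by
        apply Real.exp_le_exp.2
        push_cast
        nlinarith [sq_nonneg (k * r - L), mul_nonneg (by linarith : (0:ℝ) ≤ k) (sq_nonneg r)]

lemma bergman (k : ℕ) (hk : 0 < k) {P : S3 → ℂ} (hP : P ∈ Vn k) {v : S3 → ℝ} (hv : Continuous v) {L : ℝ}
    (hL : ∀ x y, |v x - v y| ≤ L * dist (hopfS x) (hopfS y)) (x : S3) :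
    Complex.normSq (P x) ≤ (k + k ^ 2 + 1) ^ 2 * exp (L ^ 2 / 2) * exp (- (k * v x)) *
      ∫ z, Complex.normSq (P z) * exp (k * v z) ∂mu3 := by
  have hc := Vn_cont hP
  have c1 := hp_cont (x : E4)
  have c2 := hp_cont' (x : E4)
  have h := reproducing (Vn_mul hP (hp_mem x (k ^ 2))) x
  simp only [hp_self, one_pow, mul_one, Pi.mul_apply] at h
  set I := ∫ y, (‖hp x y‖ ^ (k + 2 * k ^ 2) * exp (- (k * v y / 2))) * (‖P y‖ * exp (k * v y / 2)) ∂mu3 with hI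
  have hI0 : 0 ≤ I := integral_nonneg fun y => by positivity
  have h1 : ‖P x‖ ≤ (k + k ^ 2 + 1) * I := by
    rw [h, norm_mul]
    have e1 : ‖((k + k ^ 2 : ℕ) : ℂ) + 1‖ = k + k ^ 2 + 1 := by
      have : ((k + k ^ 2 : ℕ) : ℂ) + 1 = ((k + k ^ 2 + 1 : ℕ) : ℂ) := by push_cast; ring
      rw [this, Complex.norm_natCast]; push_cast; ring
    rw [e1]
    refine mul_le_mul_of_nonneg_left ((norm_integral_le_integral_norm _).trans (le_of_eq ?_)) (by positivity)
    congr 1; ext y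
    have e2 : ‖hp (y : E4) x‖ = ‖hp (x : E4) y‖ := by
      rw [← hp_conj, RCLike.norm_conj]
    have e3 : exp (- (k * v y / 2)) * exp (k * v y / 2) = 1 := by
      rw [← Real.exp_add]; simp
    rw [norm_mul, norm_mul, norm_pow, norm_pow, e2]
    linear_combination (- (‖hp (x : E4) y‖ ^ (k + 2 * k ^ 2) * ‖P y‖)) * e3
  have h2 := cs_int (f := fun y => ‖hp x y‖ ^ (k + 2 * k ^ 2) * exp (- (k * v y / 2)))
    (g := fun y => ‖P y‖ * exp (k * v y / 2)) (by fun_prop) (by fun_prop)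
  rw [← hI] at h2
  have h3 : ∫ z, (‖hp x z‖ ^ (k + 2 * k ^ 2) * exp (- (k * v z / 2))) ^ 2 ∂mu3 ≤
      exp (L ^ 2 / 2) * exp (- (k * v x)) := by
    have : ∀ z : S3, (‖hp x z‖ ^ (k + 2 * k ^ 2) * exp (- (k * v z / 2))) ^ 2 ≤ exp (L ^ 2 / 2) * exp (- (k * v x)) := by
      intro z
      have e1 := normSq_hp_add x z
      have e2 := dist_hopfS x z
      have e3 : Complex.normSq (hp x z) = 1 - dist (hopfS x) (hopfS z) ^ 2 / 4 := by
        rw [e2, mul_pow, ← Complex.normSq_eq_norm_sq]; linarith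
      have e4 := bergman_aux k hk (L := L) (r := dist (hopfS x) (hopfS z)) (D := v x - v z)
        (by have := Complex.normSq_nonneg (hp x z); linarith) ((le_abs_self _).trans (hL x z))
      rw [← e3] at e4
      have e5 : exp (k * (v x - v z)) = exp (- (k * v z / 2)) ^ 2 * exp (k * v x) := by
        rw [← Real.exp_nat_mul, ← Real.exp_add]; congr 1; push_cast; ring
      have e6 : exp (k * v x) * exp (- (k * v x)) = 1 := by rw [← Real.exp_add]; simp
      rw [e5, Complex.normSq_eq_norm_sq] at e4
      calc _ = (‖hp x z‖ ^ 2) ^ (k + 2 * k ^ 2) * (exp (- (k * v z / 2)) ^ 2 * exp (k * v x)) * exp (- (k * v x)) := by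
            rw [mul_pow, ← pow_mul, ← pow_mul, mul_comm 2]
            linear_combination (- (‖hp (x : E4) z‖ ^ ((k + 2 * k ^ 2) * 2) * exp (- (k * v z / 2)) ^ 2)) * e6
        _ ≤ _ := by gcongr
    have := integral_mono (μ := mu3) (S3.integrable (by fun_prop)) (S3.integrable (by fun_prop)) this
    simpa using this
  have h4 : ∫ z, (‖P z‖ * exp (k * v z / 2)) ^ 2 ∂mu3 = ∫ z, Complex.normSq (P z) * exp (k * v z) ∂mu3 := by
    congr 1; ext z
    rw [mul_pow, Complex.normSq_eq_norm_sq, ← Real.exp_nat_mul]; congr 2; push_cast; ring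
  rw [h4] at h2
  have h5 : 0 ≤ ∫ z, Complex.normSq (P z) * exp (k * v z) ∂mu3 :=
    integral_nonneg fun y => mul_nonneg (Complex.normSq_nonneg _) (exp_pos _).le
  rw [Complex.normSq_eq_norm_sq]
  calc ‖P x‖ ^ 2 ≤ ((k + k ^ 2 + 1) * I) ^ 2 := by gcongr
    _ = (k + k ^ 2 + 1) ^ 2 * I ^ 2 := by ring
    _ ≤ (k + k ^ 2 + 1) ^ 2 * ((exp (L ^ 2 / 2) * exp (- (k * v x))) * ∫ z, Complex.normSq (P z) * exp (k * v z) ∂mu3) := by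
        gcongr; exact h2.trans (by gcongr)
    _ = _ := by ring

lemma bergman_S (k : ℕ) (hk : 0 < k) {v : S3 → ℝ} (hv : Continuous v) {L : ℝ}
    (hL : ∀ x y, |v x - v y| ≤ L * dist (hopfS x) (hopfS y)) (P : Fin (k + 1) → S3 → ℂ)
    (lam : Fin (k + 1) → ℝ) (hP : ∀ j, P j ∈ Vn k)
    (hsum : ∀ z, ∑ j, Complex.normSq (P j z) = k + 1)
    (ho : ∀ i j, ∫ z, P i z * conj (P j z) * (exp (k * v z) : ℝ) ∂mu3 = if i = j then (exp (- lam j) : ℂ) else 0)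
    (x : S3) : Sm P lam 0 1 x ≤ (k + k ^ 2 + 1) ^ 2 * exp (L ^ 2 / 2) * exp (- (k * v x)) := by
  have hc : ∀ j, Continuous (P j) := fun j => Vn_cont (hP j)
  have hS := S_pos (lam := lam) hsum 1 x
  set S := Sm P lam 0 1 x with hSd
  have hSe : (S : ℂ) = ∑ j, (exp (lam j) : ℂ) * conj (P j x) * P j x := by
    rw [hSd, Sm]; push_cast
    refine Finset.sum_congr rfl fun j _ => ?_
    rw [← Complex.mul_conj]; simp; ring
  have hQ : (∑ j, ((exp (lam j) : ℂ) * conj (P j x)) • P j) ∈ Vn k :=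
    Submodule.sum_mem _ fun j _ => Submodule.smul_mem _ _ (hP j)
  have h := bergman k hk hQ hv hL x
  have e1 : (∑ j, ((exp (lam j) : ℂ) * conj (P j x)) • P j) x = S := by
    rw [hSe]; simp
  have e2 : ∫ z, Complex.normSq ((∑ j, ((exp (lam j) : ℂ) * conj (P j x)) • P j) z) * exp (k * v z) ∂mu3 = S := by
    have : ∫ z, ((Complex.normSq ((∑ j, ((exp (lam j) : ℂ) * conj (P j x)) • P j) z) * exp (k * v z) : ℝ) : ℂ) ∂mu3 = S := by
      have e3 : ∀ z, ((Complex.normSq ((∑ j, ((exp (lam j) : ℂ) * conj (P j x)) • P j) z) * exp (k * v z) : ℝ) : ℂ)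
         = ∑ i, ∑ j, ((exp (lam i) : ℂ) * conj (P i x) * ((exp (lam j) : ℂ) * P j x)) * (P i z * conj (P j z) * (exp (k * v z) : ℝ)) := by
        intro z
        rw [Complex.ofReal_mul, ← Complex.mul_conj]
        simp only [Finset.sum_apply, Pi.smul_apply, smul_eq_mul, map_sum]
        rw [Finset.sum_mul_sum, Finset.sum_mul]
        refine Finset.sum_congr rfl fun i _ => ?_
        rw [Finset.sum_mul]
        refine Finset.sum_congr rfl fun j _ => ?_
        simp only [map_mul, ← Complex.ofReal_exp, Complex.conj_ofReal, Complex.conj_conj]; ring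
      simp only [e3]
      rw [integral_finsetSum _ (fun a _ => S3.integrable (by fun_prop)), hSe]
      refine Finset.sum_congr rfl fun i _ => ?_
      rw [integral_finsetSum _ (fun a _ => S3.integrable (by fun_prop))]
      simp only [integral_const_mul, ho]
      simp only [mul_ite, mul_zero, Finset.sum_ite_eq, Finset.mem_univ, if_true]
      have : ((exp (lam i) : ℝ) : ℂ) * ((exp (- lam i) : ℝ) : ℂ) = 1 := by rw [← Complex.ofReal_mul, ← Real.exp_add]; simp
      linear_combination (((exp (lam i) : ℝ) : ℂ) * conj (P i x) * P i x) * this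
    rw [integral_complex_ofReal] at this
    exact_mod_cast this
  rw [e1, e2, Complex.normSq_ofReal] at h
  exact le_of_mul_le_mul_right h hS
end

noncomputable section
open MeasureTheory Real Metric
open scoped ENNReal RealInnerProductSpace Manifold Pointwise
local notation "conj" => starRingEnd ℂ

lemma S3pi.integrable {N : ℕ} {G : Type*} [NormedAddCommGroup G] {f : (Fin N → S3) → G} (hf : Continuous f) [SecondCountableTopologyEither (Fin N → S3) G] :
    Integrable f (Measure.pi fun _ : Fin N => mu3) :=
  hf.integrable_of_hasCompactSupport (HasCompactSupport.of_compactSpace f)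

lemma andreief {N : ℕ} {f : Fin N → S3 → ℂ} (hf : ∀ a, Continuous (f a)) {ψ : S3 → ℝ} (hψ : Continuous ψ) :
    ∫ z : Fin N → S3, (Matrix.of fun a i => f a (z i)).det * conj (Matrix.of fun a i => f a (z i)).det *
      ∏ i, (ψ (z i) : ℂ) ∂(Measure.pi fun _ => mu3) =
    N.factorial * (Matrix.of fun a b => ∫ z, f a z * conj (f b z) * ψ z ∂mu3).det := by
  set G : Matrix (Fin N) (Fin N) ℂ := Matrix.of fun a b => ∫ z, f a z * conj (f b z) * ψ z ∂mu3 with hG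
  have h1 : ∀ z : Fin N → S3, (Matrix.of fun a i => f a (z i)).det * conj (Matrix.of fun a i => f a (z i)).det *
      ∏ i, (ψ (z i) : ℂ) = ∑ σ : Equiv.Perm (Fin N), ∑ τ : Equiv.Perm (Fin N),
        (((Equiv.Perm.sign σ : ℤ) : ℂ) * ((Equiv.Perm.sign τ : ℤ) : ℂ)) *
          ∏ i, (f (σ i) (z i) * conj (f (τ i) (z i)) * ψ (z i)) := by
    intro z
    rw [Matrix.det_apply', map_sum, Finset.sum_mul_sum, Finset.sum_mul]
    refine Finset.sum_congr rfl fun σ _ => ?_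
    rw [Finset.sum_mul]
    refine Finset.sum_congr rfl fun τ _ => ?_
    simp only [map_mul, map_prod, Matrix.of_apply, map_intCast, Finset.prod_mul_distrib]
    ring
  simp only [h1]
  rw [integral_finsetSum _ (fun a _ => S3pi.integrable (by fun_prop))]
  have h2 : ∀ σ : Equiv.Perm (Fin N), ∫ z : Fin N → S3, ∑ τ : Equiv.Perm (Fin N),
        (((Equiv.Perm.sign σ : ℤ) : ℂ) * ((Equiv.Perm.sign τ : ℤ) : ℂ)) *
          ∏ i, (f (σ i) (z i) * conj (f (τ i) (z i)) * ψ (z i)) ∂(Measure.pi fun _ => mu3) =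
      ∑ τ : Equiv.Perm (Fin N), (((Equiv.Perm.sign σ : ℤ) : ℂ) * ((Equiv.Perm.sign τ : ℤ) : ℂ)) * ∏ i, G (σ i) (τ i) := by
    intro σ
    rw [integral_finsetSum _ (fun a _ => S3pi.integrable (by fun_prop))]
    refine Finset.sum_congr rfl fun τ _ => ?_
    rw [integral_const_mul, integral_fintype_prod_eq_prod (fun i z => f (σ i) z * conj (f (τ i) z) * ψ z)]
    rfl
  simp only [h2]
  rw [Finset.sum_comm]
  have h3 : ∀ τ : Equiv.Perm (Fin N), ∑ σ : Equiv.Perm (Fin N),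
      (((Equiv.Perm.sign σ : ℤ) : ℂ) * ((Equiv.Perm.sign τ : ℤ) : ℂ)) * ∏ i, G (σ i) (τ i) = G.det := by
    intro τ
    have h4 : ∑ σ : Equiv.Perm (Fin N),
      (((Equiv.Perm.sign σ : ℤ) : ℂ) * ((Equiv.Perm.sign τ : ℤ) : ℂ)) * ∏ i, G (σ i) (τ i) =
      ((Equiv.Perm.sign τ : ℤ) : ℂ) * (G.submatrix id τ).det := by
      rw [Matrix.det_apply', Finset.mul_sum]
      refine Finset.sum_congr rfl fun σ _ => ?_
      simp only [Matrix.submatrix_apply, id]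
      ring
    rw [h4, Matrix.det_permute', ← mul_assoc]
    have : ((Equiv.Perm.sign τ : ℤ) : ℂ) * ((Equiv.Perm.sign τ : ℤ) : ℂ) = 1 := by
      rcases Int.units_eq_one_or (Equiv.Perm.sign τ) with h | h <;> simp [h]
    rw [this, one_mul]
  simp only [h3]
  simp [Fintype.card_perm]

/-- the determinantal density -/
def Dn (n : ℕ) (z : Fin (n + 1) → S3) : ℝ := Complex.normSq (Matrix.of fun a i => onb n a (z i)).det

lemma Dn_cont (n : ℕ) : Continuous (Dn n) := by
  unfold Dn
  have : Continuous fun z : Fin (n + 1) → S3 => (Matrix.of fun a i => onb n a (z i)).det := by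
    simp only [Matrix.det_apply', Matrix.of_apply]; fun_prop
  fun_prop

lemma det_int (n : ℕ) {ψ : S3 → ℝ} (hψ : Continuous ψ) :
    ∫ z : Fin (n + 1) → S3, Dn n z * ∏ i, ψ (z i) ∂(Measure.pi fun _ => mu3) =
    (n + 1).factorial * (Mat n ψ).det.re := by
  have h := andreief (f := onb n) (fun a => by fun_prop) hψ
  have h2 : ∀ z : Fin (n + 1) → S3, (Matrix.of fun a i => onb n a (z i)).det * conj (Matrix.of fun a i => onb n a (z i)).det *
      ∏ i, (ψ (z i) : ℂ) = ((Dn n z * ∏ i, ψ (z i) : ℝ) : ℂ) := by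
    intro z; rw [Complex.mul_conj]; push_cast; rfl
  simp only [h2] at h
  rw [integral_complex_ofReal] at h
  have := congrArg Complex.re h
  rw [Complex.ofReal_re, ← Complex.ofReal_natCast, Complex.re_ofReal_mul] at this
  exact this

lemma det_mono (n : ℕ) {ψ φ : S3 → ℝ} (hψ : Continuous ψ) (hφ : Continuous φ) {c : ℝ} (h0 : ∀ z, 0 ≤ ψ z)
    (h : ∀ z, ψ z ≤ c * φ z) : (Mat n ψ).det.re ≤ c ^ (n + 1) * (Mat n φ).det.re := by
  have h1 := det_int n hψ
  have h2 := det_int n hφ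
  have : ∫ z : Fin (n + 1) → S3, Dn n z * ∏ i, ψ (z i) ∂(Measure.pi fun _ => mu3) ≤
      ∫ z : Fin (n + 1) → S3, c ^ (n + 1) * (Dn n z * ∏ i, φ (z i)) ∂(Measure.pi fun _ => mu3) := by
    have hD := Dn_cont n
    refine integral_mono (S3pi.integrable (by fun_prop)) (S3pi.integrable (by fun_prop)) fun z => ?_
    have : ∏ i, ψ (z i) ≤ ∏ i, (c * φ (z i)) := Finset.prod_le_prod (fun i _ => h0 _) (fun i _ => h _)
    rw [Finset.prod_mul_distrib] at this
    simp only [Finset.prod_const, Finset.card_univ, Fintype.card_fin] at this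
    calc _ ≤ Dn n z * (c ^ (n + 1) * ∏ i, φ (z i)) := mul_le_mul_of_nonneg_left this (Complex.normSq_nonneg _)
      _ = _ := by ring
  rw [integral_const_mul, h1, h2] at this
  have hp : (0 : ℝ) < (n + 1).factorial := by positivity
  refine le_of_mul_le_mul_left ?_ hp
  linarith

/-- product of the monomial norms -/
def pmom (n : ℕ) : ℝ := ∏ a : Fin (n + 1), mom a (n - a)

lemma pmom_pos (n : ℕ) : 0 < pmom n := Finset.prod_pos fun a _ => mom_pos _ _

lemma prod_offDiag_lt {N : ℕ} (g : Fin N → Fin N → ℝ) (hg : ∀ i j, g i j = g j i) :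
    ∏ p ∈ (Finset.univ : Finset (Fin N)).offDiag, g p.1 p.2 = ∏ i, ∏ j ∈ Finset.Ioi i, g i j ^ 2 := by
  have h1 : ∏ p ∈ (Finset.univ : Finset (Fin N)).offDiag, g p.1 p.2 =
      (∏ i, ∏ j ∈ Finset.Ioi i, g i j) * ∏ i, ∏ j ∈ Finset.Iio i, g i j := by
    rw [← Finset.prod_mul_distrib]
    have e : ∀ i, (∏ j ∈ Finset.Ioi i, g i j) * (∏ j ∈ Finset.Iio i, g i j) = ∏ j, if i ≠ j then g i j else 1 := by
      intro i
      rw [← Finset.prod_filter, ← Finset.prod_union]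
      · congr 1; ext j; simp [lt_or_lt_iff_ne]
      · rw [Finset.disjoint_left]; intro a ha hb; simp at ha hb; exact absurd (ha.trans hb) (lt_irrefl _)
    simp only [e]
    rw [← Finset.prod_product' Finset.univ Finset.univ (fun i j => if i ≠ j then g i j else 1), ← Finset.prod_filter]
    congr 1; ext p; simp
  have h2 : ∏ i, ∏ j ∈ Finset.Iio i, g i j = ∏ i, ∏ j ∈ Finset.Ioi i, g i j := by
    have : ∀ i, ∏ j ∈ Finset.Iio i, g i j = ∏ j, if j < i then g i j else 1 := by
      intro i; rw [← Finset.prod_filter]; congr 1; ext; simp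
    simp only [this]
    rw [Finset.prod_comm]
    refine Finset.prod_congr rfl fun i _ => ?_
    rw [← Finset.prod_filter]
    refine Finset.prod_congr (by ext; simp) fun j _ => hg _ _
  rw [h1, h2, ← sq, ← Finset.prod_pow]
  simp only [Finset.prod_pow]

lemma Dn_eq (n : ℕ) (z : Fin (n + 1) → S3) :
    ∏ p ∈ (Finset.univ : Finset (Fin (n + 1))).offDiag, dist (hopfS (z p.1)) (hopfS (z p.2)) =
      2 ^ ((n + 1) * n) * pmom n * Dn n z := by
  have h1 : Dn n z = (pmom n)⁻¹ * Complex.normSq (Matrix.projVandermonde (fun i => za (z i)) (fun i => zb (z i))).det := by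
    have : (Matrix.of fun a i => onb n a (z i)) = Matrix.of fun (a : Fin (n + 1)) i =>
        ((Real.sqrt (mom a (n - a)) : ℂ)⁻¹) * (Matrix.projVandermonde (fun i => za (z i)) (fun i => zb (z i))).transpose a i := by
      ext a i
      simp only [onb, mon, Matrix.of_apply, Matrix.transpose_apply, Matrix.projVandermonde_apply, Fin.val_rev]
      congr 3
      omega
    rw [Dn, this, Matrix.det_mul_column, Matrix.det_transpose, Complex.normSq_mul]
    congr 1
    rw [pmom, map_prod, ← Finset.prod_inv_distrib]
    refine Finset.prod_congr rfl fun a _ => ?_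
    rw [map_inv₀, Complex.normSq_ofReal, Real.mul_self_sqrt (mom_pos _ _).le]
  rw [prod_offDiag_lt (fun i j => dist (hopfS (z i)) (hopfS (z j))) (fun i j => dist_comm _ _), h1,
    Matrix.det_projVandermonde, map_prod]
  have h3 : ∏ p ∈ (Finset.univ : Finset (Fin (n + 1))).offDiag, (2 : ℝ) = 2 ^ ((n + 1) * n) := by
    rw [Finset.prod_const, Finset.offDiag_card]; simp only [Finset.card_univ, Fintype.card_fin]; congr 1; rw [Nat.mul_succ (n + 1) n]; omega
  have h4 := prod_offDiag_lt (N := n + 1) (fun i j => 2) (fun i j => rfl)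
  rw [h3] at h4
  rw [h4]
  have := (pmom_pos n).ne'
  field_simp
  simp only [map_prod, ← Finset.prod_mul_distrib]
  refine Finset.prod_congr rfl fun i _ => Finset.prod_congr rfl fun j _ => ?_
  rw [dist_hopfS, mul_pow, ← Complex.normSq_eq_norm_sq, ← Complex.normSq_neg]
  congr 2; ring

lemma ens_int (n : ℕ) {h : S2 → ℝ} (hh : Continuous h) :
    ∫ x : Fin (n + 1) → S2, (∏ p ∈ (Finset.univ : Finset (Fin (n + 1))).offDiag, dist (x p.1) (x p.2)) *
      ∏ i, h (x i) ∂(Measure.pi fun _ => sphereUniform) =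
    2 ^ ((n + 1) * n) * pmom n * (n + 1).factorial * (Mat n (fun z => h (hopfS z))).det.re := by
  have hmp : MeasurePreserving (fun (z : Fin (n + 1) → S3) i => hopfS (z i)) (Measure.pi fun _ => mu3)
      (Measure.pi fun _ => sphereUniform) := measurePreserving_pi _ _ fun _ => hopf_mp
  rw [← hmp.map_eq, integral_map hmp.measurable.aemeasurable
    (Continuous.aestronglyMeasurable (by fun_prop))]
  simp only [Dn_eq]
  have := det_int n (ψ := fun z => h (hopfS z)) (by fun_prop)
  rw [mul_assoc _ _ (Mat n _).det.re, ← this, ← integral_const_mul]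
  congr 1; ext z; ring
end

noncomputable section
open MeasureTheory Real Metric
open scoped ENNReal RealInnerProductSpace Manifold Pointwise ComplexOrder
local notation "conj" => starRingEnd ℂ

lemma mat_det_pos (n : ℕ) {ψ : S3 → ℝ} (hψ : Continuous ψ) (hp : ∀ z, 0 < ψ z) : 0 < (Mat n ψ).det.re := by
  have := (mat_posDef n hψ hp).det_pos
  exact (Complex.lt_def.1 this).1

lemma key_ineq (n k : ℕ) (hk : 0 < k) {v : S2 → ℝ} (hv : Continuous v) {L : ℝ}
    (hL : ∀ x y, |v x - v y| ≤ L * dist x y) :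
    log (Mat n (fun z => exp ((n + 2) * v (hopfS z)))).det.re ≤
      (n + 1) * (n + 2) / k * log ((k + k ^ 2 + 1) ^ 2 * exp (L ^ 2 / 2) / (k + 1)) +
      (n + 1) * (n + 2) / (k * (k + 1)) * log (Mat k (fun z => exp (k * v (hopfS z)))).det.re := by
  obtain ⟨P, lam, hP, hsum, hn, ho, htr⟩ := spectral k (ψ := fun z => exp (k * v (hopfS z))) (by fun_prop) (fun z => exp_pos _)
  have hk' : (0 : ℝ) < k := by exact_mod_cast hk
  have hcp := concave_path n k hk P lam hP hsum hn
  rw [htr] at hcp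
  set C : ℝ := (k + k ^ 2 + 1) ^ 2 * exp (L ^ 2 / 2) / (k + 1) with hC
  have hCp : 0 < C := by positivity
  have hS : ∀ z, 0 < Sm P lam 0 1 z := fun z => S_pos hsum 1 z
  have hSc : Continuous (Sm P lam 0 1) := Sm_cont (fun j => Vn_cont (hP j)) 0 1
  set φ : S3 → ℝ := fun z => exp (-((n + 2) / k) * log (Sm P lam 0 1 z / (k + 1))) with hφ
  have hφc : Continuous φ := by
    have : Continuous fun z => log (Sm P lam 0 1 z / (k + 1)) :=
      Continuous.log (by fun_prop) fun z => by have := hS z; positivity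
    fun_prop
  have hb : ∀ z, exp ((n + 2) * v (hopfS z)) ≤ exp ((n + 2) / k * log C) * φ z := by
    intro z
    rw [hφ, ← Real.exp_add]
    apply Real.exp_le_exp.2
    have h1 := bergman_S k hk (v := fun z => v (hopfS z)) (by fun_prop) (fun x y => hL _ _) P lam hP hsum ho z
    have h2 : Sm P lam 0 1 z / (k + 1) ≤ C * exp (- (k * v (hopfS z))) := by
      rw [hC, div_mul_eq_mul_div]; gcongr
    have h3 := Real.log_le_log (by have := hS z; positivity) h2
    rw [Real.log_mul hCp.ne' (exp_pos _).ne', Real.log_exp] at h3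
    have h4 : (n + 2 : ℝ) * v (hopfS z) = (n + 2) / k * (k * v (hopfS z)) := by field_simp
    rw [h4]
    have h5 : (0 : ℝ) ≤ (n + 2) / k := by positivity
    nlinarith
  have hd := det_mono n (ψ := fun z => exp ((n + 2) * v (hopfS z))) (by fun_prop) hφc (fun z => (exp_pos _).le) hb
  have h6 := Real.log_le_log (mat_det_pos n (by fun_prop) fun z => exp_pos _) hd
  rw [Real.log_mul (by positivity) (mat_det_pos n hφc fun z => exp_pos _).ne', Real.log_pow, Real.log_exp] at h6
  push_cast at h6
  have e1 : (n + 1 : ℝ) * ((n + 2) / k * log C) = (n + 1) * (n + 2) / k * log C := by ring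
  linarith

lemma prod_choose (n : ℕ) : ∏ a ∈ Finset.range (n + 1), (n.choose a : ℝ) ≤ exp (n * (n + 1) / 2) := by
  induction n with
  | zero => simp
  | succ n ih =>
    rw [Finset.prod_range_succ, Nat.choose_self, Nat.cast_one, mul_one]
    have h1 : ∏ a ∈ Finset.range (n + 1), ((n + 1).choose a : ℝ) * ((n + 1 - a : ℕ) : ℝ) =
        ∏ a ∈ Finset.range (n + 1), (n.choose a : ℝ) * (n + 1) := by
      refine Finset.prod_congr rfl fun a ha => ?_
      have : a ≤ n := by simp at ha; omega
      have h2 := Nat.choose_mul_succ_eq n a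
      have h3 : n.succ - a = n + 1 - a := rfl
      exact_mod_cast h2.symm
    have h2 : ∏ a ∈ Finset.range (n + 1), ((n + 1 - a : ℕ) : ℝ) = (n + 1).factorial := by
      rw [← Finset.prod_range_add_one_eq_factorial, ← Finset.prod_range_reflect]
      push_cast
      refine Finset.prod_congr rfl fun a ha => ?_
      have : a ≤ n := by simp at ha; omega
      norm_cast; omega
    rw [Finset.prod_mul_distrib, Finset.prod_mul_distrib, h2, Finset.prod_const, Finset.card_range] at h1
    have h3 := Real.pow_div_factorial_le_exp (n + 1 : ℝ) (by positivity) (n + 1)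
    have hf : (0 : ℝ) < (n + 1).factorial := by positivity
    have h4 : ∏ a ∈ Finset.range (n + 1), ((n + 1).choose a : ℝ) =
      (∏ a ∈ Finset.range (n + 1), (n.choose a : ℝ)) * ((n + 1) ^ (n + 1) / (n + 1).factorial) := by
      field_simp; linarith
    rw [h4]
    calc _ ≤ exp (n * (n + 1) / 2) * exp (n + 1 : ℝ) := by gcongr
      _ = _ := by rw [← Real.exp_add]; congr 1; push_cast; ring

lemma pmom_log (n : ℕ) : - ((n + 1) * log (n + 1)) - n * (n + 1) / 2 ≤ log (pmom n) := by
  have h1 : pmom n = ((n + 1) ^ (n + 1) * ∏ a ∈ Finset.range (n + 1), (n.choose a : ℝ))⁻¹ := by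
    rw [pmom, Fin.prod_univ_eq_prod_range (fun a => mom a (n - a)) (n + 1)]
    rw [mul_inv, ← Finset.prod_inv_distrib, ← inv_pow]
    have : ((n + 1 : ℝ)⁻¹) ^ (n + 1) = ∏ a ∈ Finset.range (n + 1), (n + 1 : ℝ)⁻¹ := by simp
    rw [this, ← Finset.prod_mul_distrib]
    refine Finset.prod_congr rfl fun a ha => ?_
    have ha' : a ≤ n := by simp at ha; omega
    rw [mom_val, Nat.cast_choose ℝ ha', Nat.add_sub_of_le ha', Nat.factorial_succ]
    push_cast
    field_simp
  have hp : 0 < ∏ a ∈ Finset.range (n + 1), (n.choose a : ℝ) := Finset.prod_pos fun a ha => by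
    have : 0 < n.choose a := Nat.choose_pos (by simp at ha; omega)
    exact_mod_cast this
  rw [h1, Real.log_inv, Real.log_mul (by positivity) hp.ne', Real.log_pow]
  have := Real.log_le_log hp (prod_choose n)
  rw [Real.log_exp] at this
  push_cast; linarith

/-- from an energy bound to a determinant bound -/
lemma det_energy (k : ℕ) {v : S2 → ℝ} (hv : Continuous v) {E : ℝ}
    (hE : ∀ x : Fin (k + 1) → S2, (∏ p ∈ (Finset.univ : Finset (Fin (k + 1))).offDiag, dist (x p.1) (x p.2)) *
      ∏ i, exp (k * v (x i)) ≤ exp E) :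
    log (Mat k (fun z => exp (k * v (hopfS z)))).det.re ≤
      E - (k + 1) * k * log 2 + (k + 1) * log (k + 1) + k * (k + 1) / 2 := by
  have h := ens_int k (h := fun x => exp (k * v x)) (by fun_prop)
  have h2 : ∫ x : Fin (k + 1) → S2, (∏ p ∈ (Finset.univ : Finset (Fin (k + 1))).offDiag, dist (x p.1) (x p.2)) *
      ∏ i, exp (k * v (x i)) ∂(Measure.pi fun _ => sphereUniform) ≤ exp E := by
    have := integral_mono_of_nonneg (μ := Measure.pi fun _ : Fin (k + 1) => sphereUniform)
      (f := fun x : Fin (k + 1) → S2 => (∏ p ∈ (Finset.univ : Finset (Fin (k + 1))).offDiag, dist (x p.1) (x p.2)) *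
      ∏ i, exp (k * v (x i))) (g := fun _ => exp E) (Filter.Eventually.of_forall fun x => by
        exact mul_nonneg (Finset.prod_nonneg fun _ _ => dist_nonneg) (Finset.prod_nonneg fun _ _ => (exp_pos _).le))
      (integrable_const _) (Filter.Eventually.of_forall fun x => hE x)
    simpa using this
  rw [h] at h2
  have hp := mat_det_pos k (ψ := fun z => exp (k * v (hopfS z))) (by fun_prop) (fun z => exp_pos _)
  have hpm := pmom_pos k
  have h3 := Real.log_le_log (by positivity) h2
  rw [Real.log_exp, Real.log_mul (by positivity) hp.ne', Real.log_mul (by positivity) (by positivity),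
    Real.log_mul (by positivity) hpm.ne', Real.log_pow] at h3
  have h4 := pmom_log k
  have h5 : 0 ≤ log ((k + 1).factorial : ℝ) := Real.log_nonneg (by exact_mod_cast Nat.factorial_pos (k + 1))
  push_cast at h3
  linarith
end

noncomputable section
open MeasureTheory Real Metric
open scoped ENNReal RealInnerProductSpace Manifold Pointwise
local notation "conj" => starRingEnd ℂ

/-- shifted Legendre value -/
def pl (l : ℕ) (s : ℝ) : ℝ := (legendreP l).eval (2 * s - 1)

open Polynomial in
lemma comp_iter (p : ℝ[X]) (k : ℕ) :
    derivative^[k] (p.comp (C 2 * X - 1)) = C (2 ^ k) * (derivative^[k] p).comp (C 2 * X - 1) := by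
  induction k generalizing p with
  | zero => simp
  | succ k ih =>
    rw [Function.iterate_succ_apply, derivative_comp, Function.iterate_succ_apply]
    have : derivative (C (2 : ℝ) * X - 1) = C 2 := by simp
    rw [this, iterate_derivative_C_mul, ih]
    rw [← mul_assoc, ← C_mul]; congr 2; ring

open Polynomial in
lemma leg_comp (l : ℕ) : (legendreP l).comp (C 2 * X - 1) =
    C ((l.factorial : ℝ)⁻¹) * derivative^[l] (X ^ l * (X - C 1) ^ l) := by
  have h := comp_iter ((X ^ 2 - 1) ^ l) l
  have h2 : ((X ^ 2 - 1 : ℝ[X]) ^ l).comp (C 2 * X - 1) = C (4 ^ l) * (X ^ l * (X - C 1) ^ l) := by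
    simp only [pow_comp, sub_comp, X_comp, one_comp]
    rw [C_pow, ← mul_pow, ← mul_pow]
    congr 1
    have e4 : (C 4 : ℝ[X]) = C 2 * C 2 := by rw [← C_mul]; norm_num
    have e2 : (C 2 : ℝ[X]) = 2 := rfl
    rw [e4, C_1, e2]; ring
  rw [h2, iterate_derivative_C_mul] at h
  rw [legendreP, mul_comp, C_comp]
  have h3 : (derivative^[l] ((X ^ 2 - 1) ^ l)).comp (C 2 * X - 1) = C ((2 ^ l : ℝ)⁻¹) * (C (4 ^ l) * derivative^[l] (X ^ l * (X - C 1) ^ l)) := by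
    rw [h, ← mul_assoc, ← C_mul, inv_mul_cancel₀ (by positivity), C_1, one_mul]
  rw [h3, ← mul_assoc, ← mul_assoc, ← C_mul, ← C_mul]
  congr 2
  have : (4 : ℝ) ^ l = 2 ^ l * 2 ^ l := by rw [← mul_pow]; norm_num
  rw [this]; field_simp

open Polynomial in
/-- sum-of-squares-of-binomials formula -/
lemma pl_bin (l : ℕ) (s : ℝ) : pl l s = ∑ j ∈ Finset.range (l + 1), (l.choose j : ℝ) ^ 2 * (s ^ j * (s - 1) ^ (l - j)) := by
  have h1 : pl l s = ((legendreP l).comp (C 2 * X - 1)).eval s := by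
    rw [pl, eval_comp]; simp
  rw [h1, leg_comp, iterate_derivative_mul, eval_mul, eval_C, eval_finsetSum, Finset.mul_sum]
  refine Finset.sum_congr rfl fun j hj => ?_
  have hj' : j ≤ l := by simp at hj; omega
  rw [iterate_derivative_X_pow_eq_C_mul, iterate_derivative_X_sub_pow, Nat.sub_sub_self hj']
  simp only [nsmul_eq_mul, eval_mul, eval_natCast, eval_C, eval_pow, eval_X, eval_sub]
  have e1 : (l.descFactorial (l - j) : ℝ) * j.factorial = l.factorial := by
    have := Nat.factorial_mul_descFactorial (Nat.sub_le l j)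
    rw [Nat.sub_sub_self hj'] at this
    rw [mul_comm]; exact_mod_cast this
  have e2 : (l.descFactorial j : ℝ) * (l - j).factorial = l.factorial := by
    have := Nat.factorial_mul_descFactorial hj'
    rw [mul_comm]; exact_mod_cast this
  rw [Nat.cast_choose ℝ hj']
  have f1 : (l.descFactorial (l - j) : ℝ) = l.factorial / j.factorial := by
    rw [eq_div_iff (by positivity), e1]
  have f2 : (l.descFactorial j : ℝ) = l.factorial / (l - j).factorial := by
    rw [eq_div_iff (by positivity), e2]
  rw [f1, f2]
  field_simp

/-- coefficients -/
def cl (l j : ℕ) : ℝ := (-1) ^ (l + j) * l.choose j * (l + j).choose l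

open Polynomial in
lemma pl_coef (l : ℕ) (s : ℝ) (n : ℕ) (hn : l ≤ n) : pl l s = ∑ j ∈ Finset.range (n + 1), cl l j * s ^ j := by
  have h1 : pl l s = ((legendreP l).comp (C 2 * X - 1)).eval s := by
    rw [pl, eval_comp]; simp
  have h2 := congrArg (Polynomial.map (Int.castRingHom ℝ)) (factorial_mul_shiftedLegendre_eq l)
  rw [← iterate_derivative_map] at h2
  simp only [Polynomial.map_mul, Polynomial.map_pow, Polynomial.map_natCast, map_X, Polynomial.map_sub, Polynomial.map_one] at h2
  have h3 : (X : ℝ[X]) ^ l * (X - C 1) ^ l = C ((-1) ^ l) * (X ^ l * (1 - X) ^ l) := by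
    have : (X - C 1 : ℝ[X]) = C (-1) * (1 - X) := by simp
    rw [this, mul_pow, C_pow]; ring
  rw [h1, leg_comp, h3, iterate_derivative_C_mul, ← h2]
  simp only [eval_mul, eval_C, eval_natCast]
  have hf : (l.factorial : ℝ) ≠ 0 := by positivity
  rw [eval_eq_sum_range' (n := n + 1)
    (lt_of_le_of_lt (natDegree_map_le.trans (natDegree_shiftedLegendre l).le) (by omega))]
  rw [show ∀ A : ℝ, (l.factorial : ℝ)⁻¹ * ((-1) ^ l * (l.factorial * A)) = (-1) ^ l * A from fun A => by field_simp,
    Finset.mul_sum]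
  refine Finset.sum_congr rfl fun j _ => ?_
  rw [coeff_map, coeff_shiftedLegendre, cl, pow_add]
  simp; ring

lemma cl_rec (l j : ℕ) : ((j : ℝ) + 1) ^ 2 * cl l (j + 1) = - ((l * (l + 1) - j * (j + 1)) * cl l j) := by
  have h1 : ((l.choose (j + 1) : ℕ) : ℝ) * (j + 1) = l.choose j * (l - j) := by
    rcases le_or_gt j l with h | h
    · have := Nat.choose_succ_right_eq l j
      rw [← Nat.cast_sub h]; exact_mod_cast this
    · rw [Nat.choose_eq_zero_of_lt h, Nat.choose_eq_zero_of_lt (by omega : l < j + 1)]; simp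
  have h2 : (((l + (j + 1)).choose l : ℕ) : ℝ) * (j + 1) = (l + j).choose l * (l + j + 1) := by
    have := Nat.choose_mul_succ_eq (l + j) l
    have e : (l + j).succ - l = j + 1 := by omega
    have e2 : l + j + 1 - l = j + 1 := by omega
    rw [e2] at this
    have : (((l + j).choose l * (l + j + 1) : ℕ) : ℝ) = (((l + j + 1).choose l * (j + 1) : ℕ) : ℝ) := by rw [this]
    push_cast at this
    rw [this]; rfl
  simp only [cl]
  have e3 : (-1 : ℝ) ^ (l + (j + 1)) = - (-1) ^ (l + j) := by rw [← add_assoc, pow_succ]; ring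
  rw [e3]
  linear_combination (-(-1 : ℝ) ^ (l + j)) * ((((l + (j + 1)).choose l : ℕ) : ℝ) * (j + 1) * h1 + (l.choose j * (l - j)) * h2)

/-- multipliers -/
def la (n l : ℕ) : ℝ := (2 * n + 1).choose (n + l + 1) / (2 * n + 1).choose n

lemma ch_pos (n : ℕ) : (0 : ℝ) < (2 * n + 1).choose n := by
  exact_mod_cast Nat.choose_pos (by omega)

lemma la_zero (n : ℕ) : la n 0 = 1 := by
  rw [la, div_eq_one_iff_eq (ch_pos n).ne']
  have := Nat.choose_symm_half n
  exact_mod_cast this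

lemma la_gt {n l : ℕ} (h : n < l) : la n l = 0 := by
  rw [la, Nat.choose_eq_zero_of_lt (by omega)]; simp

lemma la_nonneg (n l : ℕ) : 0 ≤ la n l := by unfold la; positivity

lemma la_succ (n l : ℕ) : la n (l + 1) * (n + l + 2) = la n l * (n - l) := by
  rcases lt_or_ge n l with h | h
  · rw [la_gt h, la_gt (by omega)]; simp
  have h1 := Nat.choose_succ_right_eq (2 * n + 1) (n + l + 1)
  have e : 2 * n + 1 - (n + l + 1) = n - l := by omega
  rw [e] at h1
  have h2 : (((2 * n + 1).choose (n + l + 1 + 1) * (n + l + 1 + 1) : ℕ) : ℝ) = (((2 * n + 1).choose (n + l + 1) * (n - l) : ℕ) : ℝ) := by rw [h1]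
  rw [Nat.cast_mul, Nat.cast_mul, Nat.cast_sub h] at h2
  push_cast at h2
  have := ch_pos n
  simp only [la]
  rw [div_mul_eq_mul_div, div_mul_eq_mul_div]
  congr 1
  rw [← add_assoc]
  linarith

lemma la_le (n l : ℕ) : la n l ≤ 1 := by
  induction l with
  | zero => rw [la_zero]
  | succ l ih =>
    have h := la_succ n l
    have h0 := la_nonneg n l
    have h1 := la_nonneg n (l + 1)
    have : la n (l + 1) * (n + l + 2) ≤ 1 * (n + l + 2) := by
      rw [h]; 
      have a : (0 : ℝ) ≤ l := by positivity
      have b : (0 : ℝ) ≤ n := by positivity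
      nlinarith
    exact le_of_mul_le_mul_right this (by positivity)

lemma la_n (n l : ℕ) : la (n + 1) l * ((n + 1) * (n + 2) - l * (l + 1)) = (n + 1) * (n + 2) * la n l := by
  induction l with
  | zero => rw [la_zero, la_zero]; simp
  | succ l ih =>
    have h1 := la_succ (n + 1) l
    have h2 := la_succ n l
    push_cast at h1 ⊢
    have p1 : (n + l + 2 : ℝ) ≠ 0 := by positivity
    have p2 : (n + 1 + l + 2 : ℝ) ≠ 0 := by positivity
    have h1' : la (n + 1) (l + 1) = la (n + 1) l * (n + 1 - l) / (n + 1 + l + 2) := by rw [eq_div_iff p2, h1]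
    have h2' : la n (l + 1) = la n l * (n - l) / (n + l + 2) := by rw [eq_div_iff p1, h2]
    rw [h1', h2']
    field_simp
    linear_combination (n - l : ℝ) * (n + l + 3) * ih

lemma la_top (n : ℕ) : la n n * (2 * n + 1) * (n + n).choose n = n + 1 := by
  have h1 : (2 * n + 1).choose (n + n + 1) = 1 := by rw [← two_mul, Nat.choose_self]
  rw [la, h1]
  have h2 := Nat.choose_mul_succ_eq (2 * n) n
  have e : (2 * n).succ - n = n + 1 := by omega
  have e2 : 2 * n + 1 - n = n + 1 := by omega
  rw [e2] at h2
  have h3 : (((2 * n).choose n * (2 * n + 1) : ℕ) : ℝ) = (((2 * n + 1).choose n * (n + 1) : ℕ) : ℝ) := by rw [h2]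
  have := (ch_pos n).ne'
  rw [← two_mul]
  push_cast at h3
  field_simp
  push_cast
  linarith

lemma q_coef : ∀ n j : ℕ, ∑ l ∈ Finset.range (n + 1), la n l * (2 * l + 1) * cl l j = if j = n then (n : ℝ) + 1 else 0 := by
  intro n
  induction n with
  | zero =>
    intro j
    simp only [zero_add, Finset.sum_range_one, la_zero]
    rcases Nat.eq_zero_or_pos j with h | h
    · subst h; simp [cl]
    · rw [if_neg (by omega)]; simp [cl, Nat.choose_eq_zero_of_lt h]
  | succ n ih =>
    have hgt : ∀ j, n + 1 < j → ∑ l ∈ Finset.range (n + 1 + 1), la (n + 1) l * (2 * l + 1) * cl l j = 0 := by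
      intro j hj
      refine Finset.sum_eq_zero fun l hl => ?_
      have : l < j := by simp at hl; omega
      simp [cl, Nat.choose_eq_zero_of_lt this]
    have htop : ∑ l ∈ Finset.range (n + 1 + 1), la (n + 1) l * (2 * l + 1) * cl l (n + 1) = n + 1 + 1 := by
      rw [Finset.sum_range_succ, Finset.sum_eq_zero fun l hl => ?_]
      · have := la_top (n + 1)
        simp only [cl, zero_add, Nat.choose_self]
        have e : (-1 : ℝ) ^ (n + 1 + (n + 1)) = 1 := by rw [← two_mul, pow_mul]; simp
        rw [e]; push_cast at this ⊢; linarith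
      · have : l < n + 1 := by simpa using hl
        simp [cl, Nat.choose_eq_zero_of_lt this]
    have hrec : ∀ j : ℕ, ((n + 1) * (n + 2) - j * (j + 1) : ℝ) * (∑ l ∈ Finset.range (n + 1 + 1), la (n + 1) l * (2 * l + 1) * cl l j)
        = (n + 1) * (n + 2) * (∑ l ∈ Finset.range (n + 1), la n l * (2 * l + 1) * cl l j)
          - ((j : ℝ) + 1) ^ 2 * ∑ l ∈ Finset.range (n + 1 + 1), la (n + 1) l * (2 * l + 1) * cl l (j + 1) := by
      intro j
      have e : ∑ l ∈ Finset.range (n + 1), la n l * (2 * l + 1) * cl l j = ∑ l ∈ Finset.range (n + 1 + 1), la n l * (2 * l + 1) * cl l j := by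
        rw [Finset.sum_range_succ _ (n + 1), la_gt (by omega : n < n + 1)]; simp
      rw [e, Finset.mul_sum, Finset.mul_sum, Finset.mul_sum, ← Finset.sum_sub_distrib]
      refine Finset.sum_congr rfl fun l _ => ?_
      linear_combination (2 * l + 1 : ℝ) * cl l j * la_n n l + la (n + 1) l * (2 * l + 1) * cl_rec l j
    have hlow : ∀ d j, j + d = n → ∑ l ∈ Finset.range (n + 1 + 1), la (n + 1) l * (2 * l + 1) * cl l j = 0 := by
      intro d
      induction d with
      | zero =>
        intro j hj
        obtain rfl : j = n := by omega
        have h := hrec j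
        rw [ih, if_pos rfl, htop] at h
        have h2 : ((j + 1) * (j + 2) - j * (j + 1) : ℝ) ≠ 0 := by
          have : (0 : ℝ) < (j + 1) * (j + 2) - j * (j + 1) := by ring_nf; positivity
          exact this.ne'
        have h3 : ((j + 1) * (j + 2) - j * (j + 1) : ℝ) * (∑ l ∈ Finset.range (j + 1 + 1), la (j + 1) l * (2 * l + 1) * cl l j) = 0 := by
          rw [h]; ring
        exact (mul_eq_zero.1 h3).resolve_left h2
      | succ d ihd =>
        intro j hj
        have h := hrec j
        rw [ih, if_neg (by omega), ihd (j + 1) (by omega)] at h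
        have h2 : ((n + 1) * (n + 2) - j * (j + 1) : ℝ) ≠ 0 := by
          have hl : (j : ℝ) < n := by exact_mod_cast (by omega : j < n)
          have h0 : (0 : ℝ) ≤ j := by positivity
          have : (0 : ℝ) < (n + 1) * (n + 2) - j * (j + 1) := by nlinarith
          exact this.ne'
        have h3 : ((n + 1) * (n + 2) - j * (j + 1) : ℝ) * (∑ l ∈ Finset.range (n + 1 + 1), la (n + 1) l * (2 * l + 1) * cl l j) = 0 := by
          rw [h]; ring
        exact (mul_eq_zero.1 h3).resolve_left h2
    intro j
    rcases lt_trichotomy j (n + 1) with h | h | h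
    · rw [if_neg (by omega)]; exact hlow (n - j) j (by omega)
    · subst h; rw [if_pos rfl, htop]; push_cast; ring
    · rw [if_neg (by omega)]; exact hgt j h

lemma E1 (n : ℕ) (s : ℝ) : (n + 1) * s ^ n = ∑ l ∈ Finset.range (n + 1), la n l * (2 * l + 1) * pl l s := by
  have h : ∀ l ∈ Finset.range (n + 1), la n l * (2 * l + 1) * pl l s =
      ∑ j ∈ Finset.range (n + 1), la n l * (2 * l + 1) * cl l j * s ^ j := by
    intro l hl
    rw [pl_coef l s n (by simp at hl; omega), Finset.mul_sum]
    refine Finset.sum_congr rfl fun j _ => by ring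
  rw [Finset.sum_congr rfl h, Finset.sum_comm]
  simp only [← Finset.sum_mul, q_coef]
  simp

lemma pl_zero (s : ℝ) : pl 0 s = 1 := by simp [pl, legendreP]

/-- truncated logarithm -/
def Tn (n : ℕ) (s : ℝ) : ℝ := ∑ j ∈ Finset.range n, s ^ (j + 1) / (j + 1)

lemma E2 (n : ℕ) (s : ℝ) : Tn n s = n / (n + 1) + ∑ l ∈ Finset.range n, la n (l + 1) / ((l + 1) * (l + 2)) * (2 * (l + 1) + 1) * pl (l + 1) s := by
  induction n with
  | zero => simp [Tn]
  | succ n ih =>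
    have h1 : Tn (n + 1) s = Tn n s + s ^ (n + 1) / (n + 1) := by rw [Tn, Finset.sum_range_succ]; rfl
    have h2 := E1 (n + 1) s
    rw [Finset.sum_range_succ', la_zero, pl_zero] at h2
    have h3 : ∑ l ∈ Finset.range n, la n (l + 1) / ((l + 1) * (l + 2)) * (2 * (l + 1) + 1) * pl (l + 1) s =
      ∑ l ∈ Finset.range (n + 1), la n (l + 1) / ((l + 1) * (l + 2)) * (2 * (l + 1) + 1) * pl (l + 1) s := by
      rw [Finset.sum_range_succ, la_gt (by omega : n < n + 1)]; simp
    have h4 : s ^ (n + 1) / (n + 1) = ((∑ l ∈ Finset.range (n + 1), la (n + 1) (l + 1) * (2 * (l + 1 : ℕ) + 1) * pl (l + 1) s) + 1) / ((n + 1) * (n + 2)) := by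
      push_cast at h2 ⊢
      rw [div_eq_div_iff (by positivity) (by positivity)]
      linear_combination (n + 1 : ℝ) * h2
    rw [h1, ih, h3, h4]
    have h5 : ∀ l, la (n + 1) (l + 1) / ((l + 1) * (l + 2)) * (2 * (l + 1) + 1) * pl (l + 1) s =
        la n (l + 1) / ((l + 1) * (l + 2)) * (2 * (l + 1) + 1) * pl (l + 1) s +
        (la (n + 1) (l + 1) * (2 * (l + 1 : ℕ) + 1) * pl (l + 1) s) / ((n + 1) * (n + 2)) := by
      intro l
      have h6 := la_n n (l + 1)
      push_cast at h6 ⊢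
      field_simp
      linear_combination pl (l + 1) s * h6
    simp only [h5]
    rw [Finset.sum_add_distrib, ← Finset.sum_div]
    push_cast
    field_simp
    ring

lemma Tn_log (n : ℕ) {s : ℝ} (h0 : 0 ≤ s) (h1 : s ≤ 1) : 1 - s ≤ exp (- Tn n s) := by
  rcases eq_or_lt_of_le h1 with h | h
  · rw [h]; simp; positivity
  have hs := Real.hasSum_pow_div_log_of_abs_lt_one (x := s) (by rw [abs_of_nonneg h0]; exact h)
  have h2 := sum_le_hasSum (Finset.range n) (fun i _ => by positivity) hs
  rw [← Real.log_le_iff_le_exp (by linarith)]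
  have : Tn n s ≤ - log (1 - s) := h2
  linarith

lemma la_tendsto (l : ℕ) : Filter.Tendsto (fun n : ℕ => (n + 1 : ℝ) * (1 - la n l)) Filter.atTop (nhds (l * (l + 1))) ∧
    Filter.Tendsto (fun n : ℕ => la n l) Filter.atTop (nhds 1) := by
  induction l with
  | zero => simp [la_zero]
  | succ l ih =>
    have hr : Filter.Tendsto (fun n : ℕ => (n + 1 : ℝ) * (2 * l + 2) / (n + l + 2)) Filter.atTop (nhds (2 * l + 2)) := by
      have h1 : Filter.Tendsto (fun n : ℕ => 1 / ((n : ℝ) + 1)) Filter.atTop (nhds 0) := tendsto_one_div_add_atTop_nhds_zero_nat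
      have h2 : Filter.Tendsto (fun n : ℕ => (2 * l + 2 : ℝ) / (1 + (l + 1) * (1 / ((n : ℝ) + 1)))) Filter.atTop (nhds ((2 * l + 2) / (1 + (l + 1) * 0))) :=
        tendsto_const_nhds.div (tendsto_const_nhds.add (tendsto_const_nhds.mul h1)) (by simp)
      simp only [mul_zero, add_zero, div_one] at h2
      refine h2.congr fun n => ?_
      field_simp
      ring
    have e : ∀ n : ℕ, (n + 1 : ℝ) * (1 - la n (l + 1)) = (n + 1 : ℝ) * (1 - la n l) + la n l * ((n + 1 : ℝ) * (2 * l + 2) / (n + l + 2)) := by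
      intro n
      have h1 := la_succ n l
      have p1 : (n + l + 2 : ℝ) ≠ 0 := by positivity
      have h1' : la n (l + 1) = la n l * (n - l) / (n + l + 2) := by rw [eq_div_iff p1, h1]
      rw [h1']; field_simp; ring
    have h1 : Filter.Tendsto (fun n : ℕ => (n + 1 : ℝ) * (1 - la n (l + 1))) Filter.atTop (nhds ((l + 1 : ℕ) * ((l + 1 : ℕ) + 1))) := by
      simp only [e]
      have := ih.1.add (ih.2.mul hr)
      convert this using 2
      push_cast; ring
    refine ⟨h1, ?_⟩
    have h2 : Filter.Tendsto (fun n : ℕ => 1 / ((n : ℝ) + 1)) Filter.atTop (nhds 0) := tendsto_one_div_add_atTop_nhds_zero_nat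
    have h3 := (tendsto_const_nhds (x := (1 : ℝ))).sub (h1.mul h2)
    simp only [mul_zero, sub_zero] at h3
    refine h3.congr fun n => ?_
    have : (n + 1 : ℝ) ≠ 0 := by positivity
    field_simp; ring
end

noncomputable section
open MeasureTheory Real Metric
open scoped ENNReal RealInnerProductSpace Manifold Pointwise
local notation "conj" => starRingEnd ℂ

/-- generating function -/
def Gp (l : ℕ) (z u : S3) : ℂ :=
  (za z * za u + zb z * zb u) ^ l * (conj (za z) * zb u - conj (zb z) * za u) ^ l

lemma lin_mem (a b : ℂ) (n : ℕ) : (fun u : S3 => (a * za u + b * zb u) ^ n) ∈ Vn n := by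
  have h1 : (fun u : S3 => a * za u + b * zb u) ∈ Vn 1 := by
    have h := Submodule.add_mem _ (Submodule.smul_mem _ a (mon_mem 1 0))
      (Submodule.smul_mem _ b (mon_mem 0 1))
    convert h using 1
    ext z; simp
  induction n with
  | zero => simpa using one_mem
  | succ n ih => simpa [pow_succ] using Vn_mul ih h1

lemma Gp_mem (l : ℕ) (z : S3) : Gp l z ∈ Vn (2 * l) := by
  have := Vn_mul (lin_mem (za z) (zb z) l) (lin_mem (- conj (zb z)) (conj (za z)) l)
  rw [← two_mul] at this
  convert this using 1
  ext u
  simp only [Gp]; congr 2; ring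

lemma Gp_cont (l : ℕ) : Continuous fun p : S3 × S3 => Gp l p.1 p.2 := by
  unfold Gp; fun_prop

lemma mon_int (l p q : ℕ) (h : p + q = 2 * l) :
    ∫ u : S3, (za u ^ p * zb u ^ q) * conj (za u ^ l * zb u ^ l) ∂mu3 =
      if p = l then (mom l l : ℂ) else 0 := by
  have hp : p < 2 * l + 1 := by omega
  have hl : l < 2 * l + 1 := by omega
  have hq : q = 2 * l - p := by omega
  have hl' : 2 * l - l = l := by omega
  split_ifs with h'
  · have := mon_norm (2 * l) ⟨l, hl⟩
    simp only [mon, hl'] at this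
    have hql : q = l := by omega
    subst h'; rw [hql]; exact this
  · have := mon_ortho (2 * l) ⟨p, hp⟩ ⟨l, hl⟩ (by simpa using h')
    simp only [mon, hl'] at this
    rw [hq]; exact this

lemma coef_int (l : ℕ) (α β : ℂ) :
    ∫ u : S3, ((α * za u + β * zb u) ^ l * (conj α * zb u + - conj β * za u) ^ l) *
      conj (za u ^ l * zb u ^ l) ∂mu3 =
    mom l l * ∑ j ∈ Finset.range (l + 1), ((l.choose j : ℂ) ^ 2 *
      ((α * conj α) ^ j * (-(β * conj β)) ^ (l - j))) := by
  have h1 : ∀ u : S3, ((α * za u + β * zb u) ^ l * (conj α * zb u + - conj β * za u) ^ l) *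
      conj (za u ^ l * zb u ^ l) = ∑ j ∈ Finset.range (l + 1), ∑ i ∈ Finset.range (l + 1),
      ((l.choose j : ℂ) * l.choose i * (α ^ j * β ^ (l - j) * (conj α ^ i * (- conj β) ^ (l - i)))) *
      ((za u ^ (j + (l - i)) * zb u ^ ((l - j) + i)) * conj (za u ^ l * zb u ^ l)) := by
    intro u
    rw [add_pow, add_pow, Finset.sum_mul_sum, Finset.sum_mul]
    refine Finset.sum_congr rfl fun j _ => ?_
    rw [Finset.sum_mul]
    refine Finset.sum_congr rfl fun i _ => ?_
    simp only [mul_pow, pow_add]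
    ring
  simp only [h1]
  rw [integral_finsetSum _ (fun j _ => S3.integrable (by fun_prop)), Finset.mul_sum]
  refine Finset.sum_congr rfl fun j hj => ?_
  rw [integral_finsetSum _ (fun j _ => S3.integrable (by fun_prop))]
  rw [Finset.sum_eq_single j]
  · rw [integral_const_mul, mon_int _ _ _ (by have := Finset.mem_range.1 hj; omega), if_pos (by have := Finset.mem_range.1 hj; omega)]
    simp only [mul_pow, neg_pow (β * conj β), neg_pow (conj β)]
    ring
  · intro i hi hij
    rw [integral_const_mul, mon_int _ _ _ (by have := Finset.mem_range.1 hj; have := Finset.mem_range.1 hi; omega), if_neg (by have := Finset.mem_range.1 hj; have := Finset.mem_range.1 hi; omega), mul_zero]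
  · intro h; exact absurd hj h

lemma Gp_int (l : ℕ) (z w : S3) :
    ∫ u, Gp l z u * conj (Gp l w u) ∂mu3 = (mom l l : ℂ) * (pl l (Complex.normSq (hp z w)) : ℝ) := by
  have hw : Complex.normSq (conj (za w)) + Complex.normSq (conj (zb w)) = 1 := by
    rw [Complex.normSq_conj, Complex.normSq_conj, S3_normSq]
  set α := hp z w with hα
  set β := zb z * za w - za z * zb w with hβ
  have hw1 := S3_eq w
  have key : ∀ u, Gp l z u * conj (Gp l w u) =
      (fun u : S3 => ((α * za u + β * zb u) ^ l * (conj α * zb u + - conj β * za u) ^ l) *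
      conj (za u ^ l * zb u ^ l)) (sphMap (uni _ _ hw) u) := by
    intro u
    simp only [sphMap_coe, za_uni, zb_uni, Complex.conj_conj, Gp]
    have e1 : za z * za u + zb z * zb u = α * (za u * za w + zb u * zb w) +
        β * (conj (za w) * zb u - conj (zb w) * za u) := by
      simp only [hα, hβ, hp]
      linear_combination (-(za z * za u) - zb z * zb u) * hw1
    have e2 : conj (za z) * zb u - conj (zb z) * za u =
        conj α * (conj (za w) * zb u - conj (zb w) * za u) + - conj β * (za u * za w + zb u * zb w) := by
      simp only [hα, hβ, hp, map_add, map_sub, map_mul, Complex.conj_conj]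
      linear_combination (-(conj (za z) * zb u) + conj (zb z) * za u) * hw1
    rw [← e1, ← e2]
    congr 3
    ring
  rw [integral_congr_ae (Filter.Eventually.of_forall key)]
  have hI := mu3_integral (uni _ _ hw) (fun u : S3 =>
    ((α * za u + β * zb u) ^ l * (conj α * zb u + - conj β * za u) ^ l) *
      conj (za u ^ l * zb u ^ l)) (by fun_prop)
  rw [hI, coef_int, pl_bin]
  congr 1
  push_cast
  refine Finset.sum_congr rfl fun j _ => ?_
  rw [Complex.mul_conj, Complex.mul_conj]
  have h := normSq_hp_add z w
  have hb : Complex.normSq β = 1 - Complex.normSq α := by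
    rw [← h, hβ, ← Complex.normSq_neg]; simp [hα]
  rw [hb]
  push_cast
  congr 3
  ring

theorem leg_psd (l : ℕ) : ∃ g : Fin (2 * l + 1) → S3 → ℂ, (∀ a, Continuous (g a)) ∧
    ∀ z w : S3, ((pl l (Complex.normSq (hp z w)) : ℝ) : ℂ) = ∑ a, g a z * conj (g a w) := by
  have hm := mom_pos l l
  refine ⟨fun a z => (Real.sqrt (mom l l) : ℂ)⁻¹ * ∫ u, Gp l z u * conj (onb (2 * l) a u) ∂mu3,
    ?_, ?_⟩
  · intro a
    refine continuous_const.mul ?_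
    have hG := Gp_cont l
    have := continuous_parametric_integral_of_continuous (μ := mu3) (s := Set.univ)
      (f := fun z u => Gp l z u * conj (onb (2 * l) a u))
      (by simp only [Function.uncurry_def]; fun_prop) isCompact_univ
    simpa using this
  · intro z w
    obtain ⟨p, hp'⟩ := Vn_iff.1 (Gp_mem l z)
    obtain ⟨q, hq'⟩ := Vn_iff.1 (Gp_mem l w)
    have hcoef : ∀ (x : S3) (p : Fin (2 * l + 1) → ℂ), (∀ u, Gp l x u = ∑ a, p a * onb (2*l) a u) →
        ∀ a, ∫ u, Gp l x u * conj (onb (2 * l) a u) ∂mu3 = p a := by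
      intro x p hp a
      simp only [hp, Finset.sum_mul, mul_assoc]
      rw [integral_finsetSum _ (fun j _ => S3.integrable (by fun_prop))]
      simp only [integral_const_mul, onb_ortho]
      simp
    simp only [hcoef z p hp', hcoef w q hq']
    have := Gp_int l z w
    simp only [hq', map_sum, Finset.mul_sum, map_mul] at this
    have hGz : Continuous (Gp l z) := Vn_cont (Gp_mem l z)
    rw [integral_finsetSum _ (fun j _ => S3.integrable (by fun_prop))] at this
    have e : ∀ a, ∫ u, Gp l z u * (conj (q a) * conj (onb (2 * l) a u)) ∂mu3 = p a * conj (q a) := by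
      intro a
      rw [← hcoef z p hp' a, ← integral_mul_const]
      congr 1; ext u; ring
    simp only [e] at this
    have hm' : ((mom l l : ℝ) : ℂ) ≠ 0 := by exact_mod_cast hm.ne'
    have hs : (Real.sqrt (mom l l) : ℂ) * Real.sqrt (mom l l) = mom l l := by
      rw [← Complex.ofReal_mul, Real.mul_self_sqrt hm.le]
    have h2 : ∀ a, (Real.sqrt (mom l l) : ℂ)⁻¹ * p a * conj ((Real.sqrt (mom l l) : ℂ)⁻¹ * q a) =
      ((mom l l : ℝ) : ℂ)⁻¹ * (p a * conj (q a)) := by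
      intro a
      rw [← hs]; simp only [map_mul, map_inv₀, Complex.conj_ofReal, mul_inv]; ring
    simp only [h2]
    rw [← Finset.mul_sum, this, inv_mul_cancel_left₀ hm']
end

noncomputable section
open MeasureTheory Real Metric
open scoped ENNReal RealInnerProductSpace Manifold Pointwise
local notation "conj" => starRingEnd ℂ

/-- half-angle kernel -/
def kap (x y : S2) : ℝ := (1 + ⟪(x : E3), (y : E3)⟫) / 2

@[fun_prop] lemma kap_cont : Continuous fun p : S2 × S2 => kap p.1 p.2 := by
  unfold kap; fun_prop

@[fun_prop] lemma kap_cont_r (x : S2) : Continuous fun y : S2 => kap x y := by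
  unfold kap; fun_prop

lemma kap_hopf (z w : S3) : kap (hopfS z) (hopfS w) = Complex.normSq (hp z w) := by
  rw [kap, inner_hopfS]; ring

lemma kap_symm (x y : S2) : kap x y = kap y x := by
  rw [kap, kap, real_inner_comm]

lemma kap_self (x : S2) : kap x x = 1 := by
  rw [kap, real_inner_self_eq_norm_sq]; simp

lemma kap_dist (x y : S2) : dist x y ^ 2 = 4 * (1 - kap x y) := by
  rw [Subtype.dist_eq, dist_eq_norm, norm_sub_sq_real, kap]; simp; ring

lemma kap_le (x y : S2) : kap x y ≤ 1 := by
  have := kap_dist x y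
  nlinarith [sq_nonneg (dist x y)]

lemma kap_nonneg (x y : S2) : 0 ≤ kap x y := by
  obtain ⟨z, rfl⟩ := hopf_surj x
  obtain ⟨w, rfl⟩ := hopf_surj y
  rw [kap_hopf]; exact Complex.normSq_nonneg _

@[fun_prop] lemma pl_cont (l : ℕ) : Continuous (pl l) := by
  unfold pl
  exact (Polynomial.continuous _).comp (by fun_prop)

lemma leg_kap (l : ℕ) (x y : S2) : (legendreP l).eval ⟪(x : E3), (y : E3)⟫ = pl l (kap x y) := by
  rw [pl, kap]; congr 1; ring

lemma S2.cont_int {F : S2 → S2 → ℝ} (h : Continuous fun p : S2 × S2 => F p.1 p.2) :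
    Continuous fun x => ∫ y, F x y ∂sphereUniform := by
  have := continuous_parametric_integral_of_continuous (μ := sphereUniform) (s := Set.univ)
      (f := F) (by simpa only [Function.uncurry_def] using h) isCompact_univ
  simpa using this

lemma kap_moment (n : ℕ) (x : S2) : ∫ y, kap x y ^ n ∂sphereUniform = 1 / (n + 1) := by
  obtain ⟨z, rfl⟩ := hopf_surj x
  rw [← hopf_integral _ (by fun_prop), ← hp_moment n z]
  congr 1; ext w
  rw [kap_symm, kap_hopf]

/-- quadratic Legendre coefficient -/
def Cl (l : ℕ) (v : S2 → ℝ) : ℝ :=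
  ∫ x, ∫ y, v x * pl l (kap x y) * v y ∂sphereUniform ∂sphereUniform

lemma sphereArea_eq : sphereArea = ENNReal.ofReal (4 * π) • sphereUniform := by
  rw [sphereUniform, smul_smul, ENNReal.mul_inv_cancel (by simp [Real.pi_pos]) ENNReal.ofReal_ne_top, one_smul]

lemma levelSq_eq (l : ℕ) (v : S2 → ℝ) : levelSq l v = 4 * π * ((2 * l + 1) * Cl l v) := by
  unfold levelSq Cl
  rw [sphereArea_eq]
  simp only [integral_smul_measure, ENNReal.toReal_ofReal (show 0 ≤ 4 * π by positivity), smul_eq_mul,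
    zonal, leg_kap]
  have : ∀ x y : S2, v x * ((2 * l + 1 : ℝ) / (4 * π) * pl l (kap x y)) * v y =
    ((2 * l + 1 : ℝ) / (4 * π)) * (v x * pl l (kap x y) * v y) := fun x y => by ring
  simp only [this, integral_const_mul]
  have := Real.pi_ne_zero
  field_simp

theorem psd_kernel (l : ℕ) {v : S2 → ℝ} (hv : Continuous v) {M : ℕ} (x : Fin M → S2) (t : ℝ) :
    0 ≤ (∑ i, ∑ j, pl l (kap (x i) (x j))) +
      2 * t * (∑ i, ∫ y, pl l (kap (x i) y) * v y ∂sphereUniform) + t ^ 2 * Cl l v := by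
  obtain ⟨g, hg, hgk⟩ := leg_psd l
  choose z hz using fun i => hopf_surj (x i)
  set b : Fin (2 * l + 1) → ℂ := fun a => ∫ w, (v (hopfS w) : ℂ) * g a w ∂mu3 with hb
  have hB : ∀ z : S3, ((∫ y, pl l (kap (hopfS z) y) * v y ∂sphereUniform : ℝ) : ℂ) =
      ∑ a, g a z * conj (b a) := by
    intro z
    rw [← hopf_integral _ (by fun_prop), ← integral_complex_ofReal]
    have : ∀ w : S3, ((pl l (kap (hopfS z) (hopfS w)) * v (hopfS w) : ℝ) : ℂ) =
        ∑ a, g a z * conj ((v (hopfS w) : ℂ) * g a w) := by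
      intro w
      rw [kap_hopf]; push_cast
      rw [hgk, Finset.sum_mul]
      refine Finset.sum_congr rfl fun a _ => ?_
      simp only [map_mul, Complex.conj_ofReal]; ring
    simp only [this]
    rw [integral_finsetSum _ (fun a _ => S3.integrable (by have := hg a; fun_prop))]
    refine Finset.sum_congr rfl fun a _ => ?_
    rw [integral_const_mul, integral_conj]
  have hC : ((Cl l v : ℝ) : ℂ) = ∑ a, b a * conj (b a) := by
    unfold Cl
    rw [← hopf_integral _ (S2.cont_int (by fun_prop)), ← integral_complex_ofReal]
    have : ∀ w : S3, ((∫ y, v (hopfS w) * pl l (kap (hopfS w) y) * v y ∂sphereUniform : ℝ) : ℂ) =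
        ∑ a, ((v (hopfS w) : ℂ) * g a w) * conj (b a) := by
      intro w
      simp only [mul_assoc]
      rw [integral_const_mul]
      push_cast
      rw [← integral_complex_ofReal] 
      have := hB w
      rw [← integral_complex_ofReal] at this
      push_cast at this
      rw [← Finset.mul_sum, ← this]
      push_cast; rfl
    simp only [this]
    rw [integral_finsetSum _ (fun a _ => S3.integrable (by have := hg a; fun_prop))]
    refine Finset.sum_congr rfl fun a _ => ?_
    rw [integral_mul_const]
  have key : (((∑ i, ∑ j, pl l (kap (x i) (x j))) +
      2 * t * (∑ i, ∫ y, pl l (kap (x i) y) * v y ∂sphereUniform) + t ^ 2 * Cl l v : ℝ) : ℂ) =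
      ((∑ a, Complex.normSq ((∑ i, g a (z i)) + t * b a) : ℝ) : ℂ) := by
    have hB2 : ∀ i, ((∫ y, pl l (kap (x i) y) * v y ∂sphereUniform : ℝ) : ℂ) =
      ∑ a, g a (z i) * conj (b a) := fun i => by rw [← hz]; exact hB _
    have hB3 : ∀ i, ((∫ y, pl l (kap (x i) y) * v y ∂sphereUniform : ℝ) : ℂ) =
      ∑ a, b a * conj (g a (z i)) := fun i => by
        rw [← Complex.conj_ofReal, hB2, map_sum]
        refine Finset.sum_congr rfl fun a _ => ?_
        simp only [map_mul, Complex.conj_conj]; ring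
    have hA : ((∑ i, ∑ j, pl l (kap (x i) (x j)) : ℝ) : ℂ) =
        ∑ a, (∑ i, g a (z i)) * conj (∑ i, g a (z i)) := by
      push_cast
      have : ∀ i j, ((pl l (kap (x i) (x j)) : ℝ) : ℂ) = ∑ a, g a (z i) * conj (g a (z j)) := by
        intro i j; rw [← hz i, ← hz j, kap_hopf, hgk]
      simp only [this, map_sum, Finset.sum_mul_sum]
      conv_rhs => rw [Finset.sum_comm]
      refine Finset.sum_congr rfl fun i _ => ?_
      rw [Finset.sum_comm]
    have hS : ((∑ i, ∫ y, pl l (kap (x i) y) * v y ∂sphereUniform : ℝ) : ℂ) =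
        ∑ a, (∑ i, g a (z i)) * conj (b a) := by
      push_cast
      simp only [hB2, Finset.sum_mul]
      rw [Finset.sum_comm]
    have hS' : ((∑ i, ∫ y, pl l (kap (x i) y) * v y ∂sphereUniform : ℝ) : ℂ) =
        ∑ a, b a * conj (∑ i, g a (z i)) := by
      push_cast
      simp only [hB3, map_sum, Finset.mul_sum]
      rw [Finset.sum_comm]
    have h2 : ((2 * t * (∑ i, ∫ y, pl l (kap (x i) y) * v y ∂sphereUniform) : ℝ) : ℂ) =
      ∑ a, t * ((∑ i, g a (z i)) * conj (b a)) + ∑ a, t * (b a * conj (∑ i, g a (z i))) := by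
      rw [← Finset.mul_sum, ← Finset.mul_sum, ← hS, ← hS']; push_cast; ring
    rw [Complex.ofReal_add, Complex.ofReal_add, h2, hA, Complex.ofReal_mul, hC, Finset.mul_sum,
      ← Finset.sum_add_distrib, ← Finset.sum_add_distrib, ← Finset.sum_add_distrib, Complex.ofReal_sum]
    refine Finset.sum_congr rfl fun a _ => ?_
    rw [← Complex.mul_conj, map_add, map_mul, Complex.conj_ofReal]
    push_cast; ring
  have key' := Complex.ofReal_injective key
  rw [key']
  exact Finset.sum_nonneg fun a _ => Complex.normSq_nonneg _

lemma Cl_nonneg (l : ℕ) {v : S2 → ℝ} (hv : Continuous v) : 0 ≤ Cl l v := by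
  have := psd_kernel l hv (fun i : Fin 0 => i.elim0) 1
  simpa using this
end

noncomputable section
open MeasureTheory Real Metric
open scoped ENNReal RealInnerProductSpace Manifold Pointwise
local notation "conj" => starRingEnd ℂ

/-- Bergman-type probability kernel -/
def qn (n : ℕ) (x y : S2) : ℝ := (n + 1) * kap x y ^ n

@[fun_prop] lemma qn_cont (n : ℕ) : Continuous fun p : S2 × S2 => qn n p.1 p.2 := by
  unfold qn; fun_prop
@[fun_prop] lemma qn_cont_r (n : ℕ) (x : S2) : Continuous fun y : S2 => qn n x y := by
  unfold qn; fun_prop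

lemma qn_nonneg (n : ℕ) (x y : S2) : 0 ≤ qn n x y :=
  mul_nonneg (by positivity) (pow_nonneg (kap_nonneg x y) n)

lemma qn_int (n : ℕ) (x : S2) : ∫ y, qn n x y ∂sphereUniform = 1 := by
  unfold qn
  rw [integral_const_mul, kap_moment]; field_simp

lemma qn_dist (n : ℕ) (x : S2) : ∫ y, qn n x y * dist x y ^ 2 ∂sphereUniform = 4 / (n + 2) := by
  have : ∀ y, qn n x y * dist x y ^ 2 = 4 * (n + 1) * kap x y ^ n - 4 * (n + 1) * kap x y ^ (n + 1) := by
    intro y; rw [kap_dist, qn]; ring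
  simp only [this]
  rw [integral_sub (S2.integrable (by fun_prop)) (S2.integrable (by fun_prop)),
    integral_const_mul, integral_const_mul, kap_moment, kap_moment]
  push_cast; field_simp; ring

lemma qn_form (n : ℕ) {v : S2 → ℝ} (hv : Continuous v) :
    ∫ x, ∫ y, v x * qn n x y * v y ∂sphereUniform ∂sphereUniform =
      ∑ l ∈ Finset.range (n + 1), la n l * ((2 * l + 1) * Cl l v) := by
  have : ∀ x y, v x * qn n x y * v y = ∑ l ∈ Finset.range (n + 1),
      (la n l * (2 * l + 1)) * (v x * pl l (kap x y) * v y) := by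
    intro x y
    rw [qn, E1, Finset.mul_sum, Finset.sum_mul]
    refine Finset.sum_congr rfl fun l _ => ?_
    ring
  simp only [this]
  have h2 : ∀ x, ∫ y, ∑ l ∈ Finset.range (n + 1),
      (la n l * (2 * l + 1)) * (v x * pl l (kap x y) * v y) ∂sphereUniform = 
      ∑ l ∈ Finset.range (n + 1), (la n l * (2 * l + 1)) * ∫ y, (v x * pl l (kap x y) * v y) ∂sphereUniform := by
    intro x
    rw [integral_finsetSum _ (fun l _ => S2.integrable (by fun_prop))]
    simp only [integral_const_mul]
  simp only [h2]
  rw [integral_finsetSum]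
  · refine Finset.sum_congr rfl fun l _ => ?_
    rw [integral_const_mul, Cl]; ring
  · intro l _
    exact S2.integrable (continuous_const.mul (S2.cont_int (by fun_prop)))

lemma qn_var (n : ℕ) {v : S2 → ℝ} (hv : Continuous v) :
    ∫ x, ∫ y, (v x - v y) ^ 2 * qn n x y ∂sphereUniform ∂sphereUniform =
     2 * (∫ x, v x ^ 2 ∂sphereUniform - ∑ l ∈ Finset.range (n + 1), la n l * ((2 * l + 1) * Cl l v)) := by
  rw [← qn_form n hv]
  have h1 : ∀ x, ∫ y, (v x - v y) ^ 2 * qn n x y ∂sphereUniform =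
      v x ^ 2 - 2 * ∫ y, v x * qn n x y * v y ∂sphereUniform + ∫ y, qn n x y * v y ^ 2 ∂sphereUniform := by
    intro x
    have : ∀ y, (v x - v y) ^ 2 * qn n x y = v x ^ 2 * qn n x y - 2 * (v x * qn n x y * v y) +
      qn n x y * v y ^ 2 := fun y => by ring
    simp only [this]
    rw [integral_add (S2.integrable (by fun_prop)) (S2.integrable (by fun_prop)),
      integral_sub (S2.integrable (by fun_prop)) (S2.integrable (by fun_prop)),
      integral_const_mul, integral_const_mul, qn_int, mul_one]
  simp only [h1]
  have c1 : Continuous fun x => ∫ y, v x * qn n x y * v y ∂sphereUniform := S2.cont_int (by fun_prop)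
  have c2 : Continuous fun x => ∫ y, qn n x y * v y ^ 2 ∂sphereUniform := S2.cont_int (by fun_prop)
  rw [integral_add (S2.integrable (by fun_prop)) (S2.integrable (by fun_prop)),
      integral_sub (S2.integrable (by fun_prop)) (S2.integrable (by fun_prop)), integral_const_mul]
  have h3 : ∫ x, ∫ y, qn n x y * v y ^ 2 ∂sphereUniform ∂sphereUniform = ∫ x, v x ^ 2 ∂sphereUniform := by
    rw [integral_integral_swap]
    · congr 1; ext y
      rw [integral_mul_const]
      have : ∀ x, qn n x y = qn n y x := fun x => by rw [qn, qn, kap_symm]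
      simp only [this, qn_int, one_mul]
    · have hc : Continuous fun p : S2 × S2 => qn n p.1 p.2 * v p.2 ^ 2 := by fun_prop
      obtain ⟨C, hC⟩ := isCompact_univ.exists_bound_of_continuousOn hc.continuousOn
      exact Integrable.of_bound hc.aestronglyMeasurable C
        (Filter.Eventually.of_forall fun p => hC p (Set.mem_univ _))
  rw [h3]; ring

lemma bessel {v : S2 → ℝ} (hv : Continuous v) (K : ℕ) :
    ∑ l ∈ Finset.range (K + 1), (2 * l + 1) * Cl l v ≤ ∫ x, v x ^ 2 ∂sphereUniform := by
  have h : ∀ n, ∑ l ∈ Finset.range (n + 1), la n l * ((2 * l + 1) * Cl l v) ≤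
      ∫ x, v x ^ 2 ∂sphereUniform := by
    intro n
    have h1 := qn_var n hv
    have h2 : 0 ≤ ∫ x, ∫ y, (v x - v y) ^ 2 * qn n x y ∂sphereUniform ∂sphereUniform :=
      integral_nonneg fun x => integral_nonneg fun y => mul_nonneg (sq_nonneg _) (qn_nonneg _ _ _)
    linarith
  have hc : Filter.Tendsto (fun n : ℕ => ∑ l ∈ Finset.range (K + 1), la n l * ((2 * l + 1) * Cl l v))
      Filter.atTop (nhds (∑ l ∈ Finset.range (K + 1), 1 * ((2 * l + 1) * Cl l v))) :=
    tendsto_finsetSum _ fun l _ => (la_tendsto l).2.mul_const _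
  simp only [one_mul] at hc
  refine le_of_tendsto hc ?_
  filter_upwards [Filter.eventually_ge_atTop K] with n hn
  refine le_trans ?_ (h n)
  refine Finset.sum_le_sum_of_subset_of_nonneg (Finset.range_mono (by omega)) ?_
  intro l _ _
  exact mul_nonneg (la_nonneg n l) (mul_nonneg (by positivity) (Cl_nonneg l hv))

lemma sob_partial {v : S2 → ℝ} (hv : Continuous v) {L : ℝ}
    (hL : ∀ x y, |v x - v y| ≤ L * dist x y) (K : ℕ) :
    ∑ l ∈ Finset.range (K + 1), ((l : ℝ) * (l + 1)) * ((2 * l + 1) * Cl l v) ≤ 2 * L ^ 2 := by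
  have h : ∀ n : ℕ, ∫ x, v x ^ 2 ∂sphereUniform -
      ∑ l ∈ Finset.range (n + 1), la n l * ((2 * l + 1) * Cl l v) ≤ 2 * L ^ 2 / (n + 2) := by
    intro n
    have h1 := qn_var n hv
    have h2 : ∫ x, ∫ y, (v x - v y) ^ 2 * qn n x y ∂sphereUniform ∂sphereUniform ≤ 4 * L ^ 2 / (n + 2) := by
      have h3 : ∀ x, ∫ y, (v x - v y) ^ 2 * qn n x y ∂sphereUniform ≤ 4 * L ^ 2 / (n + 2) := by
        intro x
        have : 4 * L ^ 2 / (n + 2) = ∫ y, L ^ 2 * (qn n x y * dist x y ^ 2) ∂sphereUniform := by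
          rw [integral_const_mul, qn_dist]; ring
        rw [this]
        refine integral_mono (S2.integrable (by fun_prop)) (S2.integrable (by fun_prop)) fun y => ?_
        have h4 : (v x - v y) ^ 2 ≤ (L * dist x y) ^ 2 := by
          rw [← sq_abs]; exact pow_le_pow_left₀ (abs_nonneg _) (hL x y) 2
        have := mul_le_mul_of_nonneg_right h4 (qn_nonneg n x y)
        simp only; nlinarith [this]
      calc _ ≤ ∫ x, 4 * L ^ 2 / (n + 2) ∂sphereUniform :=
            integral_mono (S2.integrable (S2.cont_int (by fun_prop))) (integrable_const _) h3
        _ = _ := by simp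
    have : 2 * L ^ 2 / (n + 2 : ℝ) = (4 * L ^ 2 / (n + 2)) / 2 := by ring
    rw [this]; linarith
  have hc : Filter.Tendsto (fun n : ℕ => ∑ l ∈ Finset.range (K + 1), ((n + 1 : ℝ) * (1 - la n l)) * ((2 * l + 1) * Cl l v))
      Filter.atTop (nhds (∑ l ∈ Finset.range (K + 1), ((l : ℝ) * (l + 1)) * ((2 * l + 1) * Cl l v))) :=
    tendsto_finsetSum _ fun l _ => (la_tendsto l).1.mul_const _
  refine le_of_tendsto hc ?_
  filter_upwards [Filter.eventually_ge_atTop K] with n hn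
  have hb := bessel hv n
  have h1 : ∑ l ∈ Finset.range (n + 1), (1 - la n l) * ((2 * l + 1) * Cl l v) ≤ 2 * L ^ 2 / (n + 2) := by
    refine le_trans ?_ (h n)
    simp only [sub_mul, one_mul, Finset.sum_sub_distrib]
    linarith
  have h2 : ∑ l ∈ Finset.range (K + 1), (1 - la n l) * ((2 * l + 1) * Cl l v) ≤
      ∑ l ∈ Finset.range (n + 1), (1 - la n l) * ((2 * l + 1) * Cl l v) := by
    refine Finset.sum_le_sum_of_subset_of_nonneg (Finset.range_mono (by omega)) ?_
    intro l _ _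
    exact mul_nonneg (sub_nonneg.2 (la_le n l)) (mul_nonneg (by positivity) (Cl_nonneg l hv))
  simp only [mul_assoc, ← Finset.mul_sum] at h1 h2 ⊢
  calc _ ≤ (n + 1 : ℝ) * (2 * L ^ 2 / (n + 2)) :=
        mul_le_mul_of_nonneg_left (h2.trans h1) (by positivity)
    _ ≤ 2 * L ^ 2 := by
      rw [mul_div_assoc', div_le_iff₀ (by positivity)]
      nlinarith [sq_nonneg L]

/-- normalized Sobolev seminorm -/
def sb (v : S2 → ℝ) : ℝ := ∑' l : ℕ, ((l + 1 : ℝ) * (l + 2)) * ((2 * (l + 1) + 1) * Cl (l + 1) v)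

lemma sob_eq (v : S2 → ℝ) : sobNormSq 1 v = 4 * π * sb v := by
  unfold sobNormSq sb
  rw [← tsum_mul_left]
  congr 1; ext l
  rw [levelSq_eq, Real.rpow_one]
  push_cast; ring

lemma sb_summable {v : S2 → ℝ} (hv : Continuous v) {L : ℝ}
    (hL : ∀ x y, |v x - v y| ≤ L * dist x y) :
    Summable fun l : ℕ => ((l + 1 : ℝ) * (l + 2)) * ((2 * (l + 1) + 1) * Cl (l + 1) v) := by
  refine summable_of_sum_range_le (c := 2 * L ^ 2) ?_ ?_
  · intro l
    have := Cl_nonneg (l + 1) hv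
    positivity
  · intro K
    have := sob_partial hv hL K
    rw [Finset.sum_range_succ'] at this
    push_cast at this
    simp only [zero_mul, add_zero] at this
    refine le_trans (le_of_eq ?_) this
    refine Finset.sum_congr rfl fun l _ => ?_
    ring

lemma sb_ge {v : S2 → ℝ} (hv : Continuous v) {L : ℝ}
    (hL : ∀ x y, |v x - v y| ≤ L * dist x y) (K : ℕ) :
    ∑ l ∈ Finset.range K, ((l + 1 : ℝ) * (l + 2)) * ((2 * (l + 1) + 1) * Cl (l + 1) v) ≤ sb v := by
  refine (sb_summable hv hL).sum_le_tsum _ ?_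
  intro l _
  have := Cl_nonneg (l + 1) hv
  positivity

lemma sb_nonneg {v : S2 → ℝ} (hv : Continuous v) : 0 ≤ sb v := by
  refine tsum_nonneg fun l => ?_
  have := Cl_nonneg (l + 1) hv
  positivity

lemma sb_smul (c : ℝ) (v : S2 → ℝ) : sb (fun x => c * v x) = c ^ 2 * sb v := by
  unfold sb
  rw [← tsum_mul_left]
  congr 1; ext l
  have : Cl (l + 1) (fun x => c * v x) = c ^ 2 * Cl (l + 1) v := by
    unfold Cl
    have : ∀ x y, c * v x * pl (l + 1) (kap x y) * (c * v y) =
      c ^ 2 * (v x * pl (l + 1) (kap x y) * v y) := fun x y => by ring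
    simp only [this, integral_const_mul]
  rw [this]; ring
end

noncomputable section
open MeasureTheory Real Metric
open scoped ENNReal RealInnerProductSpace Manifold Pointwise
local notation "conj" => starRingEnd ℂ

lemma dist_exp (k : ℕ) (x y : S2) : dist x y ≤ exp (log 2 - Tn k (kap x y) / 2) := by
  rw [← abs_of_nonneg (dist_nonneg (x := x) (y := y)), ← abs_of_pos (exp_pos _), ← sq_le_sq, kap_dist]
  have := Tn_log k (kap_nonneg x y) (kap_le x y)
  have h2 : exp (log 2 - Tn k (kap x y) / 2) ^ 2 = 4 * exp (- Tn k (kap x y)) := by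
    rw [exp_sub, exp_log (by norm_num), div_pow, ← exp_nat_mul, exp_neg]
    rw [show ((2 : ℕ) : ℝ) * (Tn k (kap x y) / 2) = Tn k (kap x y) by push_cast; ring]
    field_simp; norm_num
  rw [h2]; linarith

lemma smooth_bd (k : ℕ) {v : S2 → ℝ} (hv : Continuous v) {L : ℝ} (hL0 : 0 ≤ L)
    (hL : ∀ x y, |v x - v y| ≤ L * dist x y) (x : S2) :
    v x ≤ ∫ y, qn k x y * v y ∂sphereUniform + 2 * L / √(k + 2) := by
  have hs : 0 < √((k : ℝ) + 2) := Real.sqrt_pos.2 (by positivity)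
  set e := √((k : ℝ) + 2) with he
  have hee : e ^ 2 = k + 2 := Real.sq_sqrt (by positivity)
  have h1 : v x = ∫ y, qn k x y * v x ∂sphereUniform := by
    rw [integral_mul_const, qn_int, one_mul]
  have h2 : 2 * L / e = ∫ y, (L / e * qn k x y + L * e / 4 * (qn k x y * dist x y ^ 2)) ∂sphereUniform := by
    rw [integral_add (S2.integrable (by fun_prop)) (S2.integrable (by fun_prop)),
      integral_const_mul, integral_const_mul, qn_int, qn_dist, ← hee]
    field_simp; ring
  rw [h2, ← integral_add (S2.integrable (by fun_prop)) (S2.integrable (by fun_prop))]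
  conv_lhs => rw [h1]
  refine integral_mono (S2.integrable (by fun_prop)) (S2.integrable (by fun_prop)) fun y => ?_
  have h3 := (le_abs_self _).trans (hL x y)
  have h4 : dist x y ≤ 1 / e + e / 4 * dist x y ^ 2 := by
    have : 1 / e + e / 4 * dist x y ^ 2 - dist x y = (e * dist x y / 2 - 1) ^ 2 / e := by
      field_simp; ring
    have h5 : 0 ≤ (e * dist x y / 2 - 1) ^ 2 / e := by positivity
    linarith
  have h6 : v x - v y ≤ L * (1 / e + e / 4 * dist x y ^ 2) :=
    h3.trans (mul_le_mul_of_nonneg_left h4 hL0)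
  have h7 := mul_le_mul_of_nonneg_left h6 (qn_nonneg k x y)
  simp only
  have e1 : qn k x y * (L * (1 / e + e / 4 * dist x y ^ 2)) =
    L / e * qn k x y + L * e / 4 * (qn k x y * dist x y ^ 2) := by ring
  linarith

lemma qn_exp (k : ℕ) {v : S2 → ℝ} (hv : Continuous v) (x : S2) :
    ∫ y, qn k x y * v y ∂sphereUniform = ∫ y, v y ∂sphereUniform +
      ∑ l ∈ Finset.range k, la k (l + 1) * (2 * (l + 1) + 1) *
        ∫ y, pl (l + 1) (kap x y) * v y ∂sphereUniform := by
  have : ∀ y, qn k x y * v y = ∑ l ∈ Finset.range (k + 1),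
      (la k l * (2 * l + 1)) * (pl l (kap x y) * v y) := by
    intro y
    rw [qn, E1, Finset.sum_mul]
    refine Finset.sum_congr rfl fun l _ => ?_
    ring
  simp only [this]
  rw [integral_finsetSum _ (fun l _ => S2.integrable (by fun_prop)), Finset.sum_range_succ', add_comm]
  simp only [integral_const_mul]
  congr 1
  · simp [la_zero, pl_zero]
  · push_cast; rfl

theorem energy (k : ℕ) {v : S2 → ℝ} (hv : Continuous v) {L : ℝ} (hL0 : 0 ≤ L)
    (hL : ∀ x y, |v x - v y| ≤ L * dist x y) (x : Fin (k + 1) → S2) :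
    (∏ p ∈ Finset.univ.offDiag, dist (x p.1) (x p.2)) * ∏ i, exp (k * v (x i)) ≤
      exp ((k + 1) * k * log 2 - k * (k + 1) / 2 + (k + 1) * Tn k 1 / 2 +
        k * (k + 1) * (∫ y, v y ∂sphereUniform + 2 * L / √(k + 2)) + k ^ 2 / 2 * sb v) := by
  have h1 : ∏ p ∈ (Finset.univ : Finset (Fin (k + 1))).offDiag, dist (x p.1) (x p.2) ≤
      exp (∑ p ∈ (Finset.univ : Finset (Fin (k + 1))).offDiag, (log 2 - Tn k (kap (x p.1) (x p.2)) / 2)) := by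
    rw [exp_sum]
    exact Finset.prod_le_prod (fun _ _ => dist_nonneg) fun p _ => dist_exp k _ _
  rw [← exp_sum]
  refine (mul_le_mul_of_nonneg_right h1 (exp_pos _).le).trans ?_
  rw [← exp_add]
  apply exp_le_exp.2
  set A : ℕ → ℝ := fun l => ∑ i, ∑ j, pl l (kap (x i) (x j)) with hA
  set Bb : ℕ → ℝ := fun l => ∑ i, ∫ y, pl l (kap (x i) y) * v y ∂sphereUniform with hB
  have hT : ∑ i, ∑ j, Tn k (kap (x i) (x j)) = (k + 1) * k +
      ∑ l ∈ Finset.range k, la k (l + 1) / ((l + 1) * (l + 2)) * (2 * (l + 1) + 1) * A (l + 1) := by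
    simp only [E2, Finset.sum_add_distrib, Finset.sum_const, Finset.card_univ, Fintype.card_fin, nsmul_eq_mul]
    congr 1
    · push_cast; field_simp
    · simp only [hA, Finset.mul_sum]
      rw [Finset.sum_comm' (t' := Finset.univ) (s' := fun _ => Finset.univ) (by simp)]
      conv_rhs => rw [Finset.sum_comm]
      rw [Finset.sum_comm]
      refine Finset.sum_congr rfl fun i _ => ?_
      rw [Finset.sum_comm]
  have hoff : ∑ p ∈ (Finset.univ : Finset (Fin (k + 1))).offDiag, Tn k (kap (x p.1) (x p.2)) =
      ∑ i, ∑ j, Tn k (kap (x i) (x j)) - (k + 1) * Tn k 1 := by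
    have h := Finset.sum_union (f := fun p : Fin (k + 1) × Fin (k + 1) => Tn k (kap (x p.1) (x p.2)))
      (Finset.disjoint_diag_offDiag (Finset.univ : Finset (Fin (k + 1))))
    rw [Finset.diag_union_offDiag, Finset.sum_product, Finset.sum_diag] at h
    simp only [kap_self, Finset.sum_const, Finset.card_univ, Fintype.card_fin, nsmul_eq_mul] at h
    push_cast at h
    linarith
  have hlog : ∑ p ∈ (Finset.univ : Finset (Fin (k + 1))).offDiag, (log 2 - Tn k (kap (x p.1) (x p.2)) / 2) =
      (k + 1) * k * log 2 - (∑ i, ∑ j, Tn k (kap (x i) (x j)) - (k + 1) * Tn k 1) / 2 := by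
    rw [← hoff, Finset.sum_sub_distrib, ← Finset.sum_div, Finset.sum_const, Finset.offDiag_card]
    congr 1
    simp only [Finset.card_univ, Fintype.card_fin, nsmul_eq_mul]
    rw [show (k + 1) * (k + 1) - (k + 1) = (k + 1) * k by
      rw [Nat.mul_succ, Nat.add_sub_cancel]]
    push_cast; ring
  have hv1 : ∑ i, v (x i) ≤ (k + 1) * (∫ y, v y ∂sphereUniform + 2 * L / √(k + 2)) +
      ∑ l ∈ Finset.range k, la k (l + 1) * (2 * (l + 1) + 1) * Bb (l + 1) := by
    have : ∀ i, v (x i) ≤ (∫ y, v y ∂sphereUniform + 2 * L / √(k + 2)) + 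
      ∑ l ∈ Finset.range k, la k (l + 1) * (2 * (l + 1) + 1) *
        ∫ y, pl (l + 1) (kap (x i) y) * v y ∂sphereUniform := by
      intro i
      have := smooth_bd k hv hL0 hL (x i)
      rw [qn_exp k hv] at this
      linarith
    refine (Finset.sum_le_sum fun i _ => this i).trans (le_of_eq ?_)
    rw [Finset.sum_add_distrib]
    congr 1
    · simp; ring
    · rw [Finset.sum_comm]
      simp only [hB, Finset.mul_sum]
  have hper : ∀ l ∈ Finset.range k, - (la k (l + 1) / ((l + 1) * (l + 2)) * (2 * (l + 1) + 1) * A (l + 1)) / 2 +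
      k * (la k (l + 1) * (2 * (l + 1) + 1) * Bb (l + 1)) ≤
      k ^ 2 / 2 * (((l + 1 : ℝ) * (l + 2)) * ((2 * (l + 1) + 1) * Cl (l + 1) v)) := by
    intro l _
    have h := psd_kernel (l + 1) hv x (-(k * ((l + 1 : ℝ) * (l + 2))))
    change 0 ≤ A (l + 1) + 2 * (-(k * ((l + 1 : ℝ) * (l + 2)))) * Bb (l + 1) + _ at h
    have hC := Cl_nonneg (l + 1) hv
    have hl0 := la_nonneg k (l + 1)
    have hl1 := la_le k (l + 1)
    have hm : 0 < (l + 1 : ℝ) * (l + 2) := by positivity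
    set m := (l + 1 : ℝ) * (l + 2) with hmdef
    have hd : (0 : ℝ) < 2 * (l + 1) + 1 := by positivity
    set d : ℝ := 2 * (l + 1) + 1 with hddef
    have h2 : 0 ≤ la k (l + 1) * d / (2 * m) := by positivity
    have h3 := mul_nonneg h2 h
    have h4 : la k (l + 1) * (k ^ 2 / 2 * (m * (d * Cl (l + 1) v))) ≤ 1 * (k ^ 2 / 2 * (m * (d * Cl (l + 1) v))) :=
      mul_le_mul_of_nonneg_right hl1 (by positivity)
    have h5 : la k (l + 1) * d / (2 * m) * (A (l + 1) + 2 * (-(k * m)) * Bb (l + 1) + (-(k * m)) ^ 2 * Cl (l + 1) v) =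
      la k (l + 1) / m * d * A (l + 1) / 2 - k * (la k (l + 1) * d * Bb (l + 1)) +
        la k (l + 1) * (k ^ 2 / 2 * (m * (d * Cl (l + 1) v))) := by
      field_simp; ring
    rw [h5] at h3
    linarith
  have hsum := Finset.sum_le_sum hper
  rw [Finset.sum_add_distrib, ← Finset.mul_sum, ← Finset.sum_div, Finset.sum_neg_distrib, ← Finset.mul_sum] at hsum
  have hsb := mul_le_mul_of_nonneg_left (sb_ge hv hL k) (show (0 : ℝ) ≤ k ^ 2 / 2 by positivity)
  have hv2 := mul_le_mul_of_nonneg_left hv1 (Nat.cast_nonneg (α := ℝ) k)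
  rw [hlog, hT, ← Finset.mul_sum]
  rw [mul_add] at hv2
  linarith

lemma det_bound (k : ℕ) {v : S2 → ℝ} (hv : Continuous v) {L : ℝ} (hL0 : 0 ≤ L)
    (hL : ∀ x y, |v x - v y| ≤ L * dist x y) :
    log (Mat k (fun z => exp (k * v (hopfS z)))).det.re ≤ (k + 1) * Tn k 1 / 2 + (k + 1) * log (k + 1) +
        k * (k + 1) * (∫ y, v y ∂sphereUniform + 2 * L / √(k + 2)) + k ^ 2 / 2 * sb v := by
  have := det_energy k hv (energy k hv hL0 hL)
  refine this.trans (le_of_eq ?_)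
  ring
end

noncomputable section
open MeasureTheory Real Metric
open scoped ENNReal NNReal RealInnerProductSpace Manifold Pointwise Topology

lemma smooth_loc {w : S2 → ℝ} (hw : SmoothOnSphere w) : LocallyLipschitz w := by
  intro x
  have h := (contMDiffAt_iff.1 (hw x)).2
  simp only [modelWithCornersSelf_coe, Set.range_id, contDiffWithinAt_univ, mfld_simps] at h
  set φ := chartAt (EuclideanSpace ℝ (Fin 2)) x with hφ
  let U := (OrthonormalBasis.fromOrthogonalSpanSingleton (𝕜 := ℝ) 2 (ne_zero_of_mem_unit_sphere (-x))).repr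
  have hφ' : ∀ y : S2, φ y = U (stereoToFun ((-x : S2) : E3) y) := fun y => rfl
  have hst : ContDiffAt ℝ 1 (fun y : E3 => U (stereoToFun ((-x : S2) : E3) y)) x := by
    refine U.contDiff.contDiffAt.comp (x : E3) ?_
    refine (contDiffOn_stereoToFun (n := 1)).contDiffAt ?_
    apply IsOpen.mem_nhds
    · exact isOpen_ne_fun (by fun_prop) (by fun_prop)
    · simp
      norm_num
  have hF : ContDiffAt ℝ 1 ((w ∘ φ.symm) ∘ fun y : E3 => U (stereoToFun ((-x : S2) : E3) y)) x := by
    refine ContDiffAt.comp (x : E3) ?_ hst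
    rw [← hφ']
    exact h.of_le (by norm_cast)
  obtain ⟨K, t, ht, hK⟩ := hF.exists_lipschitzOnWith
  refine ⟨K, (fun y : S2 => (y : E3)) ⁻¹' t ∩ φ.source, Filter.inter_mem
    (continuous_subtype_val.continuousAt.preimage_mem_nhds ht)
    (φ.open_source.mem_nhds (mem_chart_source _ x)), ?_⟩
  intro a ha b hb
  have := hK ha.1 hb.1
  simp only [Function.comp] at this
  rw [← hφ', ← hφ', φ.left_inv ha.2, φ.left_inv hb.2] at this
  exact this

lemma smooth_lip {w : S2 → ℝ} (hw : SmoothOnSphere w) :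
    ∃ L : ℝ, 0 ≤ L ∧ ∀ x y, |w x - w y| ≤ L * dist x y := by
  have h : LocallyLipschitzOn Set.univ w := (smooth_loc hw).locallyLipschitzOn
  obtain ⟨K, hK⟩ := h.exists_lipschitzOnWith_of_compact isCompact_univ
  refine ⟨K, K.2, fun x y => ?_⟩
  have := hK.dist_le_mul x (Set.mem_univ _) y (Set.mem_univ _)
  rwa [Real.dist_eq] at this
end

noncomputable section
open MeasureTheory Real Metric
open scoped ENNReal NNReal RealInnerProductSpace Manifold Pointwise Topology

lemma Tn_one (k : ℕ) : Tn k 1 ≤ 1 + log (k + 1) := by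
  have h := harmonic_le_one_add_log k
  have e : ((harmonic k : ℚ) : ℝ) = Tn k 1 := by
    simp [harmonic, Tn]
  rw [e] at h
  refine h.trans ?_
  rcases Nat.eq_zero_or_pos k with rfl | hk
  · simp
  · have : log k ≤ log (k + 1) := log_le_log (by exact_mod_cast hk) (by linarith)
    linarith

lemma det_lim_bd (n k : ℕ) (hk : 0 < k) {v : S2 → ℝ} (hv : Continuous v) {L : ℝ} (hL0 : 0 ≤ L)
    (hL : ∀ x y, |v x - v y| ≤ L * dist x y) :
    log (Mat n (fun z => exp ((n + 2) * v (hopfS z)))).det.re ≤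
      (n + 1) * (n + 2) * (6 * (log (k + 1) / k) + (L ^ 2 / 2 + 1) / k + 2 * L / √(k + 2) +
        (∫ y, v y ∂sphereUniform + sb v / 2)) := by
  have h1 := key_ineq n k hk hv hL
  have h2 := det_bound k hv hL0 hL
  have hk' : (0 : ℝ) < k := by exact_mod_cast hk
  have hs := sb_nonneg hv
  have hT := Tn_one k
  have h3 : log ((k + k ^ 2 + 1) ^ 2 * exp (L ^ 2 / 2) / (k + 1)) ≤ 4 * log (k + 1) + L ^ 2 / 2 := by
    have : 4 * log (k + 1 : ℝ) + L ^ 2 / 2 = log ((k + 1) ^ 4 * exp (L ^ 2 / 2)) := by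
      rw [log_mul (by positivity) (by positivity), log_pow, log_exp]; norm_num
    rw [this]
    apply log_le_log (by positivity)
    rw [div_le_iff₀ (by positivity)]
    have h5 : ((k : ℝ) + k ^ 2 + 1) ^ 2 ≤ (k + 1) ^ 4 * (k + 1) := by
      have : 0 < (k : ℝ) ^ 2 := by positivity
      have : 0 < (k : ℝ) ^ 3 := by positivity
      have : 0 < (k : ℝ) ^ 4 := by positivity
      have : 0 < (k : ℝ) ^ 5 := by positivity
      nlinarith
    nlinarith [exp_pos (L ^ 2 / 2)]
  have hlog : 0 ≤ log (k + 1 : ℝ) := log_nonneg (by linarith)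
  set I := ∫ y, v y ∂sphereUniform with hI
  set d := 2 * L / √((k : ℝ) + 2) with hd
  have h4 : log (Mat k (fun z => exp (k * v (hopfS z)))).det.re ≤
      k * (k + 1) * (2 * (log (k + 1) / k) + 1 / k + (I + d) + sb v / 2) := by
    refine h2.trans ?_
    have e : k * (k + 1) * (2 * (log (k + 1) / k) + 1 / k + (I + d) + sb v / 2) = 
      (k + 1) * (2 * log (k + 1)) + (k + 1) + k * (k + 1) * (I + d) + k * (k + 1) * sb v / 2 := by
      field_simp
    rw [e]
    have e2 : (k + 1) * Tn k 1 ≤ (k + 1) * (1 + log (k + 1)) := mul_le_mul_of_nonneg_left hT (by positivity)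
    have e3 : 0 ≤ k * sb v := by positivity
    have e4 : 0 ≤ k * log (k + 1 : ℝ) := by positivity
    nlinarith
  have h6 : (n + 1) * (n + 2) / k * log ((k + k ^ 2 + 1) ^ 2 * exp (L ^ 2 / 2) / (k + 1)) ≤
    (n + 1) * (n + 2) / k * (4 * log (k + 1) + L ^ 2 / 2) := mul_le_mul_of_nonneg_left h3 (by positivity)
  have h7 : (n + 1) * (n + 2) / (k * (k + 1)) * log (Mat k (fun z => exp (k * v (hopfS z)))).det.re ≤
    (n + 1) * (n + 2) / (k * (k + 1)) * (k * (k + 1) * (2 * (log (k + 1) / k) + 1 / k + (I + d) + sb v / 2)) :=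
    mul_le_mul_of_nonneg_left h4 (by positivity)
  refine (h1.trans (add_le_add h6 h7)).trans (le_of_eq ?_)
  field_simp
  ring

lemma det_lim (n : ℕ) {v : S2 → ℝ} (hv : Continuous v) {L : ℝ} (hL0 : 0 ≤ L)
    (hL : ∀ x y, |v x - v y| ≤ L * dist x y) :
    log (Mat n (fun z => exp ((n + 2) * v (hopfS z)))).det.re ≤
      (n + 1) * (n + 2) * (∫ y, v y ∂sphereUniform + sb v / 2) := by
  have t1 : Filter.Tendsto (fun k : ℕ => log (k + 1 : ℝ) / k) Filter.atTop (𝓝 0) := by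
    have h := Real.tendsto_pow_log_div_mul_add_atTop 1 (-1) 1 one_ne_zero
    have h2 : Filter.Tendsto (fun k : ℕ => (k + 1 : ℝ)) Filter.atTop Filter.atTop :=
      Filter.tendsto_atTop_add_const_right _ _ tendsto_natCast_atTop_atTop
    refine (h.comp h2).congr fun k => ?_
    simp
  have t2 : Filter.Tendsto (fun k : ℕ => (L ^ 2 / 2 + 1) / (k : ℝ)) Filter.atTop (𝓝 0) :=
    tendsto_const_nhds.div_atTop tendsto_natCast_atTop_atTop
  have t3 : Filter.Tendsto (fun k : ℕ => 2 * L / √((k : ℝ) + 2)) Filter.atTop (𝓝 0) :=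
    tendsto_const_nhds.div_atTop (Real.tendsto_sqrt_atTop.comp
      (Filter.tendsto_atTop_add_const_right _ _ tendsto_natCast_atTop_atTop))
  have t := ((((t1.const_mul 6).add t2).add t3).add_const
    (∫ y, v y ∂sphereUniform + sb v / 2)).const_mul ((n + 1 : ℝ) * (n + 2))
  have t' : (n + 1 : ℝ) * (n + 2) * (6 * 0 + 0 + 0 + (∫ y, v y ∂sphereUniform + sb v / 2)) =
    (n + 1) * (n + 2) * (∫ y, v y ∂sphereUniform + sb v / 2) := by ring
  rw [t'] at t
  refine ge_of_tendsto t ?_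
  filter_upwards [Filter.eventually_gt_atTop 0] with k hk
  exact det_lim_bd n k hk hv hL0 hL

lemma det_final (n : ℕ) {w : S2 → ℝ} (hw : SmoothOnSphere w) :
    (Mat n (fun z => exp (w (hopfS z)))).det.re ≤
      exp ((n + 1) * ∫ y, w y ∂sphereUniform + sb w / 2) := by
  obtain ⟨L, hL0, hL⟩ := smooth_lip hw
  have hc : Continuous w := hw.continuous
  have hn : (0 : ℝ) < n + 2 := by positivity
  have h := det_lim n (v := fun x => (n + 2 : ℝ)⁻¹ * w x) (by fun_prop) (L := (n + 2 : ℝ)⁻¹ * L)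
    (by positivity) (by
      intro x y
      rw [← mul_sub, abs_mul, abs_of_pos (by positivity), mul_assoc]
      exact mul_le_mul_of_nonneg_left (hL x y) (by positivity))
  have e : ∀ z : S3, (n + 2 : ℝ) * ((n + 2 : ℝ)⁻¹ * w (hopfS z)) = w (hopfS z) := fun z => by
    field_simp
  simp only [e] at h
  rw [sb_smul, integral_const_mul] at h
  have hp := mat_det_pos n (ψ := fun z => exp (w (hopfS z))) (by fun_prop) (fun z => exp_pos _)
  rw [← exp_log hp]
  apply exp_le_exp.2
  refine h.trans ?_
  have hs := sb_nonneg hc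
  have e2 : (n + 1 : ℝ) * (n + 2) * ((n + 2 : ℝ)⁻¹ * ∫ y, w y ∂sphereUniform + (n + 2 : ℝ)⁻¹ ^ 2 * sb w / 2) =
    (n + 1) * ∫ y, w y ∂sphereUniform + (n + 1) / (n + 2) * (sb w / 2) := by
    field_simp
  rw [e2]
  have h3 : (n + 1 : ℝ) / (n + 2) ≤ 1 := by rw [div_le_one hn]; linarith
  have := mul_le_mul_of_nonneg_right h3 (show 0 ≤ sb w / 2 by positivity)
  linarith

lemma S2pi_integrable {N : ℕ} {F : (Fin N → S2) → ℝ} (hF : Continuous F) :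
    Integrable F (Measure.pi fun _ => sphereUniform) := by
  obtain ⟨C, hC⟩ := isCompact_univ.exists_bound_of_continuousOn hF.continuousOn
  exact Integrable.of_bound hF.aestronglyMeasurable C
    (Filter.Eventually.of_forall fun p => hC p (Set.mem_univ _))

lemma dens_cont (N : ℕ) : Continuous fun x : Fin N → S2 =>
    ∏ p ∈ (Finset.univ : Finset (Fin N)).offDiag, dist (x p.1) (x p.2) := by
  fun_prop

theorem final_aux (N : ℕ) (hN : 0 < N) (w : S2 → ℝ)
    (hw : SmoothOnSphere w) :
    ∫⁻ x, ENNReal.ofReal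
        (Real.exp ((∑ i, w (x i)) - N * ∫ y, w y ∂sphereUniform))
        ∂(sphericalEnsemble N) ≤
      ENNReal.ofReal (Real.exp (1 / (8 * π) * sobNormSq 1 w)) := by
  obtain ⟨n, rfl⟩ : ∃ n, N = n + 1 := ⟨N - 1, by omega⟩
  have hc : Continuous w := hw.continuous
  have hdc := dens_cont (n + 1)
  set I := ∫ y, w y ∂sphereUniform with hI
  set K : ℝ := 2 ^ ((n + 1) * n) * pmom n * (n + 1).factorial with hK
  have hKpos : 0 < K := by have := pmom_pos n; positivity
  have hmeas : Measurable (ensembleDensity (n + 1)) := by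
    unfold ensembleDensity; exact hdc.measurable.ennreal_ofReal
  have hnorm : ∫⁻ x, ensembleDensity (n + 1) x ∂(Measure.pi fun _ => sphereUniform) = ENNReal.ofReal K := by
    unfold ensembleDensity
    rw [← ofReal_integral_eq_lintegral_ofReal (S2pi_integrable hdc)
      (Filter.Eventually.of_forall fun x => Finset.prod_nonneg fun _ _ => dist_nonneg)]
    congr 1
    have := ens_int n (h := fun _ => 1) (by fun_prop)
    simp only [Finset.prod_const_one, mul_one] at this
    rw [this, mat_one]; simp [hK]
  have hexp : ∀ x : Fin (n + 1) → S2, exp ((∑ i, w (x i)) - (n + 1 : ℕ) * I) =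
      (∏ i, exp (w (x i))) * exp (-((n + 1 : ℕ) * I)) := by
    intro x; rw [← exp_sum, ← exp_add]; ring_nf
  unfold sphericalEnsemble
  rw [lintegral_smul_measure, hnorm, lintegral_withDensity_eq_lintegral_mul _ hmeas (by
    apply Measurable.ennreal_ofReal
    apply Continuous.measurable
    fun_prop)]
  have hint : ∫⁻ x, (ensembleDensity (n + 1) * fun x : Fin (n + 1) → S2 => ENNReal.ofReal
        (exp ((∑ i, w (x i)) - (n + 1 : ℕ) * I))) x ∂(Measure.pi fun _ => sphereUniform) =
      ENNReal.ofReal (K * (Mat n (fun z => exp (w (hopfS z)))).det.re * exp (-((n + 1 : ℕ) * I))) := by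
    have h1 := ens_int n (h := fun x => exp (w x)) (by fun_prop)
    rw [← hK] at h1
    rw [← h1, ← integral_mul_const, ofReal_integral_eq_lintegral_ofReal]
    · congr 1; ext x
      simp only [Pi.mul_apply, ensembleDensity]
      rw [← ENNReal.ofReal_mul (Finset.prod_nonneg fun _ _ => dist_nonneg), hexp, mul_assoc]
    · exact S2pi_integrable (by fun_prop)
    · refine Filter.Eventually.of_forall fun x => ?_
      exact mul_nonneg (mul_nonneg (Finset.prod_nonneg fun _ _ => dist_nonneg)
        (Finset.prod_nonneg fun _ _ => (exp_pos _).le)) (exp_pos _).le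
  rw [hint, smul_eq_mul, ← ENNReal.ofReal_inv_of_pos hKpos, ← ENNReal.ofReal_mul (by positivity)]
  apply ENNReal.ofReal_le_ofReal
  have hd := det_final n hw
  rw [← hI] at hd
  rw [sob_eq, mul_assoc, inv_mul_cancel_left₀ hKpos.ne']
  calc _ ≤ exp ((n + 1) * I + sb w / 2) * exp (-((n + 1 : ℕ) * I)) :=
        mul_le_mul_of_nonneg_right hd (exp_pos _).le
    _ = _ := by
      rw [← exp_add]
      congr 1
      push_cast
      have := Real.pi_ne_zero
      field_simp
      ring
end

noncomputable section

/-- Moser–Trudinger type sub-Gaussian bound for the spherical ensemble: for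
every positive integer `N` and every smooth `w : X → ℝ`,
`𝔼_N[exp(Σ_i w(x_i) − N ∫ w dσ)] ≤ exp((1/(8π)) ∫ |∇_g w|² dV_g)`, where
`∫ |∇_g w|² dV_g = ∫ w Δ_g w dV_g = ‖w‖²_{H¹(X)}` is the squared `H¹`-norm of `w`. -/
theorem spherical_ensemble_subgaussian (N : ℕ) (hN : 0 < N) (w : S2 → ℝ)
    (hw : SmoothOnSphere w) :
    ∫⁻ x, ENNReal.ofReal
        (Real.exp ((∑ i, w (x i)) - N * ∫ y, w y ∂sphereUniform))
        ∂(sphericalEnsemble N) ≤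
      ENNReal.ofReal (Real.exp (1 / (8 * π) * sobNormSq 1 w)) := by
  exact final_aux N hN w hw

end
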